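/- Let X ⊂ ℙ^r be an irreducible, non-degenerate, normal variety of dimension n ≥ 2 which is a scroll over a curve. Then either X is smooth or X is a cone. -/

import Mathlib

/-!
Basic vocabulary of complex projective algebraic geometry, built on
`Projectivization ℂ (Fin (r+1) → ℂ)` and homogeneous multivariate polynomials.
-/

noncomputable section

open MvPolynomial

/-- Complex projective `r`-space. -/
abbrev Pt (r : ℕ) : Type := Projectivization ℂ (Fin (r + 1) → ℂ)

namespace ProjGeo

variable {r s : ℕ}

/-- A (homogeneous) polynomial vanishes at a point of projective space. -/
def VanishesAt (p : MvPolynomial (Fin (r + 1)) ℂ) (x : Pt r) : Prop :=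
  ∀ (v : Fin (r + 1) → ℂ) (hv : v ≠ 0), Projectivization.mk ℂ v hv = x → eval v p = 0

/-- Common zero locus of a family of polynomials. -/
def ZeroLocus (S : Set (MvPolynomial (Fin (r + 1)) ℂ)) : Set (Pt r) :=
  {x | ∀ p ∈ S, VanishesAt p x}

/-- A subset of projective space is algebraic (Zariski closed) if it is the common
zero locus of a set of homogeneous polynomials. -/
def IsAlgSet (X : Set (Pt r)) : Prop :=
  ∃ S : Set (MvPolynomial (Fin (r + 1)) ℂ),
    (∀ p ∈ S, ∃ d, p.IsHomogeneous d) ∧ X = ZeroLocus S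

/-- Zariski closure. -/
def zcl (A : Set (Pt r)) : Set (Pt r) := ⋂₀ {Y | IsAlgSet Y ∧ A ⊆ Y}

/-- An irreducible (projective) variety: a nonempty algebraic set which is not
contained in the union of two algebraic sets unless it is contained in one of them. -/
def IsIrrVar (X : Set (Pt r)) : Prop :=
  X.Nonempty ∧ IsAlgSet X ∧
    ∀ Y Z : Set (Pt r), IsAlgSet Y → IsAlgSet Z → X ⊆ Y ∪ Z → X ⊆ Y ∨ X ⊆ Z

/-- `DimGE X n` : `X` has dimension at least `n`, measured by chains of irreducible
subvarieties of length `n+1`. -/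
def DimGE (X : Set (Pt r)) (n : ℕ) : Prop :=
  ∃ c : Fin (n + 1) → Set (Pt r),
    (∀ i, IsIrrVar (c i) ∧ c i ⊆ X) ∧ ∀ i j : Fin (n + 1), i < j → c i ⊂ c j

/-- `X` has dimension exactly `n`. -/
def HasDim (X : Set (Pt r)) (n : ℕ) : Prop := DimGE X n ∧ ¬ DimGE X (n + 1)

/-- Local dimension at a point is at least `n`. -/
def DimGEAt (X : Set (Pt r)) (x : Pt r) (n : ℕ) : Prop :=
  ∃ c : Fin (n + 1) → Set (Pt r),
    (∀ i, IsIrrVar (c i) ∧ c i ⊆ X) ∧ x ∈ c 0 ∧ ∀ i j : Fin (n + 1), i < j → c i ⊂ c j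

/-- The linear subspace of projective space associated to a linear subspace `W`. -/
def projSub (W : Submodule ℂ (Fin (r + 1) → ℂ)) : Set (Pt r) :=
  {x | x.submodule ≤ W}

/-- The linear span of a set of points. -/
def projSpan (A : Set (Pt r)) : Submodule ℂ (Fin (r + 1) → ℂ) :=
  ⨆ x ∈ A, x.submodule

/-- Non-degenerate: not contained in any hyperplane. -/
def Nondeg (X : Set (Pt r)) : Prop := projSpan X = ⊤

/-- A property `Q` holds at the general point of `X` : it holds away from some
algebraic set not containing `X`. -/
def Generic (X : Set (Pt r)) (Q : Pt r → Prop) : Prop :=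
  ∃ A : Set (Pt r), IsAlgSet A ∧ ¬ X ⊆ A ∧ ∀ x ∈ X \ A, Q x

/-- The line through two (distinct) points. -/
def lineThrough (x y : Pt r) : Set (Pt r) :=
  projSub (x.submodule ⊔ y.submodule)

/-- `L` is a (proper) secant line of `X`. -/
def SecLine (X : Set (Pt r)) (L : Set (Pt r)) : Prop :=
  ∃ x ∈ X, ∃ y ∈ X, x ≠ y ∧ L = lineThrough x y

/-- The secant variety: Zariski closure of the union of all secant lines. -/
def SecVar (X : Set (Pt r)) : Set (Pt r) :=
  zcl {p | ∃ L, SecLine X L ∧ p ∈ L}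

/-- An irreducible, non-degenerate projective variety of dimension `n`. -/
def IsVariety (n : ℕ) (X : Set (Pt r)) : Prop :=
  IsIrrVar X ∧ HasDim X n ∧ Nondeg X

/-- A variety with one apparent double point: an irreducible non-degenerate,
non secant defective variety `X ⊆ ℙ^{2n+1}` of dimension `n` such that through the
general point of `ℙ^{2n+1}` there passes exactly one secant line of `X`. -/
def IsOADP (n : ℕ) (X : Set (Pt (2 * n + 1))) : Prop :=
  IsVariety n X ∧ SecVar X = Set.univ ∧
    Generic Set.univ (fun p => ∃! L : Set (Pt (2 * n + 1)), SecLine X L ∧ p ∈ L)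

/-- Projective equivalence of two subsets of the same projective space. -/
def ProjEquiv (X Y : Set (Pt r)) : Prop :=
  ∃ g : (Fin (r + 1) → ℂ) ≃ₗ[ℂ] (Fin (r + 1) → ℂ),
    Y = Projectivization.map (g : (Fin (r + 1) → ℂ) →ₗ[ℂ] (Fin (r + 1) → ℂ)) g.injective '' X

end ProjGeo
namespace ProjGeo

variable {r s n : ℕ}

/-- The rational map `ℙ^r ⇢ ℙ^s` induced by a linear map, as a relation between points. -/
def pproj (f : (Fin (r + 1) → ℂ) →ₗ[ℂ] (Fin (s + 1) → ℂ)) (x : Pt r) (y : Pt s) : Prop :=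
  ∃ (v : Fin (r + 1) → ℂ) (hv : v ≠ 0), Projectivization.mk ℂ v hv = x ∧
    ∃ h : f v ≠ 0, y = Projectivization.mk ℂ (f v) h

/-- The rational map given by a tuple of (homogeneous, same degree) polynomials,
as a relation between points. -/
def ratMapRel (F : Fin (s + 1) → MvPolynomial (Fin (r + 1)) ℂ) (x : Pt r) (y : Pt s) : Prop :=
  ∃ (v : Fin (r + 1) → ℂ) (hv : v ≠ 0), Projectivization.mk ℂ v hv = x ∧
    ∃ h : (fun j => MvPolynomial.eval v (F j)) ≠ 0,
      y = Projectivization.mk ℂ (fun j => MvPolynomial.eval v (F j)) h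

/-- Two (sub)varieties are birationally equivalent: there are rational maps, given by
homogeneous polynomials, which are mutually inverse at the general points. -/
def AreBirational (X : Set (Pt r)) (Y : Set (Pt s)) : Prop :=
  ∃ (d e : ℕ) (F : Fin (s + 1) → MvPolynomial (Fin (r + 1)) ℂ)
    (G : Fin (r + 1) → MvPolynomial (Fin (s + 1)) ℂ),
    (∀ j, (F j).IsHomogeneous d) ∧ (∀ i, (G i).IsHomogeneous e) ∧
    (∃ A, IsAlgSet A ∧ ¬ X ⊆ A ∧
      ∀ x ∈ X \ A, ∃ y ∈ Y, ratMapRel F x y ∧ ratMapRel G y x) ∧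
    (∃ B, IsAlgSet B ∧ ¬ Y ⊆ B ∧
      ∀ y ∈ Y \ B, ∃ x ∈ X, ratMapRel G y x ∧ ratMapRel F x y)

/-- A variety is rational if it is birational to `ℙ^n`. -/
def IsRationalVar (n : ℕ) (X : Set (Pt r)) : Prop :=
  AreBirational X (Set.univ : Set (Pt n))

/-- The homogeneous ideal (as a set of homogeneous polynomials) of a set. -/
def homIdeal (X : Set (Pt r)) : Set (MvPolynomial (Fin (r + 1)) ℂ) :=
  {p | (∃ d, p.IsHomogeneous d) ∧ ∀ x ∈ X, VanishesAt p x}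

/-- Directional derivative of a polynomial at `v` in direction `w`. -/
def diffAt (p : MvPolynomial (Fin (r + 1)) ℂ) (v w : Fin (r + 1) → ℂ) : ℂ :=
  ∑ i, w i * MvPolynomial.eval v (MvPolynomial.pderiv i p)

/-- The (cone over the) embedded projective tangent space of `X` at `x`: the common kernel
of the differentials at `x` of all elements of the homogeneous ideal of `X`. -/
def embTangent (X : Set (Pt r)) (x : Pt r) : Submodule ℂ (Fin (r + 1) → ℂ) :=
  ⨅ p ∈ homIdeal X,
    LinearMap.ker (∑ i, MvPolynomial.eval x.rep (MvPolynomial.pderiv i p) •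
      (LinearMap.proj i : (Fin (r + 1) → ℂ) →ₗ[ℂ] ℂ))

/-- `X` (of dimension `n`) is smooth: at each of its points the embedded tangent
space has the expected dimension. -/
def SmoothOfDim (n : ℕ) (X : Set (Pt r)) : Prop :=
  ∀ x ∈ X, Module.finrank ℂ (embTangent X x) = n + 1

/-- The linear projection induced by `f` restricts to a birational map from `X`
onto `ℙ^n`: it is dominant and generically injective on `X`. -/
def BirationalProjTo (n : ℕ) (f : (Fin (r + 1) → ℂ) →ₗ[ℂ] (Fin (n + 1) → ℂ))
    (X : Set (Pt r)) : Prop :=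
  zcl {y | ∃ x ∈ X, pproj f x y} = Set.univ ∧
  ∃ A, IsAlgSet A ∧ ¬ X ⊆ A ∧
    ∀ x₁ ∈ X \ A, ∀ x₂ ∈ X \ A, ∀ y, pproj f x₁ y → pproj f x₂ y → x₁ = x₂

/-- `f` realizes the tangential projection of `X ⊆ ℙ^{2n+1}` at `x`: it is the linear
projection from the embedded tangent space at `x` onto `ℙ^n`. -/
def TangentProjection (n : ℕ) (X : Set (Pt (2 * n + 1))) (x : Pt (2 * n + 1))
    (f : (Fin (2 * n + 2) → ℂ) →ₗ[ℂ] (Fin (n + 1) → ℂ)) : Prop :=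
  Function.Surjective f ∧ LinearMap.ker f = embTangent X x

/-- A Bronowski variety: an irreducible non-degenerate `n`-dimensional variety
`X ⊆ ℙ^{2n+1}` whose tangential projection at the general point is birational onto `ℙ^n`. -/
def IsBronowski (n : ℕ) (X : Set (Pt (2 * n + 1))) : Prop :=
  IsVariety n X ∧
  Generic X (fun x =>
    Module.finrank ℂ (embTangent X x) = n + 1 ∧
    ∀ f, TangentProjection n X x f → BirationalProjTo n f X)

end ProjGeo
namespace ProjGeo

variable {r : ℕ}

/-- The homogeneous coordinate ring of (the affine cone over) `X`. -/
def coneRing (X : Set (Pt r)) : Type :=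
  MvPolynomial (Fin (r + 1)) ℂ ⧸ Ideal.span (homIdeal X)

noncomputable instance (X : Set (Pt r)) : CommRing (coneRing X) :=
  Ideal.Quotient.commRing _

/-- `X` is a normal variety: the local ring of the affine cone over `X` at every prime
away from the vertex (i.e. not containing the irrelevant ideal) is integrally closed
in its total fraction ring. -/
def IsNormalVar (X : Set (Pt r)) : Prop :=
  ∀ (P : Ideal (coneRing X)) (hP : P.IsPrime),
    (∃ i : Fin (r + 1),
        Ideal.Quotient.mk (Ideal.span (homIdeal X)) (MvPolynomial.X i) ∉ P) →
    integralClosure (Localization (@Ideal.primeCompl _ _ P hP))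
      (FractionRing (Localization (@Ideal.primeCompl _ _ P hP))) = ⊥

end ProjGeo
namespace ProjGeo

variable {r : ℕ}

/-- Partial sums `∑_{k<i} (a k + 1)` for the block structure of a rational normal scroll. -/
def scrollCum (n : ℕ) (a : Fin n → ℕ) (i : ℕ) : ℕ :=
  ∑ k ∈ Finset.univ.filter (fun k : Fin n => (k : ℕ) < i), (a k + 1)

/-- The parametrizing vector of the rational normal scroll `S(a 0, …, a (n-1))`:
for this to live in `ℙ^{2n+1}` one needs `∑ a i = n + 2`. -/
def scrollVec (n : ℕ) (a : Fin n → ℕ) (s t : ℂ) (u : Fin n → ℂ) : Fin (2 * n + 2) → ℂ :=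
  fun j =>
    let b := Nat.findGreatest (fun i => scrollCum n a i ≤ (j : ℕ)) (n - 1)
    if hb : b < n then
      u ⟨b, hb⟩ * s ^ (a ⟨b, hb⟩ - ((j : ℕ) - scrollCum n a b)) * t ^ ((j : ℕ) - scrollCum n a b)
    else 0

/-- The standard rational normal scroll `S(a 0, …, a (n-1)) ⊆ ℙ^{2n+1}`
(with `∑ a i = n + 2`), the closure of the image of the standard parametrization. -/
def stdScroll (n : ℕ) (a : Fin n → ℕ) : Set (Pt (2 * n + 1)) :=
  zcl {p | ∃ s t : ℂ, ∃ u : Fin n → ℂ, ∃ h : scrollVec n a s t u ≠ 0,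
    p = Projectivization.mk ℂ (scrollVec n a s t u) h}

/-- `X` is a (smooth) rational normal scroll of dimension `n` in `ℙ^{2n+1}`:
projectively equivalent to a standard scroll `S(a_1, …, a_n)` with all `a_i ≥ 1`. -/
def IsRationalNormalScroll (n : ℕ) (X : Set (Pt (2 * n + 1))) : Prop :=
  ∃ a : Fin n → ℕ, (∀ i, 1 ≤ a i) ∧ (∑ i, a i) = n + 2 ∧ ProjEquiv X (stdScroll n a)

/-- `X` (of dimension `n`) is a scroll over a curve: it is swept out by an infinite
(i.e. positive dimensional) family of linear spaces of dimension `n-1` contained in it. -/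
def IsScrollOverCurve (n : ℕ) (X : Set (Pt r)) : Prop :=
  ∃ F : Set (Submodule ℂ (Fin (r + 1) → ℂ)), F.Infinite ∧
    (∀ W ∈ F, Module.finrank ℂ W = n ∧ projSub W ⊆ X) ∧
    X = zcl (⋃ W ∈ F, projSub W)

/-- `X` is a cone: there is a vertex `v ∈ X` such that `X` contains the line joining
`v` to any of its points. -/
def IsCone (X : Set (Pt r)) : Prop :=
  ∃ v : Pt r, v ∈ X ∧ ∀ x ∈ X, lineThrough v x ⊆ X

end ProjGeo

/-!
STATEMENT 10: Let `X ⊂ ℙ^r` be an irreducible, non-degenerate, normal variety of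
dimension `n ≥ 2` which is a scroll over a curve. Then either `X` is smooth or `X`
is a cone.
-/

section
open MvPolynomial

namespace ScrollPf

/-- Nullstellensatz: a f.g. domain over ℂ has a ℂ-point where a given nonzero element is nonzero. -/
lemma exists_point {C : Type*} [CommRing C] [IsDomain C] [Algebra ℂ C] [Algebra.FiniteType ℂ C]
    (c : C) (hc : c ≠ 0) : ∃ ψ : C →ₐ[ℂ] ℂ, ψ c ≠ 0 := by
  have : IsJacobsonRing C := isJacobsonRing_of_finiteType (A := ℂ)
  have hJ : (⊥ : Ideal C).jacobson = ⊥ := by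
    exact IsJacobsonRing.out ‹_› (Ideal.isPrime_bot (α := C)).isRadical
  have : ∃ M : Ideal C, M.IsMaximal ∧ c ∉ M := by
    by_contra hcon
    push Not at hcon
    apply hc
    have : c ∈ (⊥ : Ideal C).jacobson := by
      rw [Ideal.jacobson, Ideal.mem_sInf]
      intro M hM
      exact hcon M hM.2
    rw [hJ] at this
    simpa using this
  obtain ⟨M, hM, hcM⟩ := this
  let := Ideal.Quotient.field M
  have : Algebra.FiniteType ℂ (C ⧸ M) := inferInstance
  have hf : Module.Finite ℂ (C ⧸ M) := finite_of_finite_type_of_isJacobsonRing _ _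
  have hb : Function.Bijective (algebraMap ℂ (C ⧸ M)) :=
    IsAlgClosed.algebraMap_bijective_of_isIntegral
  let e : ℂ ≃ₐ[ℂ] (C ⧸ M) := AlgEquiv.ofBijective (Algebra.ofId _ _) hb
  refine ⟨(e.symm : (C ⧸ M) →ₐ[ℂ] ℂ).comp (Ideal.Quotient.mkₐ ℂ M), ?_⟩
  intro h
  apply hcM
  have : Ideal.Quotient.mk M c = 0 := by
    apply e.symm.injective
    simpa using h
  exact Ideal.Quotient.eq_zero_iff_mem.mp this

lemma algHom_eq_of_ker_le {B : Type*} [CommRing B] [Algebra ℂ B] (φ χ : B →ₐ[ℂ] ℂ)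
    (h : ∀ b, χ b = 0 → φ b = 0) : χ = φ := by
  ext b
  have : φ (b - algebraMap ℂ B (χ b)) = 0 := by
    apply h; simp
  simp at this
  exact (sub_eq_zero.mp this).symm

/-- Lemma (E): generic extension of points along an injective map of f.g. domains. -/
lemma extend_point {B C : Type*} [CommRing B] [IsDomain B] [Algebra ℂ B]
    [Algebra.FiniteType ℂ B] [CommRing C] [IsDomain C] [Algebra ℂ C] [Algebra.FiniteType ℂ C]
    (f : B →ₐ[ℂ] C) (hf : Function.Injective f) (c : C) (hc : c ≠ 0) :
    ∃ b : B, b ≠ 0 ∧ ∀ φ : B →ₐ[ℂ] ℂ, φ b ≠ 0 →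
      ∃ ψ : C →ₐ[ℂ] ℂ, ψ.comp f = φ ∧ ψ c ≠ 0 := by
  have : IsNoetherianRing B := Algebra.FiniteType.isNoetherianRing ℂ B
  have hft : f.toRingHom.FiniteType := by
    let := f.toRingHom.toAlgebra
    have : IsScalarTower ℂ B C := IsScalarTower.of_algebraMap_eq (fun x => (f.commutes x).symm)
    exact (Algebra.FiniteType.of_restrictScalars_finiteType ℂ B C)
  have hfp : f.toRingHom.FinitePresentation := RingHom.FinitePresentation.of_finiteType.mp hft
  have hcon := PrimeSpectrum.isConstructible_comap_image hfp
    (s := (PrimeSpectrum.basicOpen c : Set (PrimeSpectrum C)))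
    ((PrimeSpectrum.isCompact_basicOpen c).isConstructible (PrimeSpectrum.basicOpen c).isOpen)
  obtain ⟨D, hD⟩ := PrimeSpectrum.exists_constructibleSetData_iff.mpr hcon
  have hgen : (⊥ : PrimeSpectrum B) ∈ D.toSet := by
    rw [hD]
    refine ⟨⊥, ?_, ?_⟩
    · simpa [PrimeSpectrum.mem_basicOpen] using hc
    · ext x
      simp [PrimeSpectrum.comap]
      exact map_eq_zero_iff _ hf
  simp only [PrimeSpectrum.ConstructibleSetData.toSet, Set.mem_iUnion] at hgen
  obtain ⟨T, hT, hbT⟩ := hgen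
  have hg : ∀ i, T.g i = 0 := by
    intro i
    have := hbT.1 (Set.mem_range_self i)
    simpa using this
  have hTf : T.f ≠ 0 := by
    have := hbT.2
    simpa [PrimeSpectrum.mem_zeroLocus] using this
  refine ⟨T.f, hTf, ?_⟩
  intro φ hφ
  let p : PrimeSpectrum B := ⟨RingHom.ker φ, RingHom.ker_isPrime _⟩
  have hp : p ∈ D.toSet := by
    simp only [PrimeSpectrum.ConstructibleSetData.toSet, Set.mem_iUnion]
    refine ⟨T, hT, ?_, ?_⟩
    · rintro _ ⟨i, rfl⟩
      rw [hg i]; exact zero_mem _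
    · simpa [PrimeSpectrum.mem_zeroLocus, p] using hφ
  rw [hD] at hp
  obtain ⟨q, hq, hqp⟩ := hp
  have hqc : Ideal.Quotient.mk q.asIdeal c ≠ 0 := by
    rw [Ne, Ideal.Quotient.eq_zero_iff_mem]; exact hq
  obtain ⟨χ, hχ⟩ := exists_point (C := C ⧸ q.asIdeal) _ hqc
  refine ⟨χ.comp (Ideal.Quotient.mkₐ ℂ q.asIdeal), ?_, by simpa using hχ⟩
  symm
  apply algHom_eq_of_ker_le
  intro b hb
  have : b ∈ p.asIdeal := hb
  rw [← hqp] at this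
  have h2 : Ideal.Quotient.mk q.asIdeal (f b) = 0 := Ideal.Quotient.eq_zero_iff_mem.mpr this
  simp [h2]

end ScrollPf

end

section
open MvPolynomial

namespace ScrollPf

lemma dom_val {O K : Type*} [CommRing O] [IsDomain O] [IsLocalRing O] [IsIntegrallyClosed O]
    [Field K] [Algebra O K] [IsFractionRing O K] (x : K) (hx : ∀ a : O, algebraMap O K a ≠ x) :
    ∃ (Vr : ValuationSubring K) (j : O →+* Vr), (∀ a, (j a : K) = algebraMap O K a) ∧
      (∀ a ∈ IsLocalRing.maximalIdeal O, j a ∈ IsLocalRing.maximalIdeal Vr) ∧ x ∉ Vr := by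
  let L : LocalSubring K := LocalSubring.range (algebraMap O K)
  have hL : ∀ y, y ∈ L.toSubring ↔ ∃ a, algebraMap O K a = y := fun y => Iff.rfl
  have hxL : x ∉ L.toSubring := by
    rw [hL]; push Not; exact hx
  have : IsIntegrallyClosedIn L.toSubring K := by
    rw [Subring.isIntegrallyClosedIn_iff]
    intro y hy
    rw [hL]
    have : IsIntegral O y := by
      obtain ⟨p, hp, hpy⟩ := hy
      have hlift : p ∈ Polynomial.lifts ((algebraMap O K).codRestrict L.toSubring
          (fun a => (hL _).2 ⟨a, rfl⟩)) := by
        rw [Polynomial.lifts_iff_coeff_lifts]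
        intro k
        obtain ⟨a, ha⟩ := (hL _).1 (p.coeff k).2
        exact ⟨a, Subtype.ext ha⟩
      obtain ⟨q, hq, -, hqm⟩ := Polynomial.lifts_and_natDegree_eq_and_monic hlift hp
      refine ⟨q, hqm, ?_⟩
      rw [← hq, Polynomial.eval₂_map] at hpy
      exact hpy
    exact IsIntegrallyClosed.isIntegral_iff.mp this
  obtain ⟨V, hV, hxV⟩ := LocalSubring.exists_le_valuationSubring_of_isIntegrallyClosedIn hxL
  refine ⟨V, (algebraMap O K).codRestrict V.toSubring (fun a => hV.1 ((hL _).2 ⟨a, rfl⟩)),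
    fun a => rfl, ?_, hxV⟩
  intro a ha
  rw [IsLocalRing.mem_maximalIdeal] at ha ⊢
  intro hu
  apply ha
  obtain ⟨hle, hloc⟩ := hV
  have h1 := hloc.map_nonunit (⟨algebraMap O K a, (hL _).2 ⟨a, rfl⟩⟩ : L.toSubring) hu
  obtain ⟨b, hb⟩ := h1.exists_right_inv
  obtain ⟨b', hb'⟩ := (hL _).1 b.2
  have : algebraMap O K (a * b') = algebraMap O K 1 := by
    rw [map_mul, hb', map_one]
    exact congrArg Subtype.val hb
  exact IsUnit.of_mul_eq_one _ (IsFractionRing.injective O K this)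

lemma dvd_or_dvd {O : Type*} [CommRing O] [IsDomain O] [IsLocalRing O] [IsIntegrallyClosed O]
    [Algebra ℂ O] (f g : O) (hf : f ∈ IsLocalRing.maximalIdeal O)
    (P : MvPolynomial (Fin 2) ℂ) (hP : P ≠ 0) (hPfg : aeval ![f, g] P = 0) :
    f ∣ g ∨ g ∣ f := by
  classical
  by_contra hcon
  push Not at hcon
  obtain ⟨h1, h2⟩ := hcon
  have hf0 : f ≠ 0 := by rintro rfl; exact h2 (dvd_zero _)
  have hg0 : g ≠ 0 := by rintro rfl; exact h1 (dvd_zero _)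
  let K := FractionRing O
  let ι := algebraMap O K
  have hι : Function.Injective ι := IsFractionRing.injective O K
  have hιf : ι f ≠ 0 := fun h => hf0 (hι (by simpa using h))
  have hιg : ι g ≠ 0 := fun h => hg0 (hι (by simpa using h))
  set h : K := ι g / ι f with hh
  have hgf : ι g = h * ι f := (div_mul_cancel₀ _ hιf).symm
  have hnot : ∀ a : O, ι a ≠ h := by
    intro a ha
    apply h1
    refine ⟨a, hι ?_⟩
    rw [map_mul, ha, hgf, mul_comm]
  have hnot' : ∀ a : O, ι a * h ≠ 1 := by
    intro a ha
    apply h2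
    refine ⟨a, hι ?_⟩
    rw [map_mul, hgf]
    calc ι f = (ι a * h) * ι f := by rw [ha, one_mul]
      _ = _ := by ring
  -- the minimal degree
  have hne : P.support.Nonempty := by simpa using hP
  obtain ⟨s₀, hs₀, hmin⟩ := P.support.exists_min_image (fun s => s 0 + s 1) hne
  set d := s₀ 0 + s₀ 1
  let Q : Polynomial ℂ := ∑ s ∈ P.support with s 0 + s 1 = d, Polynomial.monomial (s 1) (coeff s P)
  have hQ0 : Q ≠ 0 := by
    intro h0
    have : Q.coeff (s₀ 1) = coeff s₀ P := by
      simp only [Q, Polynomial.finsetSum_coeff, Polynomial.coeff_monomial]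
      rw [Finset.sum_eq_single s₀]
      · simp
      · intro s hs hne
        rw [if_neg]
        intro hs1
        apply hne
        rw [Finset.mem_filter] at hs
        ext i
        fin_cases i
        · simp; omega
        · simpa using hs1
      · intro hs; exact absurd (Finset.mem_filter.2 ⟨hs₀, (rfl : s₀ 0 + s₀ 1 = d)⟩) hs
    rw [h0] at this
    simp at this
    exact (mem_support_iff.mp hs₀) this.symm
  have key : ∀ c : ℂ, Q.eval c = 0 := by
    intro c
    let cK : K := ι (algebraMap ℂ O c)
    have hhc : h - cK ≠ 0 := fun h0 => hnot _ (sub_eq_zero.mp h0).symm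
    have hx : ∀ a : O, ι a ≠ (h - cK)⁻¹ := by
      intro a ha
      have ha' : ι a * (h - cK) = 1 := by rw [ha]; exact inv_mul_cancel₀ hhc
      by_cases hu : IsUnit a
      · obtain ⟨b, hb⟩ := hu.exists_right_inv
        apply hnot (b + algebraMap ℂ O c)
        have hb' : ι a * ι b = 1 := by rw [← map_mul, hb, map_one]
        have : ι b = h - cK := by
          calc ι b = (ι a * (h - cK)) * ι b := by rw [ha', one_mul]
            _ = (ι a * ι b) * (h - cK) := by ring
            _ = _ := by rw [hb', one_mul]
        rw [map_add, this]; ring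
      · have hu2 : IsUnit (1 + algebraMap ℂ O c * a) := by
          have : algebraMap ℂ O c * a ∈ IsLocalRing.maximalIdeal O :=
            Ideal.mul_mem_left _ _ ((IsLocalRing.mem_maximalIdeal _).2 hu)
          by_contra hcon
          have h3 := (IsLocalRing.mem_maximalIdeal _).2 hcon
          have h4 := Ideal.sub_mem _ h3 this
          simp at h4
        obtain ⟨b, hb⟩ := hu2.exists_right_inv
        apply hnot' (a * b)
        have hb' : (1 + cK * ι a) * ι b = 1 := by
          have := congrArg ι hb
          simpa using this
        have : ι a * h = 1 + cK * ι a := by linear_combination ha'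
        rw [map_mul]
        calc ι a * ι b * h = (ι a * h) * ι b := by ring
          _ = 1 := by rw [this, hb']
    obtain ⟨V, j, hj, hjm, hxV⟩ := dom_val (O := O) (K := K) _ hx
    have hhcV : h - cK ∈ V := by
      have := V.mem_or_inv_mem (h - cK)
      tauto
    have hjι : ∀ a, (j a : K) = ι a := hj
    let z : V := ⟨h - cK, hhcV⟩
    have hz : z ∈ IsLocalRing.maximalIdeal V := by
      rw [IsLocalRing.mem_maximalIdeal]
      intro hu
      obtain ⟨b, hb⟩ := hu.exists_right_inv
      apply hxV
      have hb' : (h - cK) * (b : K) = 1 := congrArg Subtype.val hb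
      have : (h - cK)⁻¹ = b := inv_eq_of_mul_eq_one_right hb'
      rw [this]; exact b.2
    let hV : V := z + j (algebraMap ℂ O c)
    have hhV : (hV : K) = h := by
      change (h - cK) + (j (algebraMap ℂ O c) : K) = h
      rw [hj]; simp [cK, ι]
    have hsum : ∑ s ∈ P.support, j (algebraMap ℂ O (coeff s P)) *
        (j f ^ (s 0 + s 1 - d) * hV ^ (s 1)) = 0 := by
      apply Subtype.coe_injective
      have h5 : ι (aeval ![f, g] P) = 0 := by rw [hPfg, map_zero]
      rw [aeval_def, eval₂_eq', map_sum] at h5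
      simp only [Fin.prod_univ_two, map_mul, map_pow] at h5
      simp only [Matrix.cons_val_zero, Matrix.cons_val_one] at h5
      have h6 : ι f ^ d * (∑ s ∈ P.support, ι (algebraMap ℂ O (coeff s P)) *
        (ι f ^ (s 0 + s 1 - d) * h ^ (s 1))) = 0 := by
        rw [Finset.mul_sum, ← h5]
        apply Finset.sum_congr rfl
        intro s hs
        have := hmin s hs
        have h7 : ι f ^ (s 0 + s 1) = ι f ^ d * ι f ^ (s 0 + s 1 - d) := by
          rw [← pow_add]; congr 1; omega
        rw [hgf, mul_pow]
        calc _ = ι (algebraMap ℂ O (coeff s P)) * h ^ (s 1) *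
              (ι f ^ d * ι f ^ (s 0 + s 1 - d)) := by ring
          _ = _ := by rw [← h7, pow_add]; ring
      have h8 := (mul_eq_zero.mp h6).resolve_left (pow_ne_zero _ hιf)
      have : ∀ (S : Finset (Fin 2 →₀ ℕ)), ((∑ s ∈ S, j (algebraMap ℂ O (coeff s P)) *
        (j f ^ (s 0 + s 1 - d) * hV ^ (s 1)) : V) : K) = ∑ s ∈ S, ι (algebraMap ℂ O (coeff s P)) *
        (ι f ^ (s 0 + s 1 - d) * h ^ (s 1)) := by
        intro S
        simp [hjι, hhV]
      exact (this _).trans h8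
    let ρ := IsLocalRing.residue V
    have hρf : ρ (j f) = 0 := Ideal.Quotient.eq_zero_iff_mem.2 (hjm f hf)
    have hρz : ρ z = 0 := Ideal.Quotient.eq_zero_iff_mem.2 hz
    let γ : ℂ →+* IsLocalRing.ResidueField V := (ρ.comp j).comp (algebraMap ℂ O)
    have hρh : ρ hV = γ c := by
      simp only [hV, map_add, hρz, zero_add]; rfl
    have h9 := congrArg ρ hsum
    rw [map_sum, map_zero] at h9
    have h10 : γ (Q.eval c) = 0 := by
      rw [← h9, Polynomial.eval_finsetSum, map_sum, Finset.sum_filter]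
      apply Finset.sum_congr rfl
      intro s hs
      have := hmin s hs
      simp only [map_mul, map_pow, hρh, hρf]
      split_ifs with h11
      · simp [h11, γ, Polynomial.eval_monomial]
      · rw [zero_pow (by omega)]; simp
    exact (map_eq_zero γ).mp h10
  apply hQ0
  apply Polynomial.funext
  intro c; simp [key c]

end ScrollPf

end

section
open MvPolynomial Matrix

namespace ScrollPf

lemma cauchy_binet_exists {n m : ℕ} {R : Type*} [CommRing R] (M : Matrix (Fin n) (Fin m) R)
    (B : Matrix (Fin m) (Fin n) R) (h : (M * B).det ≠ 0) :
    ∃ f : Fin n → Fin m, (M.submatrix id f).det ≠ 0 := by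
  by_contra hcon
  push Not at hcon
  apply h
  rw [← det_transpose]
  have h1 : (M * B)ᵀ = fun i => ∑ k, B k i • (fun j => M j k) := by
    ext i j
    simp [Matrix.mul_apply, mul_comm]
  rw [h1]
  change detRowAlternating.toMultilinearMap (fun i => ∑ k, B k i • (fun j => M j k)) = 0
  rw [MultilinearMap.map_sum]
  apply Finset.sum_eq_zero
  intro f _
  rw [MultilinearMap.map_smul_univ]
  have h2 := hcon f
  rw [← det_transpose] at h2
  have : detRowAlternating.toMultilinearMap (fun i j => M j (f i)) = 0 := h2
  rw [this, smul_zero]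

/-- chart matrix is injective on a subspace -/
def Good {n m : ℕ} (W : Submodule ℂ (Fin m → ℂ)) (l : Matrix (Fin m) (Fin n) ℂ) : Prop :=
  ∀ w ∈ W, w ᵥ* l = 0 → w = 0

lemma exists_basis_matrix {n m : ℕ} (W : Submodule ℂ (Fin m → ℂ))
    (hW : Module.finrank ℂ W = n) :
    ∃ e : Matrix (Fin n) (Fin m) ℂ, (∀ w, w ∈ W ↔ ∃ s, s ᵥ* e = w) ∧
      (∀ s, s ᵥ* e = 0 → s = 0) := by
  let b := Module.finBasisOfFinrankEq ℂ W hW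
  have hb : ∀ s : Fin n → ℂ, s ᵥ* (fun i k => (b i : Fin m → ℂ) k) =
      ((∑ i, s i • b i : W) : Fin m → ℂ) := by
    intro s
    ext k
    simp [Matrix.vecMul, dotProduct]
  refine ⟨fun i k => (b i : Fin m → ℂ) k, ?_, ?_⟩
  · intro w
    constructor
    · intro hw
      refine ⟨fun i => b.repr ⟨w, hw⟩ i, ?_⟩
      rw [hb, b.sum_repr]
    · rintro ⟨s, rfl⟩
      rw [hb]; exact Subtype.property _
  · intro s hs
    rw [hb] at hs
    have : (∑ i, s i • b i : W) = 0 := Subtype.ext hs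
    have := Fintype.linearIndependent_iff.mp b.linearIndependent s this
    ext i; exact this i

lemma good_iff {n m : ℕ} (W : Submodule ℂ (Fin m → ℂ)) (e : Matrix (Fin n) (Fin m) ℂ)
    (h1 : ∀ w, w ∈ W ↔ ∃ s, s ᵥ* e = w) (h2 : ∀ s, s ᵥ* e = 0 → s = 0)
    (l : Matrix (Fin m) (Fin n) ℂ) : Good W l ↔ (e * l).det ≠ 0 := by
  rw [Ne, ← Matrix.exists_vecMul_eq_zero_iff]
  constructor
  · rintro hg ⟨v, hv, hv0⟩
    apply hv
    apply h2
    apply hg _ ((h1 _).2 ⟨v, rfl⟩)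
    rw [vecMul_vecMul, hv0]
  · intro h w hw hw0
    obtain ⟨s, rfl⟩ := (h1 _).1 hw
    by_contra hne
    apply h
    refine ⟨s, ?_, ?_⟩
    · rintro rfl; simp at hne
    · rw [← vecMul_vecMul, hw0]

lemma good_line {n m : ℕ} (W : Submodule ℂ (Fin m → ℂ)) (hW : Module.finrank ℂ W = n)
    (l₀ l₁ : Matrix (Fin m) (Fin n) ℂ) (h : Good W l₀ ∨ Good W l₁) :
    ∃ p : Polynomial ℂ, p ≠ 0 ∧ p.natDegree ≤ n ∧
      ∀ τ, p.eval τ ≠ 0 → Good W (l₀ + τ • l₁) := by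
  obtain ⟨e, h1, h2⟩ := exists_basis_matrix W hW
  simp only [good_iff W e h1 h2] at h ⊢
  refine ⟨((Polynomial.X : Polynomial ℂ) • (e * l₁).map Polynomial.C + (e * l₀).map Polynomial.C).det,
    ?_, ?_, ?_⟩
  · intro h0
    rcases h with h | h
    · rw [← Polynomial.coeff_det_X_add_C_zero (e * l₁), h0] at h; simp at h
    · rw [← Polynomial.coeff_det_X_add_C_card _ (e * l₀), h0] at h; simp at h
  · simpa using Polynomial.natDegree_det_X_add_C_le (e * l₁) (e * l₀)
  · intro τ hτ
    convert hτ using 1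
    rw [← Polynomial.coe_evalRingHom, RingHom.map_det]
    congr 1
    ext i j
    simp [Matrix.mul_add, add_comm, -Matrix.map_mul]
    exact mul_comm _ _

lemma exists_good_coord {n m : ℕ} (W : Submodule ℂ (Fin m → ℂ))
    (hW : Module.finrank ℂ W = n) :
    ∃ f : Fin n → Fin m, Good W (Matrix.of fun (k : Fin m) (j : Fin n) => if k = f j then (1:ℂ) else 0) := by
  obtain ⟨e, h1, h2⟩ := exists_basis_matrix W hW
  simp only [good_iff W e h1 h2]
  obtain ⟨g, hg⟩ := LinearMap.exists_leftInverse_of_injective (Matrix.vecMulLinear e)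
    (by rw [LinearMap.ker_eq_bot']; exact h2)
  have : e * (LinearMap.toMatrix' g)ᵀ = 1 := by
    rw [← transpose_inj, transpose_mul, transpose_transpose, transpose_one]
    have h3 : eᵀ = LinearMap.toMatrix' (Matrix.vecMulLinear e) := by
      ext i j; simp [LinearMap.toMatrix'_apply]
    rw [h3, ← LinearMap.toMatrix'_comp, hg, LinearMap.toMatrix'_id]
  obtain ⟨f, hf⟩ := cauchy_binet_exists e _ (by rw [this]; simp)
  refine ⟨f, ?_⟩
  convert hf using 2
  ext i j
  simp [Matrix.mul_apply]

lemma exists_good_finite {n m : ℕ} (G : Set (Submodule ℂ (Fin m → ℂ))) (hG : G.Finite)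
    (hGn : ∀ W ∈ G, Module.finrank ℂ W = n) :
    ∃ l : Matrix (Fin m) (Fin n) ℂ, ∀ W ∈ G, Good W l := by
  induction G, hG using Set.Finite.induction_on with
  | empty => exact ⟨0, by simp⟩
  | @insert W G hW hG ih =>
    obtain ⟨l, hl⟩ := ih (fun W' h => hGn W' (Set.mem_insert_of_mem _ h))
    obtain ⟨f, hf⟩ := exists_good_coord W (hGn W (Set.mem_insert _ _))
    generalize (Matrix.of fun (k : Fin m) (j : Fin n) => if k = f j then (1:ℂ) else 0) = l₁ at hf
    have : ∀ W' ∈ insert W G, ∃ p : Polynomial ℂ, p ≠ 0 ∧ p.natDegree ≤ n ∧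
      ∀ τ, p.eval τ ≠ 0 → Good W' (l + τ • l₁) := by
      intro W' hW'
      apply good_line W' (hGn _ hW') l _
      rcases hW' with rfl | h
      · exact Or.inr hf
      · exact Or.inl (hl _ h)
    choose! p hp0 hpd hp using this
    have hfin : (⋃ W' ∈ insert W G, {τ | (p W').eval τ = 0}).Finite := by
      apply Set.Finite.biUnion (hG.insert W)
      intro W' hW'
      have := Polynomial.finite_setOfPred_isRoot (hp0 W' hW')
      exact this
    obtain ⟨τ, hτ⟩ := hfin.infinite_compl.nonempty
    refine ⟨_, fun W' hW' => hp W' hW' τ ?_⟩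
    intro h0
    exact hτ (Set.mem_biUnion hW' h0)

lemma exists_chart {n m : ℕ} (G T : Set (Submodule ℂ (Fin m → ℂ))) (hG : G.Finite)
    (hGn : ∀ W ∈ G, Module.finrank ℂ W = n) (hT : T.Infinite)
    (hTn : ∀ W ∈ T, Module.finrank ℂ W = n) :
    ∃ l : Matrix (Fin m) (Fin n) ℂ, (∀ W ∈ G, Good W l) ∧ {W ∈ T | Good W l}.Infinite := by
  obtain ⟨l₀, hl₀⟩ := exists_good_finite G hG hGn
  let L : (Fin n → Fin m) → Matrix (Fin m) (Fin n) ℂ :=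
    fun f => Matrix.of fun (k : Fin m) (j : Fin n) => if k = f j then (1:ℂ) else 0
  have h1 : ∃ f, {W ∈ T | Good W (L f)}.Infinite := by
    by_contra hcon
    push Not at hcon
    apply hT
    apply (Set.finite_iUnion hcon).subset
    intro W hW
    obtain ⟨f, hf⟩ := exists_good_coord W (hTn W hW)
    exact Set.mem_iUnion.2 ⟨f, hW, hf⟩
  obtain ⟨f, hf⟩ := h1
  have hG' : ∀ W' ∈ G, ∃ p : Polynomial ℂ, p ≠ 0 ∧ p.natDegree ≤ n ∧
      ∀ τ, p.eval τ ≠ 0 → Good W' (l₀ + τ • L f) :=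
    fun W' hW' => good_line W' (hGn _ hW') _ _ (Or.inl (hl₀ _ hW'))
  have hT' : ∀ W' ∈ {W ∈ T | Good W (L f)}, ∃ p : Polynomial ℂ, p ≠ 0 ∧ p.natDegree ≤ n ∧
      ∀ τ, p.eval τ ≠ 0 → Good W' (l₀ + τ • L f) :=
    fun W' hW' => good_line W' (hTn _ hW'.1) _ _ (Or.inr hW'.2)
  choose! p hp0 hpd hp using hG'
  choose! q hq0 hqd hq using hT'
  have hfin : (⋃ W' ∈ G, {τ | (p W').eval τ = 0}).Finite := by
    apply Set.Finite.biUnion hG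
    intro W' hW'
    exact Polynomial.finite_setOfPred_isRoot (hp0 W' hW')
  obtain ⟨S, hS, hSc⟩ := hfin.infinite_compl.exists_subset_card_eq (n + 1)
  have h2 : ∃ τ : S, {W ∈ T | Good W (l₀ + (τ : ℂ) • L f)}.Infinite := by
    by_contra hcon
    push Not at hcon
    apply hf
    apply (Set.finite_iUnion hcon).subset
    intro W hW
    have : ∃ τ ∈ S, (q W).eval τ ≠ 0 := by
      by_contra hc
      push Not at hc
      apply hq0 W hW
      apply Polynomial.eq_zero_of_natDegree_lt_card_of_eval_eq_zero' _ S hc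
      rw [hSc]
      have := hqd W hW
      omega
    obtain ⟨τ, hτ, hτ0⟩ := this
    exact Set.mem_iUnion.2 ⟨⟨τ, hτ⟩, hW.1, hq W hW τ hτ0⟩
  obtain ⟨τ, hτ⟩ := h2
  refine ⟨_, fun W hW => hp W hW τ ?_, hτ⟩
  intro h0
  exact hS τ.2 (Set.mem_biUnion hW h0)

end ScrollPf

end

section
open MvPolynomial Matrix

namespace ScrollPf

/-- rulings of the affine cone defined by `I` -/
def IsRul {m : ℕ} (I : Ideal (MvPolynomial (Fin m) ℂ)) (n : ℕ)
    (W : Submodule ℂ (Fin m → ℂ)) : Prop :=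
  Module.finrank ℂ W = n ∧ ∀ w ∈ W, ∀ f ∈ I, eval w f = 0

/-- matrices whose row space is contained in the cone -/
def RulM {n m : ℕ} (I : Ideal (MvPolynomial (Fin m) ℂ)) (e : Matrix (Fin n) (Fin m) ℂ) : Prop :=
  ∀ f ∈ I, ∀ s : Fin n → ℂ, eval (s ᵥ* e) f = 0

/-- the chart -/
def E0 {n m : ℕ} (I : Ideal (MvPolynomial (Fin m) ℂ)) (l : Matrix (Fin m) (Fin n) ℂ) :
    Set (Matrix (Fin n) (Fin m) ℂ) := {e | e * l = 1 ∧ RulM I e}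

/-- row space -/
def rowSp {n m : ℕ} (e : Matrix (Fin n) (Fin m) ℂ) : Submodule ℂ (Fin m → ℂ) :=
  LinearMap.range (Matrix.vecMulLinear e)

lemma mem_rowSp {n m : ℕ} (e : Matrix (Fin n) (Fin m) ℂ) (w : Fin m → ℂ) :
    w ∈ rowSp e ↔ ∃ s, s ᵥ* e = w := by
  simp [rowSp, LinearMap.mem_range]

lemma rowSp_finrank {n m : ℕ} (e : Matrix (Fin n) (Fin m) ℂ) (h : ∀ s, s ᵥ* e = 0 → s = 0) :
    Module.finrank ℂ (rowSp e) = n := by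
  rw [rowSp, LinearMap.finrank_range_of_inj]
  · simp
  · rw [← LinearMap.ker_eq_bot, LinearMap.ker_eq_bot']; exact h

lemma inj_of_mul_eq_one {n m : ℕ} {R : Type*} [CommRing R] {e : Matrix (Fin n) (Fin m) R}
    {l : Matrix (Fin m) (Fin n) R} (h : e * l = 1) (s : Fin n → R) (hs : s ᵥ* e = 0) : s = 0 := by
  have : s ᵥ* (e * l) = 0 := by rw [← vecMul_vecMul, hs, zero_vecMul]
  rwa [h, vecMul_one] at this

lemma rowSp_isRul {n m : ℕ} {I : Ideal (MvPolynomial (Fin m) ℂ)} {e : Matrix (Fin n) (Fin m) ℂ}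
    (h : ∀ s, s ᵥ* e = 0 → s = 0) (he : RulM I e) : IsRul I n (rowSp e) := by
  refine ⟨rowSp_finrank e h, ?_⟩
  intro w hw f hf
  obtain ⟨s, rfl⟩ := (mem_rowSp e w).1 hw
  exact he f hf s

lemma E0_rowSp_inj {n m : ℕ} {I : Ideal (MvPolynomial (Fin m) ℂ)}
    {l : Matrix (Fin m) (Fin n) ℂ} : Set.InjOn rowSp (E0 I l) := by
  intro e he e' he' h
  ext i k
  have h1 : e i ∈ rowSp e := (mem_rowSp _ _).2 ⟨Pi.single i 1, by simp; rfl⟩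
  rw [h] at h1
  obtain ⟨s, hs⟩ := (mem_rowSp _ _).1 h1
  have h2 : s = Pi.single i 1 := by
    have : s ᵥ* (e' * l) = (Pi.single i 1) ᵥ* (e * l) := by
      rw [← vecMul_vecMul, hs, ← vecMul_vecMul]; simp; rfl
    rwa [he.1, he'.1, vecMul_one, vecMul_one] at this
  rw [← hs, h2]; simp

lemma exists_E0_of_good {n m : ℕ} {I : Ideal (MvPolynomial (Fin m) ℂ)}
    {l : Matrix (Fin m) (Fin n) ℂ} {W : Submodule ℂ (Fin m → ℂ)} (hW : IsRul I n W)
    (hg : Good W l) : ∃ e ∈ E0 I l, rowSp e = W := by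
  obtain ⟨e, h1, h2⟩ := exists_basis_matrix W hW.1
  rw [good_iff W e h1 h2] at hg
  have hu : IsUnit (e * l).det := isUnit_iff_ne_zero.2 hg
  have hmem : ∀ w, (∃ s, s ᵥ* ((e * l)⁻¹ * e) = w) ↔ w ∈ W := by
    intro w
    rw [h1]
    constructor
    · rintro ⟨s, rfl⟩
      exact ⟨s ᵥ* (e * l)⁻¹, by rw [vecMul_vecMul]⟩
    · rintro ⟨s, rfl⟩
      refine ⟨s ᵥ* (e * l), ?_⟩
      rw [vecMul_vecMul, ← Matrix.mul_assoc, Matrix.mul_nonsing_inv _ hu, Matrix.one_mul]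
  refine ⟨(e * l)⁻¹ * e, ⟨?_, ?_⟩, ?_⟩
  · rw [Matrix.mul_assoc, Matrix.nonsing_inv_mul _ hu]
  · intro f hf s
    exact hW.2 _ ((hmem _).1 ⟨s, rfl⟩) f hf
  · ext w
    rw [mem_rowSp, hmem]

lemma E0_infinite {n m : ℕ} {I : Ideal (MvPolynomial (Fin m) ℂ)}
    {l : Matrix (Fin m) (Fin n) ℂ} (h : {W ∈ {W | IsRul I n W} | Good W l}.Infinite) :
    (E0 I l).Infinite := by
  have : {W ∈ {W | IsRul I n W} | Good W l} ⊆ rowSp '' (E0 I l) := by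
    rintro W ⟨hW, hg⟩
    obtain ⟨e, he, rfl⟩ := exists_E0_of_good hW hg
    exact ⟨e, he, rfl⟩
  exact Set.Infinite.of_image _ (h.mono this)

/-- The properties of a one-parameter family of rulings. -/
structure Fam {n m : ℕ} (I : Ideal (MvPolynomial (Fin m) ℂ)) (l : Matrix (Fin m) (Fin n) ℂ)
    {R : Type} [CommRing R] [Algebra ℂ R] (a : Matrix (Fin n) (Fin m) R) : Prop where
  F1 : a * l.map (algebraMap ℂ R) = 1
  F2 : ∀ χ : R →ₐ[ℂ] ℂ, a.map χ ∈ E0 I l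
  F3 : Infinite (R →ₐ[ℂ] ℂ)
  F4 : Algebra.adjoin ℂ (Set.range fun p : Fin n × Fin m => a p.1 p.2) = ⊤
  F5 : ∀ g : R, g ≠ 0 → {χ : R →ₐ[ℂ] ℂ | χ g = 0}.Finite

lemma Fam.ext_hom {n m : ℕ} {I : Ideal (MvPolynomial (Fin m) ℂ)} {l : Matrix (Fin m) (Fin n) ℂ}
    {R : Type} [CommRing R] [Algebra ℂ R] {a : Matrix (Fin n) (Fin m) R} (h : Fam I l a)
    {χ χ' : R →ₐ[ℂ] ℂ} (he : a.map χ = a.map χ') : χ = χ' := by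
  apply AlgHom.ext_of_adjoin_eq_top h.F4
  rintro _ ⟨p, rfl⟩
  exact congrFun (congrFun he p.1) p.2

lemma exists_fam {n m : ℕ} (I : Ideal (MvPolynomial (Fin m) ℂ)) (l : Matrix (Fin m) (Fin n) ℂ)
    (h : (E0 I l).Infinite) :
    ∃ J : Ideal (MvPolynomial (Fin n × Fin m) ℂ), J.IsPrime ∧
      Fam I l (R := MvPolynomial (Fin n × Fin m) ℂ ⧸ J)
        (Matrix.of fun i k => Ideal.Quotient.mk J (X (i, k))) := by
  let ev : Matrix (Fin n) (Fin m) ℂ → MvPolynomial (Fin n × Fin m) ℂ →+* ℂ :=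
    fun e => eval (fun p => e p.1 p.2)
  let Z : Ideal (MvPolynomial (Fin n × Fin m) ℂ) → Set (Matrix (Fin n) (Fin m) ℂ) :=
    fun J => {e ∈ E0 I l | ∀ g ∈ J, ev e g = 0}
  have hZ : ∀ J, ∀ g, Z (J ⊔ Ideal.span {g}) = {e ∈ Z J | ev e g = 0} := by
    intro J g
    ext e
    constructor
    · rintro ⟨he, h2⟩
      exact ⟨⟨he, fun q hq => h2 q (Ideal.mem_sup_left hq)⟩,
        h2 g (Ideal.mem_sup_right (Ideal.mem_span_singleton_self g))⟩
    · rintro ⟨⟨he, h2⟩, h3⟩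
      refine ⟨he, fun q hq => ?_⟩
      have : J ⊔ Ideal.span {g} ≤ RingHom.ker (ev e) := by
        rw [sup_le_iff, Ideal.span_singleton_le_iff_mem]
        exact ⟨fun q hq => h2 q hq, h3⟩
      exact this hq
  obtain ⟨J, hJ, hmax⟩ := WellFounded.has_min
    (wellFounded_gt (α := Ideal (MvPolynomial (Fin n × Fin m) ℂ)))
    {J | (Z J).Infinite} ⟨⊥, by
      have : Z ⊥ = E0 I l := by
        ext e; simp only [Z, Set.mem_ofPred_eq, and_iff_left_iff_imp]
        rintro - g hg
        rw [Ideal.mem_bot.1 hg, map_zero]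
      rw [Set.mem_ofPred_eq, this]; exact h⟩
  have hJmem : ∀ g, (Z (J ⊔ Ideal.span {g})).Infinite → g ∈ J := by
    intro g hg
    by_contra hgJ
    apply hmax _ hg
    apply lt_of_le_of_ne le_sup_left
    intro heq
    apply hgJ
    rw [heq]
    exact Ideal.mem_sup_right (Ideal.mem_span_singleton_self g)
  have hJmem2 : ∀ g, (∀ e ∈ E0 I l, ev e g = 0) → g ∈ J := by
    intro g hg
    apply hJmem
    rw [hZ]
    exact Set.Infinite.mono (fun e he => ⟨he, hg e he.1⟩) hJ
  have hprime : J.IsPrime := by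
    rw [Ideal.isPrime_iff]
    constructor
    · intro htop
      apply hJ
      convert Set.finite_empty
      ext e
      simp only [Z, Set.mem_ofPred_eq, Set.mem_empty_iff_false, iff_false, not_and]
      intro _ h2
      have := h2 1 (by rw [htop]; trivial)
      simp at this
    · intro x y hxy
      by_contra hcon
      push Not at hcon
      have hx : (Z (J ⊔ Ideal.span {x})).Finite := by
        by_contra hc; exact hcon.1 (hJmem _ hc)
      have hy : (Z (J ⊔ Ideal.span {y})).Finite := by
        by_contra hc; exact hcon.2 (hJmem _ hc)
      apply hJ
      apply (hx.union hy).subset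
      intro e he
      have := he.2 _ hxy
      rw [map_mul, mul_eq_zero] at this
      rcases this with h1 | h1
      · left; rw [hZ]; exact ⟨he, h1⟩
      · right; rw [hZ]; exact ⟨he, h1⟩
  refine ⟨J, hprime, ?_⟩
  set a : Matrix (Fin n) (Fin m) (MvPolynomial (Fin n × Fin m) ℂ ⧸ J) :=
    Matrix.of fun i k => Ideal.Quotient.mk J (X (i, k)) with ha
  have F1 : a * l.map (algebraMap ℂ (MvPolynomial (Fin n × Fin m) ℂ ⧸ J)) = 1 := by
    ext i j
    have : (∑ k, X (i, k) * C (l k j) - C ((1 : Matrix (Fin n) (Fin n) ℂ) i j)) ∈ J := by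
      apply hJmem2
      intro e he
      have := congrFun (congrFun he.1 i) j
      rw [Matrix.mul_apply] at this
      simp [ev, this]
    have h2 := Ideal.Quotient.eq_zero_iff_mem.2 this
    rw [map_sub, sub_eq_zero, map_sum] at h2
    rw [Matrix.mul_apply]
    simp only [map_mul] at h2
    refine Eq.trans ?_ (h2.trans ?_)
    · rfl
    · rw [Matrix.one_apply, Matrix.one_apply]
      split_ifs <;> simp
  have hχ : ∀ (χ : (MvPolynomial (Fin n × Fin m) ℂ ⧸ J) →ₐ[ℂ] ℂ) g,
      χ (Ideal.Quotient.mk J g) = ev (a.map χ) g := by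
    intro χ g
    have : χ.comp (Ideal.Quotient.mkₐ ℂ J) = aeval (fun p => (a.map χ) p.1 p.2) := by
      ext p
      simp [a]
    have h2 := congrArg (fun ψ => ψ g) this
    simp only [AlgHom.comp_apply] at h2
    exact h2
  have F2 : ∀ χ : (MvPolynomial (Fin n × Fin m) ℂ ⧸ J) →ₐ[ℂ] ℂ, a.map χ ∈ E0 I l := by
    intro χ
    constructor
    · have := congrArg (fun M => M.map χ) F1
      simp only [Matrix.map_mul] at this
      rw [Matrix.map_one _ (map_zero χ) (map_one χ)] at this
      convert this using 2
      ext i j; simp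
    · intro f hf s
      have : aeval (fun k => ∑ i, C (s i) * X (i, k) : Fin m → MvPolynomial (Fin n × Fin m) ℂ) f
          ∈ J := by
        apply hJmem2
        intro e he
        have h1 := he.2 f hf s
        rw [← h1]
        have : (ev e).comp (aeval (fun k => ∑ i, C (s i) * X (i, k) :
            Fin m → MvPolynomial (Fin n × Fin m) ℂ)).toRingHom = eval (s ᵥ* e) := by
          ext k
          · simp [ev]
          · simp [ev, Matrix.vecMul, dotProduct]
        exact congrArg (fun ψ => ψ f) this
      have h2 := hχ χ (aeval (fun k => ∑ i, C (s i) * X (i, k)) f)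
      rw [Ideal.Quotient.eq_zero_iff_mem.2 this, map_zero] at h2
      rw [h2]
      have : (ev (a.map χ)).comp (aeval (fun k => ∑ i, C (s i) * X (i, k) :
            Fin m → MvPolynomial (Fin n × Fin m) ℂ)).toRingHom = eval (s ᵥ* (a.map χ)) := by
          ext k
          · simp [ev]
          · simp [ev, Matrix.vecMul, dotProduct]
      exact (congrArg (fun ψ => ψ f) this).symm
  have F4 : Algebra.adjoin ℂ (Set.range fun p : Fin n × Fin m => a p.1 p.2) = ⊤ := by
    have h1 : (Set.range fun p : Fin n × Fin m => a p.1 p.2) =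
        (Ideal.Quotient.mkₐ ℂ J) '' (Set.range X) := by
      rw [← Set.range_comp]; rfl
    rw [h1, ← AlgHom.map_adjoin, MvPolynomial.adjoin_range_X, Algebra.map_top,
      AlgHom.range_eq_top]
    exact Ideal.Quotient.mk_surjective
  have hext : ∀ χ χ' : (MvPolynomial (Fin n × Fin m) ℂ ⧸ J) →ₐ[ℂ] ℂ,
      a.map χ = a.map χ' → χ = χ' := by
    intro χ χ' he
    apply AlgHom.ext_of_adjoin_eq_top F4
    rintro _ ⟨p, rfl⟩
    exact congrFun (congrFun he p.1) p.2
  refine ⟨F1, F2, ?_, F4, ?_⟩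
  · have : Infinite (Z J) := hJ.to_subtype
    let φ : Z J → ((MvPolynomial (Fin n × Fin m) ℂ ⧸ J) →ₐ[ℂ] ℂ) := fun e =>
      Ideal.Quotient.liftₐ J (aeval (fun p => e.1 p.1 p.2)) (fun g hg => e.2.2 g hg)
    apply Infinite.of_injective φ
    intro e e' hee
    apply Subtype.ext
    ext i k
    have := congrArg (fun ψ => ψ (Ideal.Quotient.mk J (X (i, k)))) hee
    have h3 : ∀ e : Z J, φ e (Ideal.Quotient.mk J (X (i, k))) = e.1 i k := by
      intro e
      change aeval (fun p : Fin n × Fin m => e.1 p.1 p.2) (X (i, k) : MvPolynomial _ ℂ) = _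
      simp
    rw [← h3, ← h3]; exact this
  · intro g hg
    obtain ⟨g, rfl⟩ := Ideal.Quotient.mk_surjective g
    have hgJ : g ∉ J := fun hc => hg (Ideal.Quotient.eq_zero_iff_mem.2 hc)
    have hfin : (Z (J ⊔ Ideal.span {g})).Finite := by
      by_contra hc; exact hgJ (hJmem _ hc)
    apply Set.Finite.of_finite_image (f := fun χ : (MvPolynomial (Fin n × Fin m) ℂ ⧸ J) →ₐ[ℂ] ℂ => a.map χ)
    · apply hfin.subset
      rintro _ ⟨χ, hχg, rfl⟩
      rw [hZ]
      refine ⟨⟨F2 χ, ?_⟩, ?_⟩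
      · intro q hq
        rw [← hχ, Ideal.Quotient.eq_zero_iff_mem.2 hq, map_zero]
      · rw [← hχ]; exact hχg
    · intro χ _ χ' _ he
      exact hext _ _ he

end ScrollPf

end

section
open MvPolynomial Matrix

namespace ScrollPf

/-- geometric hypotheses on the cone ideal -/
structure Hyp {m : ℕ} (I : Ideal (MvPolynomial (Fin m) ℂ)) (n : ℕ) : Prop where
  prime : I.IsPrime
  H1 : ∀ f, {W | IsRul I n W ∧ ∀ w ∈ W, eval w f = 0}.Infinite → f ∈ I
  H3 : ∀ p : Fin m → ℂ, p ≠ 0 → {W | IsRul I n W ∧ p ∈ W}.Finite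

section
variable {n m : ℕ} {I : Ideal (MvPolynomial (Fin m) ℂ)} {l : Matrix (Fin m) (Fin n) ℂ}
    {R : Type} [CommRing R] [IsDomain R] [Algebra ℂ R] [Algebra.FiniteType ℂ R]
    {a : Matrix (Fin n) (Fin m) R}

/-- generic point -/
def psi (a : Matrix (Fin n) (Fin m) R) : MvPolynomial (Fin m) ℂ →ₐ[ℂ] MvPolynomial (Fin n) R :=
  aeval (fun k => ∑ i, X i * C (a i k))

/-- point of the total space -/
def pt (χ : R →ₐ[ℂ] ℂ) (s : Fin n → ℂ) : MvPolynomial (Fin n) R →ₐ[ℂ] ℂ :=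
  aevalTower χ s

/-- base part of a point -/
def base (ξ : MvPolynomial (Fin n) R →ₐ[ℂ] ℂ) : R →ₐ[ℂ] ℂ :=
  ξ.comp (IsScalarTower.toAlgHom ℂ R (MvPolynomial (Fin n) R))

lemma base_apply (ξ : MvPolynomial (Fin n) R →ₐ[ℂ] ℂ) (x : R) : base ξ x = ξ (C x) := rfl

lemma pt_C (χ : R →ₐ[ℂ] ℂ) (s : Fin n → ℂ) (x : R) : pt χ s (C x) = χ x := by
  simp [pt]

lemma pt_X (χ : R →ₐ[ℂ] ℂ) (s : Fin n → ℂ) (i) : pt χ s (X i) = s i := by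
  simp [pt]

lemma pt_psi (ξ : MvPolynomial (Fin n) R →ₐ[ℂ] ℂ) (f) :
    ξ (psi a f) = eval ((fun i => ξ (X i)) ᵥ* (a.map (base ξ))) f := by
  have : ξ.comp (psi a) = aeval ((fun i => ξ (X i)) ᵥ* (a.map (base ξ))) := by
    ext k
    simp [psi, Matrix.vecMul, dotProduct, base_apply]
  have := congrArg (fun φ => φ f) this
  exact this

instance : Algebra.FiniteType ℂ (MvPolynomial (Fin n) R) :=
  Algebra.FiniteType.trans (S := R) inferInstance inferInstance

lemma Fam.inj_vec (hF : Fam I l a) (χ : R →ₐ[ℂ] ℂ) (s : Fin n → ℂ) (h : s ᵥ* a.map χ = 0) :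
    s = 0 := inj_of_mul_eq_one (hF.F2 χ).1 s h

lemma Fam.isRul (hF : Fam I l a) (χ : R →ₐ[ℂ] ℂ) : IsRul I n (rowSp (a.map χ)) :=
  rowSp_isRul (hF.inj_vec χ) (hF.F2 χ).2

lemma Fam.rowSp_inj (hF : Fam I l a) :
    Function.Injective (fun χ : R →ₐ[ℂ] ℂ => rowSp (a.map χ)) := by
  intro χ χ' h
  exact hF.ext_hom (E0_rowSp_inj (hF.F2 χ) (hF.F2 χ') h)

/-- an element vanishing at infinitely many points is zero -/
lemma Fam.eq_zero (hF : Fam I l a) (g : R) {s : Set (R →ₐ[ℂ] ℂ)} (hs : s.Infinite)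
    (h : ∀ χ ∈ s, χ g = 0) : g = 0 := by
  by_contra hg
  exact hs ((hF.F5 g hg).subset h)

lemma psi_eq_zero_iff (hI : Hyp I n) (hF : Fam I l a) (f) : psi a f = 0 ↔ f ∈ I := by
  constructor
  · intro h
    apply hI.H1
    have := hF.F3
    refine Set.Infinite.mono ?_ (Set.infinite_range_of_injective hF.rowSp_inj)
    rintro _ ⟨χ, rfl⟩
    refine ⟨hF.isRul χ, ?_⟩
    intro w hw
    obtain ⟨s, rfl⟩ := (mem_rowSp _ _).1 hw
    have h2 := pt_psi (a := a) (pt χ s) f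
    rw [h, map_zero] at h2
    rw [h2]
    congr 1
    congr 1
    have h3 : (fun i => pt χ s (X i)) = s := by ext i; exact pt_X _ _ _
    have h4 : a.map χ = a.map (base (pt χ s)) := by
      ext i k; simp [base_apply, pt_C]
    rw [h3, h4]
  · intro hf
    by_contra hne
    obtain ⟨ξ, hξ⟩ := exists_point _ hne
    apply hξ
    rw [pt_psi]
    exact (hF.F2 _).2 f hf _

/-- the induced map on the coordinate ring -/
def psiA (hI : Hyp I n) (hF : Fam I l a) :
    (MvPolynomial (Fin m) ℂ ⧸ I) →ₐ[ℂ] MvPolynomial (Fin n) R :=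
  Ideal.Quotient.liftₐ I (psi a) (fun f hf => (psi_eq_zero_iff hI hF f).2 hf)

lemma psiA_mk (hI : Hyp I n) (hF : Fam I l a) (f) :
    psiA hI hF (Ideal.Quotient.mk I f) = psi a f := rfl

lemma psiA_inj (hI : Hyp I n) (hF : Fam I l a) : Function.Injective (psiA hI hF) := by
  rw [injective_iff_map_eq_zero]
  intro x hx
  obtain ⟨f, rfl⟩ := Ideal.Quotient.mk_surjective x
  rw [psiA_mk, psi_eq_zero_iff hI hF] at hx
  exact Ideal.Quotient.eq_zero_iff_mem.2 hx

/-- S6 -/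
lemma algebraic_over_A (hn : 0 < n) (hI : Hyp I n) (hF : Fam I l a) (x : R) :
    ∃ q : Polynomial (MvPolynomial (Fin m) ℂ ⧸ I), q ≠ 0 ∧
      q.eval₂ (psiA hI hF).toRingHom (C x) = 0 := by
  by_contra hcon
  push Not at hcon
  have := hI.prime
  let Φ : Polynomial (MvPolynomial (Fin m) ℂ ⧸ I) →ₐ[ℂ] MvPolynomial (Fin n) R :=
    Polynomial.eval₂AlgHom (psiA hI hF) (C x) (fun _ => Commute.all _ _)
  have hΦ : ∀ q, Φ q = q.eval₂ (psiA hI hF).toRingHom (C x) := fun q => rfl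
  have hinj : Function.Injective Φ := by
    rw [injective_iff_map_eq_zero]
    intro q hq
    by_contra hq0
    exact hcon q hq0 hq
  have : Algebra.FiniteType ℂ (Polynomial (MvPolynomial (Fin m) ℂ ⧸ I)) :=
    Algebra.FiniteType.trans (S := MvPolynomial (Fin m) ℂ ⧸ I) inferInstance inferInstance
  obtain ⟨b, hb0, hb⟩ := extend_point (B := Polynomial (MvPolynomial (Fin m) ℂ ⧸ I)) (C := MvPolynomial (Fin n) R) Φ hinj (X ⟨0, hn⟩)
    (X_ne_zero (R := R) _)
  obtain ⟨φ₀, hφ₀⟩ := exists_point b.leadingCoeff (by simpa using hb0)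
  let p : Fin m → ℂ := fun k => φ₀ (Ideal.Quotient.mk I (X k))
  have hp : ∀ f, φ₀ (Ideal.Quotient.mk I f) = eval p f := by
    intro f
    have : φ₀.comp (Ideal.Quotient.mkₐ ℂ I) = aeval p := by
      ext k; simp [p]
    exact congrArg (fun ψ => ψ f) this
  have hbm : b.map φ₀.toRingHom ≠ 0 := by
    intro h0
    apply hφ₀
    have := congrArg (fun q => q.coeff b.natDegree) h0
    simpa using this
  have hinf : {c : ℂ | (b.map φ₀.toRingHom).eval c ≠ 0}.Infinite := by
    have := (Polynomial.finite_setOfPred_isRoot hbm).infinite_compl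
    exact this
  have key : ∀ c ∈ {c : ℂ | (b.map φ₀.toRingHom).eval c ≠ 0}, ∃ χ : R →ₐ[ℂ] ℂ,
      χ x = c ∧ p ∈ rowSp (a.map χ) ∧ p ≠ 0 := by
    intro c hc
    let φ : Polynomial (MvPolynomial (Fin m) ℂ ⧸ I) →ₐ[ℂ] ℂ := Polynomial.eval₂AlgHom φ₀ c (fun _ => Commute.all _ _)
    obtain ⟨ξ, hξ, hξ0⟩ := hb φ (by
      change Polynomial.eval₂ φ₀.toRingHom c b ≠ 0
      rw [← Polynomial.eval_map]; exact hc)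
    have h1 : ∀ q, ξ (Φ q) = φ q := fun q => congrArg (fun ψ => ψ q) hξ
    have h2 : ξ (C x) = c := by
      have := h1 Polynomial.X
      simpa [Φ, φ] using this
    have h3 : ∀ f, eval p f = eval ((fun i => ξ (X i)) ᵥ* (a.map (base ξ))) f := by
      intro f
      rw [← pt_psi, ← hp, ← psiA_mk hI hF]
      have := h1 (Polynomial.C (Ideal.Quotient.mk I f))
      simpa [Φ, φ] using this.symm
    have h4 : p = (fun i => ξ (X i)) ᵥ* (a.map (base ξ)) := by
      ext k
      have := h3 (X k)
      simpa using this
    refine ⟨base ξ, by rw [base_apply, h2], (mem_rowSp _ _).2 ⟨_, h4.symm⟩, ?_⟩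
    intro h0
    rw [h0] at h4
    have := hF.inj_vec _ _ h4.symm
    exact hξ0 (congrFun this ⟨0, hn⟩)
  have hp0 : p ≠ 0 := by
    obtain ⟨c, hc⟩ := hinf.nonempty
    obtain ⟨χ, -, -, h⟩ := key c hc
    exact h
  have := hF.F3
  have : Nonempty (R →ₐ[ℂ] ℂ) := inferInstance
  choose! χ h1 h2 h3 using key
  apply (hinf.image (f := fun c => rowSp (a.map (χ c))) ?_) ((hI.H3 p hp0).subset ?_)
  · intro c hc c' hc' hcc
    rw [← h1 c hc, ← h1 c' hc', hF.rowSp_inj hcc]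
  · rintro _ ⟨c, hc, rfl⟩
    exact ⟨hF.isRul _, h2 c hc⟩

/-- S7 -/
lemma alg_dependent (hF : Fam I l a) (g x : R) :
    ∃ P : MvPolynomial (Fin 2) ℂ, P ≠ 0 ∧ aeval ![g, x] P = 0 := by
  by_contra hcon
  push Not at hcon
  have hinj : Function.Injective (aeval ![g, x] : MvPolynomial (Fin 2) ℂ →ₐ[ℂ] R) := by
    rw [injective_iff_map_eq_zero]
    intro q hq
    by_contra hq0
    exact hcon q hq0 hq
  obtain ⟨b, hb0, hb⟩ := extend_point _ hinj 1 one_ne_zero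
  have : ∃ c, eval c b ≠ 0 := by
    by_contra hc
    push Not at hc
    exact hb0 (MvPolynomial.funext (by simpa using hc))
  obtain ⟨c, hc⟩ := this
  let q : Polynomial ℂ := aeval ![Polynomial.C (c 0), Polynomial.X] b
  have hq : ∀ d, q.eval d = eval ![c 0, d] b := by
    intro d
    have : (Polynomial.aeval d).comp (aeval ![Polynomial.C (c 0), Polynomial.X]) =
        (aeval ![c 0, d] : MvPolynomial (Fin 2) ℂ →ₐ[ℂ] ℂ) := by
      ext i; fin_cases i <;> simp
    have := congrArg (fun ψ => ψ b) this
    simp only [AlgHom.comp_apply] at this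
    rw [← Polynomial.coe_aeval_eq_eval]
    exact this
  have hq0 : q ≠ 0 := by
    intro h0
    apply hc
    have h1 := hq (c 1)
    rw [h0] at h1
    have h2 : ![c 0, c 1] = c := by ext i; fin_cases i <;> rfl
    rw [h2] at h1
    simpa using h1.symm
  have hinf : {d : ℂ | q.eval d ≠ 0}.Infinite :=
    (Polynomial.finite_setOfPred_isRoot hq0).infinite_compl
  have key : ∀ d ∈ {d : ℂ | q.eval d ≠ 0}, ∃ χ : R →ₐ[ℂ] ℂ, χ g = c 0 ∧ χ x = d := by
    intro d hd
    obtain ⟨χ, hχ, -⟩ := hb (aeval ![c 0, d]) (by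
      have : q.eval d ≠ 0 := hd
      rw [hq] at this; exact this)
    have h1 := congrArg (fun ψ => ψ (X 0)) hχ
    have h2 := congrArg (fun ψ => ψ (X 1)) hχ
    simp at h1 h2
    exact ⟨χ, h1, h2⟩
  have := hF.F3
  have : Nonempty (R →ₐ[ℂ] ℂ) := inferInstance
  choose! χ h1 h2 using key
  have hg : g - algebraMap ℂ R (c 0) = 0 := by
    apply hF.eq_zero _ (hinf.image (f := χ) ?_)
    · rintro _ ⟨d, hd, rfl⟩
      simp [h1 d hd]
    · intro d hd d' hd' hdd
      rw [← h2 d hd, ← h2 d' hd', hdd]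
  apply hcon (X 0 - C (c 0))
  · intro h0
    have := congrArg (eval ![c 0 + 1, 0]) h0
    simp at this
  · simpa [MvPolynomial.algebraMap_eq] using hg

end

end ScrollPf

end

section
open MvPolynomial Matrix

namespace ScrollPf

/-- rank at most one -/
def R1 {n m : ℕ} {R : Type*} [CommRing R] (M : Matrix (Fin n) (Fin m) R) : Prop :=
  ∀ i i' k k', M i k * M i' k' - M i k' * M i' k = 0

lemma R1_vec {n m : ℕ} (M : Matrix (Fin n) (Fin m) ℂ) (h : R1 M) :
    ∃ u y, M = vecMulVec u y := by
  by_cases h0 : M = 0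
  · exact ⟨0, 0, by simp [h0]⟩
  · have : ∃ i k, M i k ≠ 0 := by
      by_contra hc
      push Not at hc
      exact h0 (by ext i k; simp [hc])
    obtain ⟨i, k, hik⟩ := this
    refine ⟨fun i' => M i' k, fun k' => M i k' / M i k, ?_⟩
    ext i' k'
    rw [vecMulVec_apply, ← mul_div_assoc, eq_div_iff hik]
    linear_combination h i' i k' k

lemma parallel {k : ℕ} (u u' : Fin k → ℂ) (hu' : u' ≠ 0) (h : ∀ i j, u i * u' j - u j * u' i = 0) :
    ∃ c : ℂ, u = c • u' := by
  obtain ⟨j, hj⟩ := Function.ne_iff.1 hu'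
  refine ⟨u j / u' j, ?_⟩
  ext i
  simp only [Pi.smul_apply, smul_eq_mul]
  rw [div_mul_eq_mul_div, eq_div_iff hj]
  linear_combination h i j

lemma two_par {n m : ℕ} (u u' : Fin n → ℂ) (y y' : Fin m → ℂ)
    (h : R1 (vecMulVec u y - vecMulVec u' y')) :
    (∀ i j, u i * u' j - u j * u' i = 0) ∨ (∀ i j, y i * y' j - y j * y' i = 0) := by
  by_contra hc
  push Not at hc
  obtain ⟨⟨i, j, h1⟩, ⟨k, l, h2⟩⟩ := hc
  have := h i j k l
  simp only [Matrix.sub_apply, vecMulVec_apply] at this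
  apply mul_ne_zero h1 h2
  linear_combination -this

lemma rank_one_family {n m : ℕ} {ι : Type*} (M : ι → Matrix (Fin n) (Fin m) ℂ) (x0 : ι)
    (h0 : M x0 = 0) (h : ∀ x y, R1 (M x - M y)) :
    (∃ y, ∀ x, ∃ u, M x = vecMulVec u y) ∨ (∃ u, ∀ x, ∃ y, M x = vecMulVec u y) := by
  have h1 : ∀ x, ∃ u y, M x = vecMulVec u y := fun x => by
    have := h x x0
    rw [h0, sub_zero] at this
    exact R1_vec _ this
  choose u y huy using h1
  by_cases hall : ∀ x, M x = 0
  · left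
    exact ⟨0, fun x => ⟨0, by simp [hall x]⟩⟩
  push Not at hall
  obtain ⟨x1, hx1⟩ := hall
  have hu1 : u x1 ≠ 0 := fun hh => hx1 (by rw [huy, hh]; ext; simp [vecMulVec_apply])
  have hy1 : y x1 ≠ 0 := fun hh => hx1 (by rw [huy, hh]; ext; simp [vecMulVec_apply])
  have h2 : ∀ x x', (∀ i j, u x i * u x' j - u x j * u x' i = 0) ∨
      (∀ i j, y x i * y x' j - y x j * y x' i = 0) := by
    intro x x'
    have := h x x'
    rw [huy x, huy x'] at this
    exact two_par _ _ _ _ this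
  by_contra hc
  push Not at hc
  obtain ⟨hc1, hc2⟩ := hc
  obtain ⟨x2, hx2⟩ := hc1 (y x1)
  obtain ⟨x3, hx3⟩ := hc2 (u x1)
  have a2 : ¬ ∀ i j, y x2 i * y x1 j - y x2 j * y x1 i = 0 := by
    intro hh
    obtain ⟨c, hc⟩ := parallel _ _ hy1 hh
    exact hx2 (c • u x2) (by rw [huy, hc]; ext; simp [vecMulVec_apply]; ring)
  have a3 : ¬ ∀ i j, u x3 i * u x1 j - u x3 j * u x1 i = 0 := by
    intro hh
    obtain ⟨c, hc⟩ := parallel _ _ hu1 hh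
    exact hx3 (c • y x3) (by rw [huy, hc]; ext; simp [vecMulVec_apply]; ring)
  obtain ⟨c2, b2⟩ := parallel _ _ hu1 ((h2 x2 x1).resolve_right a2)
  obtain ⟨c3, b3⟩ := parallel _ _ hy1 ((h2 x3 x1).resolve_left a3)
  have hc2 : c2 ≠ 0 := by
    rintro rfl
    apply hx2 0
    rw [huy, b2]; ext; simp [vecMulVec_apply]
  have hc3 : c3 ≠ 0 := by
    rintro rfl
    apply hx3 0
    rw [huy, b3]; ext; simp [vecMulVec_apply]
  rcases h2 x3 x2 with h5 | h5
  · apply a3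
    intro i j
    have := h5 i j
    rw [b2] at this
    simp only [Pi.smul_apply, smul_eq_mul] at this
    have h6 : c2 * (u x3 i * u x1 j - u x3 j * u x1 i) = 0 := by linear_combination this
    exact (mul_eq_zero.1 h6).resolve_left hc2
  · apply a2
    intro i j
    have := h5 i j
    rw [b3] at this
    simp only [Pi.smul_apply, smul_eq_mul] at this
    have h6 : c3 * (y x2 i * y x1 j - y x2 j * y x1 i) = 0 := by linear_combination -this
    exact (mul_eq_zero.1 h6).resolve_left hc3

/-- algebraic dependence and transcendence -/
lemma alg_of_dep {Ω : Type*} [Field Ω] [Algebra ℂ Ω] (t x : Ω) (ht : Transcendental ℂ t)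
    (P : MvPolynomial (Fin 2) ℂ) (hP : P ≠ 0) (h : aeval ![t, x] P = 0)
    (T : Set Ω) (hT : t ∈ T) : IsAlgebraic (Algebra.adjoin ℂ T) x := by
  have h1 : AlgebraicIndependent ℂ (fun _ : Unit => t) := by
    rw [algebraicIndependent_unique_type_iff]; exact ht
  have h2 : IsAlgebraic (Algebra.adjoin ℂ (Set.range (fun _ : Unit => t))) x := by
    by_contra hx
    have h3 := (h1.option_iff_transcendental x).2 hx
    have h4 : AlgebraicIndependent ℂ ![t, x] := by
      let e : Fin 2 → Option Unit := ![some (), none]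
      have := h3.comp e (by intro i j; fin_cases i <;> fin_cases j <;> simp [e])
      convert this using 1
      ext i; fin_cases i <;> rfl
    exact hP ((injective_iff_map_eq_zero _).1 h4 P h)
  obtain ⟨q, hq, hqx⟩ := h2
  have hle : Algebra.adjoin ℂ (Set.range (fun _ : Unit => t)) ≤ Algebra.adjoin ℂ T := by
    apply Algebra.adjoin_mono; rintro _ ⟨_, rfl⟩; exact hT
  refine ⟨q.map (Subalgebra.inclusion hle).toRingHom, ?_, ?_⟩
  · rw [Ne, Polynomial.map_eq_zero_iff (Subalgebra.inclusion_injective hle)]; exact hq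
  · rw [Polynomial.aeval_def, Polynomial.eval₂_map]; exact hqx

lemma alg_gen {S Ω : Type*} [CommRing S] [Algebra ℂ S] [Field Ω] [Algebra ℂ Ω]
    (j : S →ₐ[ℂ] Ω) (hj : Function.Injective j)
    (hΩ : ∀ z : Ω, ∃ q : Polynomial S, q ≠ 0 ∧ q.eval₂ j.toRingHom z = 0)
    (D : Subalgebra ℂ Ω) (hD : ∀ x, IsAlgebraic D (j x)) : Algebra.IsAlgebraic D Ω := by
  have : IsDomain D := inferInstance
  let E := Subalgebra.algebraicClosure D Ω
  have hE : Algebra.IsAlgebraic D E := inferInstance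
  constructor
  intro z
  apply IsAlgebraic.restrictScalars D (S := E)
  obtain ⟨q, hq, hqz⟩ := hΩ z
  let φ : S →+* E := j.toRingHom.codRestrict E (fun x => hD x)
  refine ⟨q.map φ, ?_, ?_⟩
  · rw [Ne, Polynomial.map_eq_zero_iff]
    · exact hq
    · intro x y hxy; exact hj (congrArg Subtype.val hxy)
  · rw [Polynomial.aeval_def, Polynomial.eval₂_map]; exact hqz

end ScrollPf

end

section
open MvPolynomial Matrix

namespace ScrollPf

lemma dep_map {A B : Type*} [CommRing A] [Algebra ℂ A] [CommRing B] [Algebra ℂ B]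
    (φ : A →ₐ[ℂ] B) (x y : A) (P : MvPolynomial (Fin 2) ℂ) :
    aeval ![φ x, φ y] P = φ (aeval ![x, y] P) := by
  rw [MvPolynomial.comp_aeval_apply]
  congr 2
  ext i; fin_cases i <;> rfl

section
variable {n m : ℕ} {I : Ideal (MvPolynomial (Fin m) ℂ)} {l : Matrix (Fin m) (Fin n) ℂ}
    {R : Type} [CommRing R] [IsDomain R] [Algebra ℂ R] [Algebra.FiniteType ℂ R]
    {a : Matrix (Fin n) (Fin m) R}

lemma exists_transc (hF : Fam I l a) : ∃ t : R, Transcendental ℂ t := by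
  by_contra hc
  have hc : ∀ t : R, IsAlgebraic ℂ t := by
    intro t; by_contra h; exact hc ⟨t, h⟩
  have hIntegral : Algebra.IsIntegral ℂ R := ⟨fun t => (hc t).isIntegral⟩
  have hs : Function.Surjective (algebraMap ℂ R) :=
    (IsAlgClosed.algebraMap_bijective_of_isIntegral (k := ℂ) (K := R)).2
  have h3 := hF.F3
  obtain ⟨χ, χ', hne⟩ := exists_pair_ne (R →ₐ[ℂ] ℂ)
  apply hne
  ext x
  obtain ⟨c, rfl⟩ := hs x
  simp

lemma trdeg_ge (hF : Fam I l a) {Ω : Type} [Field Ω] [Algebra ℂ Ω]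
    (j : MvPolynomial (Fin n) R →ₐ[ℂ] Ω) (hj : Function.Injective j) :
    ((n + 1 : ℕ) : Cardinal) ≤ Algebra.trdeg ℂ Ω := by
  refine le_trans ?_ (trdeg_le_of_injective j hj)
  have h1 : Algebra.trdeg ℂ R + Algebra.trdeg R (MvPolynomial (Fin n) R) =
      Algebra.trdeg ℂ (MvPolynomial (Fin n) R) := _root_.trdeg_add_eq ℂ R
  have h2 : Algebra.trdeg R (MvPolynomial (Fin n) R) = n := by
    rw [MvPolynomial.trdeg_of_isDomain]; simp
  obtain ⟨t, ht⟩ := exists_transc hF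
  have : Algebra.Transcendental ℂ R := ⟨t, ht⟩
  have h3 : 1 ≤ Algebra.trdeg ℂ R := Cardinal.one_le_iff_pos.2 (_root_.trdeg_pos ℂ R)
  rw [← h1, h2]
  push_cast
  rw [add_comm]
  gcongr

lemma minors_zero (hF : Fam I l a) {Ω : Type} [Field Ω] [Algebra ℂ Ω]
    (j : MvPolynomial (Fin n) R →ₐ[ℂ] Ω) (hj : Function.Injective j)
    (hΩ : ∀ z : Ω, ∃ q : Polynomial (MvPolynomial (Fin n) R), q ≠ 0 ∧ q.eval₂ j.toRingHom z = 0)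
    (σ : Ω →ₐ[ℂ] Ω)
    (hσ : ∀ k, ∑ i, j (X i) * (σ (j (C (a i k))) - j (C (a i k))) = 0) :
    R1 (Matrix.of fun i k => σ (j (C (a i k))) - j (C (a i k))) := by
  intro i i' k k'
  by_contra hd
  simp only [of_apply] at hd
  have hii : i ≠ i' := by
    rintro rfl
    apply hd; ring
  obtain ⟨t0, ht0⟩ := exists_transc hF
  let s : Fin n → Ω := fun i => j (X i)
  let Δ : Fin n → Fin m → Ω := fun i k => σ (j (C (a i k))) - j (C (a i k))
  classical
  let t : Ω := j (C t0)
  let φ : R →ₐ[ℂ] Ω := j.comp (IsScalarTower.toAlgHom ℂ R (MvPolynomial (Fin n) R))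
  have hφ : Function.Injective φ := hj.comp (C_injective _ _)
  let T : Finset Ω := insert t (insert (σ t) (((Finset.univ.erase i).erase i').image s))
  have hcard : T.card ≤ n := by
    have h1 : (((Finset.univ.erase i).erase i').image s).card ≤ n - 1 - 1 := by
      refine Finset.card_image_le.trans ?_
      rw [Finset.card_erase_of_mem (by simp [hii.symm]), Finset.card_erase_of_mem (by simp)]
      simp
    have h2 := Finset.card_insert_le t (insert (σ t) (((Finset.univ.erase i).erase i').image s))
    have h3 := Finset.card_insert_le (σ t) (((Finset.univ.erase i).erase i').image s)
    have h4 : 2 ≤ n := by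
      have := i.2; have := i'.2
      have : (i : ℕ) ≠ i' := fun h => hii (Fin.ext h)
      omega
    change T.card ≤ _ at h2
    omega
  let D := Algebra.adjoin ℂ (T : Set Ω)
  have e1 : ∀ x : R, IsAlgebraic D (φ x) := by
    intro x
    obtain ⟨P, hP, hPx⟩ := alg_dependent hF t0 x
    refine alg_of_dep t (φ x) ?_ P hP ?_ _ (by simp [T])
    · exact fun h => ht0 ((isAlgebraic_algHom_iff φ hφ).1 h)
    · have := congrArg φ hPx
      rw [map_zero] at this
      rw [← this, ← dep_map]
      rfl
  have e2 : ∀ x : R, IsAlgebraic D (σ (φ x)) := by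
    intro x
    obtain ⟨P, hP, hPx⟩ := alg_dependent hF t0 x
    refine alg_of_dep (σ t) (σ (φ x)) ?_ P hP ?_ _ (by simp [T])
    · exact fun h => ht0 ((isAlgebraic_algHom_iff (σ.comp φ) (σ.toRingHom.injective.comp hφ)).1 h)
    · have := congrArg (σ.comp φ) hPx
      rw [map_zero] at this
      rw [← this, ← dep_map]
      rfl
  have e3 : ∀ i k, IsAlgebraic D (Δ i k) := fun i k => (e2 _).sub (e1 _)
  have e4 : ∀ i0, i0 ≠ i → i0 ≠ i' → IsAlgebraic D (s i0) := by
    intro i0 h h'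
    have : s i0 ∈ D := Algebra.subset_adjoin (by
      simp only [T, Finset.coe_insert, Finset.coe_image]
      right; right
      exact ⟨i0, by simp [h, h'], rfl⟩)
    exact isAlgebraic_algebraMap (⟨s i0, this⟩ : D)
  let E := Subalgebra.algebraicClosure D Ω
  let b : Fin m → Ω := fun k => - ∑ i0 ∈ (Finset.univ.erase i).erase i', s i0 * Δ i0 k
  have hb : ∀ k, IsAlgebraic D (b k) := by
    intro k
    change b k ∈ E
    apply neg_mem
    apply sum_mem
    intro i0 hi0
    simp at hi0
    exact mul_mem (e4 _ hi0.2 hi0.1) (e3 _ _)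
  have hsum : ∀ k, s i * Δ i k + s i' * Δ i' k = b k := by
    intro k
    have := hσ k
    rw [← Finset.add_sum_erase _ _ (Finset.mem_univ i),
      ← Finset.add_sum_erase _ _ (show i' ∈ Finset.univ.erase i by simp [hii.symm])] at this
    simp only [b, s, Δ]
    linear_combination this
  have hdd : IsAlgebraic D ((Δ i k * Δ i' k' - Δ i k' * Δ i' k)⁻¹) :=
    (((e3 _ _).mul (e3 _ _)).sub ((e3 _ _).mul (e3 _ _))).inv
  have e5 : IsAlgebraic D (s i) := by
    have : s i = (b k * Δ i' k' - b k' * Δ i' k) * (Δ i k * Δ i' k' - Δ i k' * Δ i' k)⁻¹ := by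
      rw [eq_mul_inv_iff_mul_eq₀ hd]
      linear_combination Δ i' k' * hsum k - Δ i' k * hsum k'
    rw [this]
    exact (((hb _).mul (e3 _ _)).sub ((hb _).mul (e3 _ _))).mul hdd
  have e6 : IsAlgebraic D (s i') := by
    have : s i' = (b k' * Δ i k - b k * Δ i k') * (Δ i k * Δ i' k' - Δ i k' * Δ i' k)⁻¹ := by
      rw [eq_mul_inv_iff_mul_eq₀ hd]
      linear_combination Δ i k * hsum k' - Δ i k' * hsum k
    rw [this]
    exact (((hb _).mul (e3 _ _)).sub ((hb _).mul (e3 _ _))).mul hdd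
  have e7 : ∀ i0, IsAlgebraic D (s i0) := by
    intro i0
    by_cases h : i0 = i
    · rw [h]; exact e5
    by_cases h' : i0 = i'
    · rw [h']; exact e6
    exact e4 _ h h'
  have hD : ∀ x, IsAlgebraic D (j x) := by
    intro x
    induction x using MvPolynomial.induction_on with
    | C r => exact e1 r
    | add p q hp hq => rw [map_add]; exact hp.add hq
    | mul_X p i0 hp => rw [map_mul]; exact hp.mul (e7 i0)
  have hDΩ : Algebra.IsAlgebraic (Algebra.adjoin ℂ (T : Set Ω)) Ω := alg_gen j hj hΩ D hD
  have h1 := Algebra.IsAlgebraic.trdeg_le_cardinalMk ℂ (T : Set Ω)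
  have h2 := (trdeg_ge hF j hj).trans h1
  have h5 : Cardinal.mk (T : Set Ω) = T.card := Cardinal.mk_coe_finset
  rw [h5] at h2
  have : n + 1 ≤ T.card := by exact_mod_cast h2
  omega

end
end ScrollPf

end

section
open MvPolynomial Matrix

namespace ScrollPf

lemma line_zero {m : ℕ} (f : MvPolynomial (Fin m) ℂ) (p q : Fin m → ℂ)
    (h : {t : ℂ | eval (p + t • q) f = 0}.Infinite) (t : ℂ) : eval (p + t • q) f = 0 := by
  let Q : Polynomial ℂ := aeval (fun k => Polynomial.C (p k) + Polynomial.X * Polynomial.C (q k)) f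
  have hQ : ∀ t, Q.eval t = eval (p + t • q) f := by
    intro t
    have : (Polynomial.aeval t).comp
        (aeval (fun k => Polynomial.C (p k) + Polynomial.X * Polynomial.C (q k))) =
        (aeval (p + t • q) : MvPolynomial (Fin m) ℂ →ₐ[ℂ] ℂ) := by
      ext k; simp; ring
    have := congrArg (fun ψ => ψ f) this
    simp only [AlgHom.comp_apply] at this
    rw [← Polynomial.coe_aeval_eq_eval]
    exact this
  have hQ0 : Q = 0 := by
    apply Polynomial.eq_zero_of_infinite_isRoot
    refine h.mono ?_
    intro t ht
    exact (hQ t).trans ht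
  rw [← hQ, hQ0]; simp

section
variable {n m : ℕ} {I : Ideal (MvPolynomial (Fin m) ℂ)} {l : Matrix (Fin m) (Fin n) ℂ}
    {R : Type} [CommRing R] [IsDomain R] [Algebra ℂ R] [Algebra.FiniteType ℂ R]
    {a : Matrix (Fin n) (Fin m) R}

lemma psi_l (hF : Fam I l a) (i : Fin n) : psi a (∑ k, C (l k i) * X k) = X i := by
  have h1 : ∀ i', ∑ k, a i' k * algebraMap ℂ R (l k i) = if i' = i then 1 else 0 := by
    intro i'
    have := congrFun (congrFun hF.F1 i') i
    simpa [Matrix.mul_apply, Matrix.one_apply] using this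
  rw [map_sum]
  simp only [psi, map_mul, aeval_X, algHom_C]
  simp only [Finset.mul_sum]
  rw [Finset.sum_comm]
  have : ∀ i', ∑ k, (algebraMap ℂ (MvPolynomial (Fin n) R)) (l k i) * (X i' * C (a i' k)) =
      X i' * C (∑ k, a i' k * algebraMap ℂ R (l k i)) := by
    intro i'
    rw [map_sum, Finset.mul_sum]
    refine Finset.sum_congr rfl fun k _ => ?_
    rw [map_mul, IsScalarTower.algebraMap_apply ℂ R (MvPolynomial (Fin n) R), algebraMap_eq]
    ring
  simp only [this, h1]
  simp

lemma nonconst_infinite (hF : Fam I l a) (g : R) (hg : ∀ c, g ≠ algebraMap ℂ R c) :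
    (Set.range (fun χ : R →ₐ[ℂ] ℂ => χ g)).Infinite := by
  intro hfin
  have := hF.F3
  apply Set.infinite_univ (α := R →ₐ[ℂ] ℂ)
  have : (⋃ c ∈ Set.range (fun χ : R →ₐ[ℂ] ℂ => χ g), {χ : R →ₐ[ℂ] ℂ | χ (g - algebraMap ℂ R c) = 0}).Finite := by
    apply hfin.biUnion
    intro c _
    exact hF.F5 _ (sub_ne_zero.2 (hg c))
  refine this.subset ?_
  intro χ _
  simp only [Set.mem_iUnion]
  exact ⟨χ g, ⟨χ, rfl⟩, by simp⟩

lemma bot_of_case1 (hI : Hyp I n) (H4 : ∀ c : Fin m → ℂ, ∑ k, C (c k) * X k ∈ I → c = 0)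
    (hF : Fam I l a) (χ0 : R →ₐ[ℂ] ℂ) (y : Fin m → ℂ)
    (hy : ∀ χ : R →ₐ[ℂ] ℂ, ∃ u, a.map χ - a.map χ0 = vecMulVec u y) : I = ⊥ := by
  choose u hu using hy
  have hinf := hF.F3
  have hdec : ∀ (χ : R →ₐ[ℂ] ℂ) (s : Fin n → ℂ), s ᵥ* a.map χ = s ᵥ* a.map χ0 + (s ⬝ᵥ u χ) • y := by
    intro χ s
    rw [← sub_add_cancel (a.map χ) (a.map χ0), hu χ, vecMul_add, add_comm]
    congr 1
    ext k
    simp [vecMul, dotProduct, vecMulVec_apply, Finset.sum_mul, mul_assoc]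
  have htop : rowSp (a.map χ0) ⊔ Submodule.span ℂ {y} = ⊤ := by
    by_contra hne
    obtain ⟨f, hf0, hf⟩ := Submodule.exists_le_ker_of_lt_top _ (lt_top_iff_ne_top.2 hne)
    have hfs : ∀ w, f w = ∑ k, f (Pi.single k 1) * w k := by
      intro w
      conv_lhs => rw [pi_eq_sum_univ' w]
      simp [mul_comm]
    have h1 : (fun k => f (Pi.single k 1)) = 0 := by
      apply H4
      apply hI.H1
      refine Set.Infinite.mono ?_ (Set.infinite_range_of_injective hF.rowSp_inj)
      rintro _ ⟨χ, rfl⟩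
      refine ⟨hF.isRul χ, ?_⟩
      intro w hw
      obtain ⟨s, rfl⟩ := (mem_rowSp _ _).1 hw
      have h2 : s ᵥ* a.map χ ∈ LinearMap.ker f := by
        apply hf
        rw [hdec]
        exact Submodule.add_mem_sup ((mem_rowSp _ _).2 ⟨s, rfl⟩)
          (Submodule.smul_mem _ _ (Submodule.mem_span_singleton_self y))
      rw [LinearMap.mem_ker, hfs] at h2
      simpa using h2
    apply hf0
    ext k
    simpa using congrFun h1 k
  have hne0 : ∃ χ : R →ₐ[ℂ] ℂ, a.map χ ≠ a.map χ0 := by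
    obtain ⟨χ, hχ⟩ := exists_ne χ0
    exact ⟨χ, fun h => hχ (hF.ext_hom h)⟩
  have hy0 : y ≠ 0 := by
    rintro rfl
    obtain ⟨χ, hχ⟩ := hne0
    apply hχ
    rw [← sub_eq_zero, hu]; ext; simp [vecMulVec_apply]
  obtain ⟨k0, hk0⟩ := Function.ne_iff.1 hy0
  let x : Fin n → R := fun i => (a i k0 - algebraMap ℂ R (χ0 (a i k0))) * algebraMap ℂ R (y k0)⁻¹
  have hx : ∀ χ : R →ₐ[ℂ] ℂ, ∀ i, χ (x i) = u χ i := by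
    intro χ i
    have h1 := congrFun (congrFun (hu χ) i) k0
    simp only [Matrix.sub_apply, Matrix.map_apply, vecMulVec_apply] at h1
    simp only [x, map_mul, map_sub, AlgHom.commutes, Algebra.algebraMap_self, RingHom.id_apply]
    rw [h1, mul_assoc, mul_inv_cancel₀ hk0, mul_one]
  have hi0 : ∃ i0, ∀ c, x i0 ≠ algebraMap ℂ R c := by
    by_contra hc
    push Not at hc
    choose c hc using hc
    obtain ⟨χ, hχ⟩ := hne0
    apply hχ
    have h1 : ∀ χ, u χ = c := by
      intro χ; ext i; rw [← hx, hc]; simp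
    rw [← sub_eq_zero, hu, h1, ← h1 χ0, ← hu, sub_self]
  obtain ⟨i0, hi0⟩ := hi0
  have hχs : ∀ (χ : R →ₐ[ℂ] ℂ) (s : Fin n → ℂ),
      χ (∑ i, algebraMap ℂ R (s i) * x i) = s ⬝ᵥ u χ := by
    intro χ s
    simp [dotProduct, hx]
  rw [eq_bot_iff]
  intro f hf
  have good : ∀ s : Fin n → ℂ, (∀ c, ∑ i, algebraMap ℂ R (s i) * x i ≠ algebraMap ℂ R c) →
      ∀ t : ℂ, eval (s ᵥ* a.map χ0 + t • y) f = 0 := by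
    intro s hs
    apply line_zero
    refine (nonconst_infinite hF _ hs).mono ?_
    rintro _ ⟨χ, rfl⟩
    have := (hF.F2 χ).2 f hf s
    rw [hdec] at this
    simp only [hχs]
    exact this
  have hzero : ∀ (s : Fin n → ℂ) (t : ℂ), eval (s ᵥ* a.map χ0 + t • y) f = 0 := by
    intro s t
    by_cases hs : ∀ c, ∑ i, algebraMap ℂ R (s i) * x i ≠ algebraMap ℂ R c
    · exact good s hs t
    · push Not at hs
      obtain ⟨c, hc⟩ := hs
      have := line_zero f (s ᵥ* a.map χ0 + t • y) ((Pi.single i0 1 : Fin n → ℂ) ᵥ* a.map χ0) ?_ 0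
      · simpa using this
      · have h0 : ({0}ᶜ : Set ℂ).Infinite := (Set.finite_singleton 0).infinite_compl
        refine h0.mono ?_
        intro d hd
        have hd : d ≠ 0 := hd
        have h1 := good (s + d • Pi.single i0 1) (by
          intro c' hc'
          apply hi0 ((c' - c) * d⁻¹)
          have h2 : ∑ i, algebraMap ℂ R ((s + d • Pi.single i0 1 : Fin n → ℂ) i) * x i =
              ∑ i, algebraMap ℂ R (s i) * x i + algebraMap ℂ R d * x i0 := by
            simp only [Pi.add_apply, map_add, add_mul, Finset.sum_add_distrib]
            congr 1
            rw [Finset.sum_eq_single i0]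
            · simp
            · intro b _ hb; simp [hb]
            · simp
          rw [h2, hc] at hc'
          have h3 : algebraMap ℂ R d * algebraMap ℂ R d⁻¹ = 1 := by
            rw [← map_mul, mul_inv_cancel₀ hd, map_one]
          rw [map_mul, map_sub]
          linear_combination (algebraMap ℂ R d⁻¹) * hc' - (x i0) * h3) t
        have h4 : s ᵥ* a.map χ0 + t • y + d • ((Pi.single i0 1 : Fin n → ℂ) ᵥ* a.map χ0) =
            (s + d • Pi.single i0 1) ᵥ* a.map χ0 + t • y := by
          rw [add_vecMul, smul_vecMul]; abel
        show eval _ f = 0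
        rw [h4]; exact h1
  change f = 0
  apply MvPolynomial.funext
  intro w
  have hw : w ∈ rowSp (a.map χ0) ⊔ Submodule.span ℂ {y} := by rw [htop]; trivial
  obtain ⟨p, hp, q, hq, rfl⟩ := Submodule.mem_sup.1 hw
  obtain ⟨s, rfl⟩ := (mem_rowSp _ _).1 hp
  obtain ⟨t, rfl⟩ := Submodule.mem_span_singleton.1 hq
  rw [hzero]; simp

lemma bot_of_B0 (hn : 2 ≤ n) (hI : Hyp I n)
    (H4 : ∀ c : Fin m → ℂ, ∑ k, C (c k) * X k ∈ I → c = 0) (hF : Fam I l a)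
    (hB : {χ : R →ₐ[ℂ] ℂ | R1 (Matrix.of fun i k => algebraMap ℂ R (χ (a i k)) - a i k)}.Infinite) :
    I = ⊥ := by
  have hinf := hF.F3
  have h1 : ∀ χ χ' : R →ₐ[ℂ] ℂ, R1 (a.map χ - a.map χ') := by
    intro χ χ' i i' k k'
    have : (a i k - algebraMap ℂ R (χ' (a i k))) * (a i' k' - algebraMap ℂ R (χ' (a i' k'))) -
        (a i k' - algebraMap ℂ R (χ' (a i k'))) * (a i' k - algebraMap ℂ R (χ' (a i' k))) = 0 := by
      apply hF.eq_zero _ hB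
      intro ψ hψ
      have := congrArg χ' (hψ i i' k k')
      simp at this ⊢
      linear_combination this
    have := congrArg χ this
    simpa using this
  obtain ⟨χ0⟩ : Nonempty (R →ₐ[ℂ] ℂ) := inferInstance
  rcases rank_one_family (fun χ : R →ₐ[ℂ] ℂ => a.map χ - a.map χ0) χ0 (by simp) (by
    intro χ χ'; simpa using h1 χ χ') with ⟨y, hy⟩ | ⟨u, hu⟩
  · exact bot_of_case1 hI H4 hF χ0 y hy
  · exfalso
    have : ∃ s : Fin n → ℂ, s ≠ 0 ∧ s ⬝ᵥ u = 0 := by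
      let f : (Fin n → ℂ) →ₗ[ℂ] ℂ :=
        { toFun := fun s => s ⬝ᵥ u
          map_add' := fun s t => add_dotProduct _ _ _
          map_smul' := fun c s => smul_dotProduct _ _ _ }
      have := LinearMap.ker_ne_bot_of_finrank_lt (f := f) (by simp; omega)
      obtain ⟨s, hs, hs0⟩ := Submodule.exists_mem_ne_zero_of_ne_bot this
      exact ⟨s, hs0, hs⟩
    obtain ⟨s, hs0, hsu⟩ := this
    have hp : ∀ χ : R →ₐ[ℂ] ℂ, s ᵥ* a.map χ = s ᵥ* a.map χ0 := by
      intro χ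
      obtain ⟨y, hy⟩ := hu χ
      rw [← sub_add_cancel (a.map χ) (a.map χ0), hy, vecMul_add]
      have : s ᵥ* vecMulVec u y = 0 := by
        ext k
        have h2 := congrArg (· * y k) hsu
        simpa [vecMul, dotProduct, vecMulVec_apply, Finset.sum_mul, mul_assoc] using h2
      rw [this, zero_add]
    refine (Set.infinite_range_of_injective hF.rowSp_inj) ((hI.H3 (s ᵥ* a.map χ0) ?_).subset ?_)
    · intro h; exact hs0 (hF.inj_vec _ _ h)
    · rintro _ ⟨χ, rfl⟩
      exact ⟨hF.isRul χ, (mem_rowSp _ _).2 ⟨s, hp χ⟩⟩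

end
end ScrollPf

end

section
open MvPolynomial Matrix

namespace ScrollPf

section
variable {n m : ℕ} {I : Ideal (MvPolynomial (Fin m) ℂ)} {l : Matrix (Fin m) (Fin n) ℂ}
    {R : Type} [CommRing R] [IsDomain R] [Algebra ℂ R] [Algebra.FiniteType ℂ R]
    {a : Matrix (Fin n) (Fin m) R}

lemma fixed_of_finite (hF : Fam I l a)
    (hB : {χ : R →ₐ[ℂ] ℂ | R1 (Matrix.of fun i k => algebraMap ℂ R (χ (a i k)) - a i k)}.Finite)
    {Ω : Type} [Field Ω] [Algebra ℂ Ω]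
    (j : MvPolynomial (Fin n) R →ₐ[ℂ] Ω) (hj : Function.Injective j)
    (hΩ : ∀ z : Ω, ∃ q : Polynomial (MvPolynomial (Fin n) R), q ≠ 0 ∧ q.eval₂ j.toRingHom z = 0)
    (σ : Ω →ₐ[ℂ] Ω) (hσ : ∀ f, σ (j (psi a f)) = j (psi a f)) (i : Fin n) (k : Fin m) :
    σ (j (C (a i k))) = j (C (a i k)) := by
  by_contra hmove
  have hinf := hF.F3
  let φ : R →ₐ[ℂ] Ω := j.comp (IsScalarTower.toAlgHom ℂ R (MvPolynomial (Fin n) R))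
  have hφ : ∀ x, φ x = j (C x) := fun x => rfl
  have hσX : ∀ i, σ (j (X i)) = j (X i) := fun i => by
    have := hσ (∑ k, C (l k i) * X k)
    rwa [psi_l hF] at this
  have hσΔ : ∀ k, ∑ i, j (X i) * (σ (j (C (a i k))) - j (C (a i k))) = 0 := by
    intro k
    have := hσ (X k)
    simp only [psi, aeval_X, map_sum, map_mul, hσX] at this
    simp only [mul_sub, Finset.sum_sub_distrib, this, sub_self]
  have hmin := minors_zero hF j hj hΩ σ hσΔ
  let Cc : Subalgebra ℂ Ω := j.range ⊔ (σ.comp φ).range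
  have hfg : Cc.FG := by
    apply Subalgebra.FG.sup
    · rw [← Algebra.map_top]; exact Subalgebra.FG.map _ Algebra.FiniteType.out
    · rw [← Algebra.map_top]; exact Subalgebra.FG.map _ Algebra.FiniteType.out
  have hft : Algebra.FiniteType ℂ Cc := Cc.fg_iff_finiteType.1 hfg
  let F : MvPolynomial (Fin n) R →ₐ[ℂ] Cc := j.codRestrict Cc (fun x =>
    (le_sup_left : j.range ≤ Cc) ⟨x, rfl⟩)
  let G : R →ₐ[ℂ] Cc := (σ.comp φ).codRestrict Cc (fun x =>
    (le_sup_right : (σ.comp φ).range ≤ Cc) ⟨x, rfl⟩)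
  have hFv : ∀ x, (F x : Ω) = j x := fun x => rfl
  have hGv : ∀ x, (G x : Ω) = σ (j (C x)) := fun x => rfl
  have hFinj : Function.Injective F := fun x y h => hj (congrArg Subtype.val h)
  obtain ⟨b, hb0, hb⟩ := extend_point F hFinj (G (a i k) - F (C (a i k))) (by
    intro h
    have := congrArg Subtype.val h
    simp only [Subalgebra.coe_sub, hFv, hGv, Subalgebra.coe_zero] at this
    exact hmove (sub_eq_zero.1 this))
  obtain ⟨d, hd⟩ := MvPolynomial.ne_zero_iff.1 hb0
  obtain ⟨χ, hχ⟩ := ((hB.union (hF.F5 _ hd)).infinite_compl).nonempty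
  simp only [Set.mem_compl_iff, Set.mem_union, not_or] at hχ
  obtain ⟨hχ1, hχ2⟩ := hχ
  have hχ2 : χ (coeff d b) ≠ 0 := hχ2
  have hD : {χ' : R →ₐ[ℂ] ℂ | R1 (a.map χ - a.map χ')}.Finite := by
    have : ¬ R1 (Matrix.of fun i k => algebraMap ℂ R (χ (a i k)) - a i k) := hχ1
    unfold R1 at this
    push Not at this
    obtain ⟨i1, i2, k1, k2, hne⟩ := this
    refine (hF.F5 _ hne).subset ?_
    intro χ' hχ'
    have := hχ' i1 i2 k1 k2
    simpa using this
  have hne : ∀ χ' : R →ₐ[ℂ] ℂ, ∃ k, χ' ≠ χ → (∑ i, C (χ (a i k) - χ' (a i k)) * X i : MvPolynomial (Fin n) ℂ) ≠ 0 := by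
    intro χ'
    by_cases h : χ' = χ
    · exact ⟨k, fun h' => absurd h h'⟩
    have : ∃ i k, χ' (a i k) ≠ χ (a i k) := by
      by_contra hc
      push Not at hc
      exact h (hF.ext_hom (by ext i k; exact hc i k))
    obtain ⟨i1, k1, h1⟩ := this
    refine ⟨k1, fun _ h0 => h1 ?_⟩
    have := congrArg (eval (Pi.single i1 1)) h0
    simp [Pi.single_apply] at this
    exact (sub_eq_zero.1 this).symm
  choose kk hkk using hne
  classical
  let Q : MvPolynomial (Fin n) ℂ := (b.map χ.toRingHom) *
    ∏ χ' ∈ hD.toFinset.erase χ, (∑ i, C (χ (a i (kk χ')) - χ' (a i (kk χ'))) * X i)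
  have hQ : Q ≠ 0 := by
    apply mul_ne_zero
    · intro h0
      apply hχ2
      have := congrArg (coeff d) h0
      simpa [coeff_map] using this
    · rw [Finset.prod_ne_zero_iff]
      intro χ' hχ'
      exact hkk _ (Finset.ne_of_mem_erase hχ')
  have : ∃ s, eval s Q ≠ 0 := by
    by_contra hc
    push Not at hc
    exact hQ (MvPolynomial.funext (by simpa using hc))
  obtain ⟨s, hs⟩ := this
  simp only [Q, map_mul, map_prod] at hs
  obtain ⟨hs1, hs2⟩ := mul_ne_zero_iff.1 hs
  rw [Finset.prod_ne_zero_iff] at hs2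
  obtain ⟨ξ, hξ, hξ0⟩ := hb (pt χ s) (by
    intro h0
    apply hs1
    rw [← h0, eval_map]
    simp [pt, aevalTower])
  have hξF : ∀ x, ξ (F x) = pt χ s x := fun x => congrArg (fun ψ => ψ x) hξ
  let χ' : R →ₐ[ℂ] ℂ := ξ.comp G
  have hχ' : ∀ x, χ' x = ξ (G x) := fun x => rfl
  have hneχ : χ' ≠ χ := by
    intro h
    apply hξ0
    rw [map_sub, ← hχ', hξF, pt_C, h, sub_self]
  have hR1 : R1 (a.map χ - a.map χ') := by
    intro i1 i2 k1 k2
    have h1 : (G (a i1 k1) - F (C (a i1 k1))) * (G (a i2 k2) - F (C (a i2 k2))) -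
       (G (a i1 k2) - F (C (a i1 k2))) * (G (a i2 k1) - F (C (a i2 k1))) = 0 := by
      apply Subtype.ext
      have := hmin i1 i2 k1 k2
      simpa [hFv, hGv] using this
    have h2 := congrArg ξ h1
    simp only [map_sub, map_mul, ← hχ', hξF, pt_C, map_zero] at h2
    simp only [Matrix.sub_apply, Matrix.map_apply]
    linear_combination h2
  apply hs2 χ' (by simp [hneχ, hR1])
  have h1 : ∑ i1, F (X i1) * (G (a i1 (kk χ')) - F (C (a i1 (kk χ')))) = 0 := by
    apply Subtype.ext
    have := hσΔ (kk χ')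
    simpa [hFv, hGv] using this
  have h2 := congrArg ξ h1
  simp only [map_sub, map_mul, map_sum, ← hχ', hξF, pt_C, pt_X, map_zero] at h2
  simp only [map_sum, map_mul, eval_C, eval_X]
  rw [← neg_eq_zero, ← h2, ← Finset.sum_neg_distrib]
  refine Finset.sum_congr rfl fun i _ => ?_
  ring

/-- S8 -/
lemma fixed_or_bot (hn : 2 ≤ n) (hI : Hyp I n)
    (H4 : ∀ c : Fin m → ℂ, ∑ k, C (c k) * X k ∈ I → c = 0) (hF : Fam I l a)
    {Ω : Type} [Field Ω] [Algebra ℂ Ω]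
    (j : MvPolynomial (Fin n) R →ₐ[ℂ] Ω) (hj : Function.Injective j)
    (hΩ : ∀ z : Ω, ∃ q : Polynomial (MvPolynomial (Fin n) R), q ≠ 0 ∧ q.eval₂ j.toRingHom z = 0) :
    I = ⊥ ∨ ∀ σ : Ω →ₐ[ℂ] Ω, (∀ f, σ (j (psi a f)) = j (psi a f)) → ∀ i k,
      σ (j (C (a i k))) = j (C (a i k)) := by
  by_cases hB : {χ : R →ₐ[ℂ] ℂ | R1 (Matrix.of fun i k =>
    algebraMap ℂ R (χ (a i k)) - a i k)}.Finite
  · right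
    intro σ hσ
    exact fixed_of_finite hF hB j hj hΩ σ hσ
  · left
    exact bot_of_B0 hn hI H4 hF hB

end
end ScrollPf

end

section
open MvPolynomial Matrix

namespace ScrollPf

lemma alg_gen_field {S Ω K : Type*} [CommRing S] [Field Ω] [Field K] [Algebra K Ω]
    (j : S →+* Ω) (hj : Function.Injective j)
    (hΩ : ∀ z : Ω, ∃ q : Polynomial S, q ≠ 0 ∧ q.eval₂ j z = 0)
    (hD : ∀ x, IsAlgebraic K (j x)) : Algebra.IsAlgebraic K Ω := by
  let E := Subalgebra.algebraicClosure K Ω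
  have hE : Algebra.IsAlgebraic K E := inferInstance
  constructor
  intro z
  apply IsAlgebraic.restrictScalars K (S := E)
  obtain ⟨q, hq, hqz⟩ := hΩ z
  let φ : S →+* E := j.codRestrict E (fun x => hD x)
  refine ⟨q.map φ, ?_, ?_⟩
  · rw [Ne, Polynomial.map_eq_zero_iff]
    · exact hq
    · intro x y hxy; exact hj (congrArg Subtype.val hxy)
  · rw [Polynomial.aeval_def, Polynomial.eval₂_map]; exact hqz

/-- the properties of the rational section -/
structure Sec {n m : ℕ} (I : Ideal (MvPolynomial (Fin m) ℂ)) (l : Matrix (Fin m) (Fin n) ℂ)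
    {K : Type} [Field K] [Algebra ℂ K] (x : Fin m → K) (α : Matrix (Fin n) (Fin m) K) : Prop where
  G1 : α * l.map (algebraMap ℂ K) = 1
  G2 : ∀ f ∈ I, aeval (fun k => ∑ i, X i * C (α i k)) f = (0 : MvPolynomial (Fin n) K)
  G3 : x = (x ᵥ* l.map (algebraMap ℂ K)) ᵥ* α
  G4 : ∀ i k i' k', ∃ P : MvPolynomial (Fin 2) ℂ, P ≠ 0 ∧ aeval ![α i k, α i' k'] P = 0


lemma exists_Omega (S : Type) [CommRing S] [IsDomain S] [Algebra ℂ S] :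
    ∃ (Ω : Type) (_ : Field Ω) (_ : Algebra ℂ Ω) (_ : IsAlgClosed Ω) (j : S →ₐ[ℂ] Ω),
      Function.Injective j ∧ ∀ z : Ω, ∃ q : Polynomial S, q ≠ 0 ∧ q.eval₂ j.toRingHom z = 0 := by
  refine ⟨AlgebraicClosure (FractionRing S), inferInstance, inferInstance, inferInstance,
    IsScalarTower.toAlgHom ℂ S (AlgebraicClosure (FractionRing S)), ?_, ?_⟩
  · change Function.Injective (algebraMap S (AlgebraicClosure (FractionRing S)))
    rw [IsScalarTower.algebraMap_eq S (FractionRing S) (AlgebraicClosure (FractionRing S))]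
    exact (algebraMap (FractionRing S) (AlgebraicClosure (FractionRing S))).injective.comp
      (IsFractionRing.injective S (FractionRing S))
  · intro z
    have h1 : IsAlgebraic (FractionRing S) z := Algebra.IsAlgebraic.isAlgebraic z
    exact (IsFractionRing.isAlgebraic_iff S (FractionRing S) (AlgebraicClosure (FractionRing S))).2 h1

section
variable {n m : ℕ} {I : Ideal (MvPolynomial (Fin m) ℂ)} {l : Matrix (Fin m) (Fin n) ℂ}
    {R : Type} [CommRing R] [IsDomain R] [Algebra ℂ R] [Algebra.FiniteType ℂ R]
    {a : Matrix (Fin n) (Fin m) R}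
    {Ω : Type} [Field Ω] [Algebra ℂ Ω]
    {K : Type} [Field K] [Algebra ℂ K] [Algebra (MvPolynomial (Fin m) ℂ ⧸ I) K]
    [IsScalarTower ℂ (MvPolynomial (Fin m) ℂ ⧸ I) K]
    [IsFractionRing (MvPolynomial (Fin m) ℂ ⧸ I) K]

lemma exists_theta (hI : Hyp I n) (hF : Fam I l a)
    (j : MvPolynomial (Fin n) R →ₐ[ℂ] Ω) (hj : Function.Injective j) :
    ∃ θ : K →ₐ[ℂ] Ω, ∀ x, θ (algebraMap (MvPolynomial (Fin m) ℂ ⧸ I) K x) = j (psiA hI hF x) := by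
  have hθ0 : Function.Injective (j.comp (psiA hI hF)).toRingHom := hj.comp (psiA_inj hI hF)
  let θ : K →+* Ω := IsFractionRing.lift (A := (MvPolynomial (Fin m) ℂ ⧸ I))
    (g := (j.comp (psiA hI hF)).toRingHom) hθ0
  have hθ : ∀ x, θ (algebraMap (MvPolynomial (Fin m) ℂ ⧸ I) K x) = j (psiA hI hF x) :=
    fun x => IsFractionRing.lift_algebraMap hθ0 x
  refine ⟨{ θ with commutes' := ?_ }, hθ⟩
  intro c
  have : θ (algebraMap ℂ K c) = algebraMap ℂ Ω c := by
    rw [IsScalarTower.algebraMap_apply ℂ (MvPolynomial (Fin m) ℂ ⧸ I) K, hθ]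
    rw [AlgHom.commutes, AlgHom.commutes]
  exact this

lemma descend [IsAlgClosed Ω] (hn : 0 < n) (hI : Hyp I n) (hF : Fam I l a)
    (j : MvPolynomial (Fin n) R →ₐ[ℂ] Ω) (hj : Function.Injective j)
    (hΩ : ∀ z : Ω, ∃ q : Polynomial (MvPolynomial (Fin n) R), q ≠ 0 ∧ q.eval₂ j.toRingHom z = 0)
    (hfix : ∀ σ : Ω →ₐ[ℂ] Ω, (∀ f, σ (j (psi a f)) = j (psi a f)) →
      ∀ i k, σ (j (C (a i k))) = j (C (a i k)))
    (θ : K →ₐ[ℂ] Ω)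
    (hθ : ∀ x, θ (algebraMap (MvPolynomial (Fin m) ℂ ⧸ I) K x) = j (psiA hI hF x)) (i : Fin n)
    (k : Fin m) : ∃ y, θ y = j (C (a i k)) := by
  let : Algebra K Ω := θ.toRingHom.toAlgebra
  have hθa : ∀ x, algebraMap K Ω x = θ x := fun x => rfl
  have : IsScalarTower ℂ K Ω := by
    apply IsScalarTower.of_algebraMap_eq
    intro c
    rw [hθa, AlgHom.commutes]
  have e1 : ∀ x, IsAlgebraic K (j (C x)) := by
    intro x
    obtain ⟨q, hq, hqx⟩ := algebraic_over_A hn hI hF x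
    refine ⟨q.map (algebraMap (MvPolynomial (Fin m) ℂ ⧸ I) K), ?_, ?_⟩
    · rw [Ne, Polynomial.map_eq_zero_iff (IsFractionRing.injective (MvPolynomial (Fin m) ℂ ⧸ I) K)]
      exact hq
    · rw [Polynomial.aeval_def, Polynomial.eval₂_map]
      have h1 : (algebraMap K Ω).comp (algebraMap (MvPolynomial (Fin m) ℂ ⧸ I) K) =
          j.toRingHom.comp (psiA hI hF).toRingHom := RingHom.ext fun x => hθ x
      rw [h1, show j (C x) = j.toRingHom (C x) from rfl, ← Polynomial.hom_eval₂, hqx, map_zero]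
  have e2 : ∀ i, j (X i) = algebraMap K Ω (algebraMap (MvPolynomial (Fin m) ℂ ⧸ I) K
      (Ideal.Quotient.mk I (∑ k, C (l k i) * X k))) := by
    intro i
    rw [hθa, hθ, psiA_mk, psi_l hF]
  have hK : ∀ x, IsAlgebraic K (j x) := by
    intro x
    induction x using MvPolynomial.induction_on with
    | C r => exact e1 r
    | add p q hp hq => rw [map_add]; exact hp.add hq
    | mul_X p i0 hp =>
      rw [map_mul]
      refine hp.mul ?_
      rw [e2]
      exact isAlgebraic_algebraMap _
  have hKΩ : Algebra.IsAlgebraic K Ω := alg_gen_field j.toRingHom hj hΩ hK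
  have hac : IsAlgClosure K Ω := ⟨inferInstance, hKΩ⟩
  have hnorm : Normal K Ω := IsAlgClosure.normal K Ω
  have hchar : CharZero K := charZero_of_injective_algebraMap (algebraMap ℂ K).injective
  have hgal : IsGalois K Ω := ⟨⟩
  have := (InfiniteGalois.mem_range_algebraMap_iff_fixed (k := K) (K := Ω) (j (C (a i k)))).2 (by
      intro σ
      refine hfix (σ.toAlgHom.restrictScalars ℂ) ?_ i k
      intro f
      rw [← psiA_mk hI hF, ← hθ]
      exact σ.commutes _)
  exact this

lemma sec_of_theta (hI : Hyp I n) (hF : Fam I l a)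
    (j : MvPolynomial (Fin n) R →ₐ[ℂ] Ω)
    (θ : K →ₐ[ℂ] Ω)
    (hθ : ∀ x, θ (algebraMap (MvPolynomial (Fin m) ℂ ⧸ I) K x) = j (psiA hI hF x))
    (α : Matrix (Fin n) (Fin m) K) (hα : ∀ i k, θ (α i k) = j (C (a i k))) :
    Sec I l (fun k => algebraMap (MvPolynomial (Fin m) ℂ ⧸ I) K (Ideal.Quotient.mk I (X k))) α := by
  have hinj : Function.Injective θ := θ.toRingHom.injective
  have hθmk : ∀ f, θ (algebraMap (MvPolynomial (Fin m) ℂ ⧸ I) K (Ideal.Quotient.mk I f)) =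
    j (psi a f) := fun f => hθ _
  obtain ⟨φ, hφ⟩ : ∃ φ : R →ₐ[ℂ] Ω, ∀ x, φ x = j (C x) :=
    ⟨j.comp (IsScalarTower.toAlgHom ℂ R (MvPolynomial (Fin n) R)), fun x => rfl⟩
  have hφα : ∀ i k, θ (α i k) = φ (a i k) := fun i k => by rw [hα, hφ]
  refine ⟨?_, ?_, ?_, ?_⟩
  · ext i i'
    apply hinj
    have := congrArg φ (congrFun (congrFun hF.F1 i) i')
    simp only [Matrix.mul_apply, map_sum, map_mul, Matrix.map_apply, hφα,
      AlgHom.commutes, Matrix.one_apply] at this ⊢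
    rw [this]
    split_ifs <;> simp
  · intro f hf
    have h0 := (psi_eq_zero_iff hI hF f).2 hf
    apply MvPolynomial.map_injective θ.toRingHom hinj
    rw [map_zero]
    have h1 : ((MvPolynomial.mapAlgHom θ).comp
        (aeval (fun k => ∑ i, X i * C (α i k)) : MvPolynomial (Fin m) ℂ →ₐ[ℂ] _)) =
        (MvPolynomial.mapAlgHom φ).comp (psi a) := by
      ext1 k
      simp only [AlgHom.comp_apply, psi, aeval_X, map_sum, map_mul, mapAlgHom_apply, map_X]
      refine Finset.sum_congr rfl fun i _ => ?_
      congr 1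
      rw [map_C, map_C]
      congr 1
      exact hφα i k
    have h2 := congrArg (fun ψ => ψ f) h1
    simp only [AlgHom.comp_apply, h0, map_zero] at h2
    exact h2
  · ext k
    apply hinj
    rw [hθmk]
    simp only [vecMul, dotProduct, map_sum, map_mul, Matrix.map_apply, AlgHom.commutes, hθmk]
    have : ∀ i, ∑ k', j (psi a (X k')) * algebraMap ℂ Ω (l k' i) = j (X i) := by
      intro i
      rw [← psi_l hF, map_sum, map_sum]
      refine Finset.sum_congr rfl fun k' _ => ?_
      rw [map_mul, map_mul, mul_comm, MvPolynomial.algHom_C, AlgHom.commutes]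
    simp only [this]
    simp only [psi, aeval_X, map_sum, map_mul, hα]
  · intro i k i' k'
    obtain ⟨P, hP, h⟩ := alg_dependent hF (a i k) (a i' k')
    refine ⟨P, hP, ?_⟩
    apply hinj
    have h1 := dep_map θ (α i k) (α i' k') P
    have h2 := dep_map φ (a i k) (a i' k') P
    rw [h, map_zero] at h2
    rw [map_zero, ← h1, hφα, hφα, h2]

lemma exists_alpha_aux
    (hn : 2 ≤ n) (hI : Hyp I n)
    (H4 : ∀ c : Fin m → ℂ, ∑ k, C (c k) * X k ∈ I → c = 0) (hF : Fam I l a) :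
    I = ⊥ ∨ ∃ α : Matrix (Fin n) (Fin m) K,
      Sec I l (fun k => algebraMap (MvPolynomial (Fin m) ℂ ⧸ I) K (Ideal.Quotient.mk I (X k))) α := by
  obtain ⟨Ω, _, _, _, j, hj, hΩ⟩ := exists_Omega (MvPolynomial (Fin n) R)
  refine (fixed_or_bot hn hI H4 hF j hj hΩ).imp id ?_
  intro hfix
  obtain ⟨θ, hθ⟩ := exists_theta (K := K) hI hF j hj
  choose α hα using descend (by omega) hI hF j hj hΩ hfix θ hθ
  exact ⟨α, sec_of_theta hI hF j θ hθ α hα⟩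

end

lemma exists_alpha {n m : ℕ} {I : Ideal (MvPolynomial (Fin m) ℂ)} {l : Matrix (Fin m) (Fin n) ℂ}
    (hn : 2 ≤ n) (hI : Hyp I n)
    (H4 : ∀ c : Fin m → ℂ, ∑ k, C (c k) * X k ∈ I → c = 0) (hE : (E0 I l).Infinite)
    {K : Type} [Field K] [Algebra ℂ K] [Algebra (MvPolynomial (Fin m) ℂ ⧸ I) K]
    [IsScalarTower ℂ (MvPolynomial (Fin m) ℂ ⧸ I) K]
    [IsFractionRing (MvPolynomial (Fin m) ℂ ⧸ I) K] :
    I = ⊥ ∨ ∃ α : Matrix (Fin n) (Fin m) K,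
      Sec I l (fun k => algebraMap (MvPolynomial (Fin m) ℂ ⧸ I) K (Ideal.Quotient.mk I (X k))) α := by
  obtain ⟨J, hJ, hF⟩ := exists_fam I l hE
  have := Ideal.Quotient.isDomain J
  exact exists_alpha_aux hn hI H4 hF

end ScrollPf

end

section
open MvPolynomial Matrix

namespace ScrollPf

lemma aeval_push {σ A B : Type*} [CommRing A] [CommRing B] [Algebra ℂ A] [Algebra ℂ B]
    (φ : A →ₐ[ℂ] B) (g : σ → A) (f : MvPolynomial σ ℂ) :
    φ (aeval g f) = aeval (fun i => φ (g i)) f := MvPolynomial.comp_aeval_apply g φ f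

lemma no_bad {n m : ℕ} {I : Ideal (MvPolynomial (Fin m) ℂ)} {l : Matrix (Fin m) (Fin n) ℂ}
    {v : Fin m → ℂ} (hgood : ∀ W, IsRul I n W → v ∈ W → Good W l)
    {κ : Type*} [Field κ] [Algebra ℂ κ] (N : Matrix (Fin n) (Fin m) κ) (I0 : Fin n → Fin m)
    (h1 : ∀ i j, N i (I0 j) = if i = j then 1 else 0)
    (h2 : ∀ f ∈ I, ∀ s : Fin n → ℂ, aeval (fun k => ∑ i, algebraMap ℂ κ (s i) * N i k) f = 0)
    (h3 : ∀ k, algebraMap ℂ κ (v k) = ∑ i, algebraMap ℂ κ (v (I0 i)) * N i k) :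
    (N * l.map (algebraMap ℂ κ)).det ≠ 0 := by
  intro h4
  let S : Set κ := Set.range fun p : Fin n × Fin m => N p.1 p.2
  let Cs : Subalgebra ℂ κ := Algebra.adjoin ℂ S
  have hft : Algebra.FiniteType ℂ Cs :=
    Cs.fg_iff_finiteType.1 (Subalgebra.fg_def.2 ⟨S, Set.finite_range _, rfl⟩)
  obtain ⟨ψ, -⟩ := exists_point (1 : Cs) one_ne_zero
  have hN : ∀ i k, N i k ∈ Cs := fun i k => Algebra.subset_adjoin ⟨(i, k), rfl⟩
  obtain ⟨N', hN'⟩ : ∃ N' : Matrix (Fin n) (Fin m) Cs, ∀ i k, (N' i k : κ) = N i k :=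
    ⟨fun i k => ⟨N i k, hN i k⟩, fun i k => rfl⟩
  have hinj : Function.Injective Cs.val := Subtype.val_injective
  have hv : ∀ y : Cs, Cs.val y = y := fun y => rfl
  let e : Matrix (Fin n) (Fin m) ℂ := N'.map ψ
  have e1 : ∀ i j, e i (I0 j) = if i = j then 1 else 0 := by
    intro i j
    have : N' i (I0 j) = if i = j then 1 else 0 := by
      apply hinj
      rw [hv, hN', h1]; split_ifs <;> simp
    simp only [e, Matrix.map_apply, this]
    split_ifs <;> simp
  have e2 : RulM I e := by
    intro f hf s
    have : aeval (fun k => ∑ i, algebraMap ℂ Cs (s i) * N' i k) f = 0 := by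
      apply hinj
      rw [aeval_push, map_zero, ← h2 f hf s]
      congr 2
      ext k
      simp [hN']
    have := congrArg ψ this
    rw [aeval_push, map_zero] at this
    rw [← this, MvPolynomial.aeval_eq_eval]
    congr 2
    ext k
    simp [Matrix.vecMul, dotProduct, e]
  have e3 : v = (fun i => v (I0 i)) ᵥ* e := by
    ext k
    have : algebraMap ℂ Cs (v k) = ∑ i, algebraMap ℂ Cs (v (I0 i)) * N' i k := by
      apply hinj
      simp only [map_sum, map_mul, AlgHom.commutes]
      simp only [hv, hN']
      exact h3 k
    have := congrArg ψ this
    simpa [Matrix.vecMul, dotProduct, e] using this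
  have e4 : (e * l).det = 0 := by
    have : (N' * l.map (algebraMap ℂ Cs)).det = 0 := by
      apply hinj
      rw [AlgHom.map_det, map_zero, ← h4]
      congr 1
      ext i j
      simp [Matrix.mul_apply, hN']
    have := congrArg ψ this
    rw [AlgHom.map_det, map_zero] at this
    rw [← this]
    congr 1
    ext i j
    simp [Matrix.mul_apply, e]
  have hin : ∀ s, s ᵥ* e = 0 → s = 0 := by
    intro s hs
    ext j
    have := congrFun hs (I0 j)
    simpa [Matrix.vecMul, dotProduct, e1] using this
  exact (good_iff (rowSp e) e (fun w => mem_rowSp e w) hin l).1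
    (hgood _ (rowSp_isRul hin e2) ((mem_rowSp e v).2 ⟨_, e3.symm⟩)) e4

lemma sec_mem {n m : ℕ} {I : Ideal (MvPolynomial (Fin m) ℂ)} {l : Matrix (Fin m) (Fin n) ℂ}
    {v : Fin m → ℂ} (hgood : ∀ W, IsRul I n W → v ∈ W → Good W l)
    {K : Type} [Field K] [Algebra ℂ K] {x : Fin m → K} {α : Matrix (Fin n) (Fin m) K}
    (hs : Sec I l x α) (Vr : ValuationSubring K) (hc : ∀ c : ℂ, algebraMap ℂ K c ∈ Vr)
    (xv : Fin m → Vr) (hxv : ∀ k, (xv k : K) = x k)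
    (hx : ∀ k, xv k - ⟨algebraMap ℂ K (v k), hc _⟩ ∈ IsLocalRing.maximalIdeal Vr) (i : Fin n)
    (k : Fin m) : α i k ∈ Vr := by
  -- choose the best minor
  obtain ⟨f0, hf0⟩ := cauchy_binet_exists α (l.map (algebraMap ℂ K)) (by rw [hs.G1]; simp)
  have hne : Nonempty (Fin n → Fin m) := ⟨f0⟩
  obtain ⟨I0, -, hI0⟩ := Finset.exists_max_image (Finset.univ : Finset (Fin n → Fin m))
    (fun f => Vr.valuation (α.submatrix id f).det) Finset.univ_nonempty
  have hd : (α.submatrix id I0).det ≠ 0 := by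
    intro h
    have := hI0 f0 (Finset.mem_univ _)
    rw [h, map_zero] at this
    exact hf0 ((map_eq_zero _).1 (le_zero_iff.1 this))
  obtain ⟨B, hB⟩ : ∃ B, B = α.submatrix id I0 := ⟨_, rfl⟩
  rw [← hB] at hd
  have hBu : IsUnit B.det := isUnit_iff_ne_zero.2 hd
  have hNmem : ∀ i k, (B⁻¹ * α) i k ∈ Vr := by
    intro i k
    have h1 : B * B⁻¹ = 1 := Matrix.mul_nonsing_inv B hBu
    have h2 : (B⁻¹ * α) i k = (α.submatrix id (Function.update I0 i k)).det / B.det := by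
      have h3 : α.submatrix id (Function.update I0 i k) = B.updateCol i (fun j => α j k) := by
        ext p q
        by_cases hq : q = i
        · subst hq; simp
        · simp [hq, hB]
      rw [h3, ← Matrix.cramer_apply, Matrix.cramer_eq_adjugate_mulVec, Matrix.inv_def]
      simp [Matrix.mul_apply, Matrix.mulVec, dotProduct, Finset.sum_div]
      refine Finset.sum_congr rfl fun j _ => by ring
    rw [h2, ← Vr.valuation_le_one_iff, map_div₀]
    apply div_le_one_of_le₀
    · rw [hB]; exact hI0 _ (Finset.mem_univ _)
    · exact zero_le
  let N : Matrix (Fin n) (Fin m) Vr := fun i k => ⟨(B⁻¹ * α) i k, hNmem i k⟩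
  have hN : ∀ i k, (N i k : K) = (B⁻¹ * α) i k := fun i k => rfl
  have hBB : B⁻¹ * B = 1 := Matrix.nonsing_inv_mul B hBu
  have hBB' : B * B⁻¹ = 1 := Matrix.mul_nonsing_inv B hBu
  have hNI : ∀ i j, N i (I0 j) = if i = j then 1 else 0 := by
    intro i j
    apply Subtype.ext
    rw [hN]
    have : (B⁻¹ * α) i (I0 j) = (B⁻¹ * B) i j := by simp [Matrix.mul_apply, hB]
    rw [this, hBB, Matrix.one_apply]
    split_ifs <;> rfl
  have hinj : Function.Injective Vr.subtype := Subtype.val_injective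
  have hv : ∀ y : Vr, Vr.subtype y = y := fun y => rfl
  let ι : ℂ →+* Vr := (algebraMap ℂ K).codRestrict Vr.toSubring hc
  have hι : ∀ c, (ι c : K) = algebraMap ℂ K c := fun c => rfl
  have hf : ∀ f ∈ I, ∀ s : Fin n → ℂ, eval₂ ι (fun k => ∑ i, ι (s i) * N i k) f = 0 := by
    intro f hf s
    have h0 := congrArg (aeval (R := K) ((fun i => algebraMap ℂ K (s i)) ᵥ* B⁻¹)) (hs.G2 f hf)
    have h0' : (aeval (R := K) ((fun i => algebraMap ℂ K (s i)) ᵥ* B⁻¹)).restrictScalars ℂ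
       (aeval (fun k => ∑ i, X i * C (α i k)) f) = 0 := by
       rw [map_zero] at h0; exact h0
    rw [aeval_push] at h0'
    apply hinj
    rw [eval₂_comp_left, map_zero, ← h0', aeval_def]
    congr 1
    ext k
    have h5 : (fun i => algebraMap ℂ K (s i)) ᵥ* (B⁻¹ * α) =
      ((fun i => algebraMap ℂ K (s i)) ᵥ* B⁻¹) ᵥ* α := by rw [Matrix.vecMul_vecMul]
    have h6 := congrFun h5 k
    simp only [Function.comp, map_sum, map_mul]
    simp only [hv, hN, hι]
    refine Eq.trans h6 ?_
    simp only [AlgHom.restrictScalars_apply, aeval_X, MvPolynomial.algHom_C,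
      Matrix.vecMul, dotProduct, Algebra.algebraMap_self, RingHom.id_apply]
  have hxN : ∀ k, xv k = ∑ i, xv (I0 i) * N i k := by
    intro k
    apply hinj
    simp only [map_sum, map_mul]
    simp only [hv, hN, hxv]
    obtain ⟨u, hu⟩ : ∃ u, u = x ᵥ* l.map (algebraMap ℂ K) := ⟨_, rfl⟩
    have h3 : x = u ᵥ* α := by rw [hu]; exact hs.G3
    have h4 : (fun i => x (I0 i)) = u ᵥ* B := by
      ext i
      rw [h3]
      simp [Matrix.vecMul, dotProduct, hB]
    have h5 : x = (u ᵥ* B) ᵥ* (B⁻¹ * α) := by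
      rw [Matrix.vecMul_vecMul, ← Matrix.mul_assoc, hBB', Matrix.one_mul, h3]
    rw [← h4] at h5
    exact congrFun h5 k
  have hNl : B * (N * l.map ι).map Vr.subtype = 1 := by
    have : (N * l.map ι).map Vr.subtype = B⁻¹ * α * l.map (algebraMap ℂ K) := by
      ext i j
      simp [Matrix.mul_apply, hN, hι]
    rw [this, ← Matrix.mul_assoc, ← Matrix.mul_assoc, hBB', Matrix.one_mul, hs.G1]
  -- the residue field
  let κ := IsLocalRing.ResidueField Vr
  let ρ : Vr →+* IsLocalRing.ResidueField Vr := IsLocalRing.residue Vr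
  let : Algebra ℂ (IsLocalRing.ResidueField Vr) := (ρ.comp ι).toAlgebra
  have hρ : ∀ c, algebraMap ℂ (IsLocalRing.ResidueField Vr) c = ρ (ι c) := fun c => rfl
  have hρx : ∀ k, ρ (xv k) = ρ (ι (v k)) := by
    intro k
    have := (IsLocalRing.residue_eq_zero_iff _).2 (hx k)
    rw [map_sub, sub_eq_zero] at this
    exact this
  have hdet := no_bad hgood (κ := IsLocalRing.ResidueField Vr) (N.map ρ) I0 (by
      intro i j
      rw [Matrix.map_apply, hNI]; split_ifs <;> simp) (by
      intro f hf' s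
      have := congrArg ρ (hf f hf' s)
      rw [eval₂_comp_left, map_zero] at this
      rw [← this, aeval_def]
      congr 1
      ext k
      simp [hρ]) (by
      intro k
      have := congrArg ρ (hxN k)
      simp only [map_sum, map_mul, hρx] at this
      exact this)
  have hdet2 : ρ (N * l.map ι).det ≠ 0 := by
    rw [RingHom.map_det]
    have : ρ.mapMatrix (N * l.map ι) = N.map ρ * l.map (algebraMap ℂ (IsLocalRing.ResidueField Vr)) := by
      ext i j
      simp [Matrix.mul_apply, hρ]
    rw [this]
    exact hdet
  have hunit : IsUnit (N * l.map ι).det := (IsLocalRing.residue_ne_zero_iff_isUnit _).1 hdet2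
  have hB2 : B = ((N * l.map ι)⁻¹).map Vr.subtype := by
    have h1 : (N * l.map ι).map Vr.subtype * ((N * l.map ι)⁻¹).map Vr.subtype = 1 := by
      rw [← Matrix.map_mul, Matrix.mul_nonsing_inv _ hunit]
      simp
    calc B = B * ((N * l.map ι).map Vr.subtype * ((N * l.map ι)⁻¹).map Vr.subtype) := by
          rw [h1, Matrix.mul_one]
      _ = _ := by rw [← Matrix.mul_assoc, hNl, Matrix.one_mul]
  have hα : α = ((N * l.map ι)⁻¹ * N).map Vr.subtype := by
    rw [Matrix.map_mul, ← hB2]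
    have : N.map Vr.subtype = B⁻¹ * α := by ext i k; rfl
    rw [this, ← Matrix.mul_assoc, hBB', Matrix.one_mul]
  rw [hα]
  exact Subtype.property _

end ScrollPf

end

section
open MvPolynomial Matrix

namespace ScrollPf

/-- abstract local ring of the affine cone at a point -/
structure LocAt {m : ℕ} (I : Ideal (MvPolynomial (Fin m) ℂ)) (v : Fin m → ℂ)
    {O : Type} [CommRing O] [IsLocalRing O] [Algebra ℂ O] (π : MvPolynomial (Fin m) ℂ →ₐ[ℂ] O) :
    Prop where
  L1 : ∀ f, π f = 0 ↔ f ∈ I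
  L2 : ∀ f, π f ∈ IsLocalRing.maximalIdeal O ↔ eval v f = 0
  L3 : ∀ y, ∃ f s, eval v s ≠ 0 ∧ π s * y = π f

section
variable {n m : ℕ} {I : Ideal (MvPolynomial (Fin m) ℂ)} {l : Matrix (Fin m) (Fin n) ℂ}
  {v : Fin m → ℂ} {O : Type} [CommRing O] [IsLocalRing O] [Algebra ℂ O]
  {π : MvPolynomial (Fin m) ℂ →ₐ[ℂ] O}

lemma LocAt.exists_ev (h : LocAt I v π) : ∃ ev : O →ₐ[ℂ] ℂ,
    (∀ y, ev y = 0 ↔ y ∈ IsLocalRing.maximalIdeal O) ∧ ∀ f, ev (π f) = eval v f := by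
  have hbij : Function.Bijective (Algebra.ofId ℂ (IsLocalRing.ResidueField O)) := by
    refine ⟨(Algebra.ofId ℂ (IsLocalRing.ResidueField O)).toRingHom.injective, ?_⟩
    intro y
    obtain ⟨y, rfl⟩ := IsLocalRing.residue_surjective y
    obtain ⟨f, s, hs, hy⟩ := h.L3 y
    refine ⟨eval v f / eval v s, ?_⟩
    have h1 : π s * (y - algebraMap ℂ O (eval v f / eval v s)) ∈ IsLocalRing.maximalIdeal O := by
      have : π s * (y - algebraMap ℂ O (eval v f / eval v s)) =
          π (f - C (eval v f / eval v s) * s) := by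
        rw [mul_sub, hy, map_sub, map_mul, MvPolynomial.algHom_C]; ring
      rw [this, h.L2]
      simp [hs]
    have h2 : π s ∉ IsLocalRing.maximalIdeal O := by rw [h.L2]; exact hs
    have h3 := ((IsLocalRing.maximalIdeal.isMaximal O).isPrime.mem_or_mem h1).resolve_left h2
    have h4 := (IsLocalRing.residue_eq_zero_iff _).2 h3
    rw [map_sub, sub_eq_zero] at h4
    rw [h4]
    rfl
  let E := AlgEquiv.ofBijective (Algebra.ofId ℂ (IsLocalRing.ResidueField O)) hbij
  let ev : O →ₐ[ℂ] ℂ := E.symm.toAlgHom.comp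
    (IsScalarTower.toAlgHom ℂ O (IsLocalRing.ResidueField O))
  have h0 : ∀ y, ev y = 0 ↔ y ∈ IsLocalRing.maximalIdeal O := by
    intro y
    rw [← IsLocalRing.residue_eq_zero_iff]
    change E.symm (IsLocalRing.residue O y) = 0 ↔ _
    exact map_eq_zero_iff _ E.symm.injective
  refine ⟨ev, h0, ?_⟩
  intro f
  have : ev (π (f - C (eval v f))) = 0 := by
    rw [h0, h.L2]; simp
  rw [map_sub, map_sub, sub_eq_zero, MvPolynomial.algHom_C, AlgHom.commutes] at this
  exact this

lemma sec_in_O [IsDomain O] [IsIntegrallyClosed O] (h : LocAt I v π)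
    (hgood : ∀ W, IsRul I n W → v ∈ W → Good W l)
    {K : Type} [Field K] [Algebra ℂ K] [Algebra O K] [IsScalarTower ℂ O K] [IsFractionRing O K]
    {α : Matrix (Fin n) (Fin m) K} (hs : Sec I l (fun k => algebraMap O K (π (X k))) α) (i k) :
    ∃ b, algebraMap O K b = α i k := by
  by_contra hcon
  push Not at hcon
  obtain ⟨Vr, j, hj, hjm, hx⟩ := dom_val (α i k) hcon
  have hc : ∀ c : ℂ, algebraMap ℂ K c ∈ Vr := by
    intro c
    rw [IsScalarTower.algebraMap_apply ℂ O K, ← hj]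
    exact Subtype.property _
  refine hx (sec_mem hgood hs Vr hc (fun k => j (π (X k))) (fun k => hj _) ?_ i k)
  intro k
  have h1 : π (X k - C (v k)) ∈ IsLocalRing.maximalIdeal O := by rw [h.L2]; simp
  have h2 := hjm _ h1
  convert h2 using 1
  rw [map_sub, map_sub]
  congr 1
  apply Subtype.ext
  rw [hj, MvPolynomial.algHom_C, ← IsScalarTower.algebraMap_apply]

lemma shift_dep {B : Type*} [CommRing B] [Algebra ℂ B] (x y : B) (c d : ℂ)
    (P : MvPolynomial (Fin 2) ℂ) (hP : P ≠ 0) (h : aeval ![x, y] P = 0) :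
    ∃ Q : MvPolynomial (Fin 2) ℂ, Q ≠ 0 ∧
      aeval ![x - algebraMap ℂ B c, y - algebraMap ℂ B d] Q = 0 := by
  let T : MvPolynomial (Fin 2) ℂ →ₐ[ℂ] MvPolynomial (Fin 2) ℂ := aeval ![X 0 + C c, X 1 + C d]
  let T' : MvPolynomial (Fin 2) ℂ →ₐ[ℂ] MvPolynomial (Fin 2) ℂ := aeval ![X 0 - C c, X 1 - C d]
  have hTT : T'.comp T = AlgHom.id _ _ := by
    ext i
    fin_cases i <;> simp [T, T', MvPolynomial.algHom_C]
  refine ⟨T P, ?_, ?_⟩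
  · intro h0
    apply hP
    have := congrArg (fun φ => φ P) hTT
    simp only [AlgHom.comp_apply, h0, map_zero] at this
    exact this.symm
  · have : (aeval ![x - algebraMap ℂ B c, y - algebraMap ℂ B d]).comp T = aeval ![x, y] := by
      ext i
      fin_cases i <;> simp [T, MvPolynomial.algHom_C]
    have := congrArg (fun φ => φ P) this
    exact this.trans h

lemma exists_common_div [IsDomain O] [IsIntegrallyClosed O] {ι : Type} [Fintype ι] (g : ι → O)
    (hg : ∀ i, g i ∈ IsLocalRing.maximalIdeal O)
    (hd : ∀ i j, ∃ P : MvPolynomial (Fin 2) ℂ, P ≠ 0 ∧ aeval ![g i, g j] P = 0) :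
    ∃ t ∈ IsLocalRing.maximalIdeal O, ∀ i, t ∣ g i := by
  classical
  have : ∀ s : Finset ι, ∃ t, (t = 0 ∨ ∃ i, t = g i) ∧ ∀ i ∈ s, t ∣ g i := by
    intro s
    induction s using Finset.induction_on with
    | empty => exact ⟨0, Or.inl rfl, by simp⟩
    | insert a s ha ih =>
      obtain ⟨t, ht, hts⟩ := ih
      rcases ht with rfl | ⟨i, rfl⟩
      · refine ⟨g a, Or.inr ⟨a, rfl⟩, ?_⟩
        intro i hi
        rcases Finset.mem_insert.1 hi with rfl | hi
        · exact dvd_rfl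
        · rw [zero_dvd_iff.1 (hts i hi)]; exact dvd_zero _
      · obtain ⟨P, hP, hPe⟩ := hd i a
        rcases dvd_or_dvd (g i) (g a) (hg i) P hP hPe with h | h
        · refine ⟨g i, Or.inr ⟨i, rfl⟩, ?_⟩
          intro k hk
          rcases Finset.mem_insert.1 hk with rfl | hk
          · exact h
          · exact hts k hk
        · refine ⟨g a, Or.inr ⟨a, rfl⟩, ?_⟩
          intro k hk
          rcases Finset.mem_insert.1 hk with rfl | hk
          · exact dvd_rfl
          · exact h.trans (hts k hk)
  obtain ⟨t, ht, hts⟩ := this Finset.univ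
  refine ⟨t, ?_, fun i => hts i (Finset.mem_univ _)⟩
  rcases ht with rfl | ⟨i, rfl⟩
  · exact zero_mem _
  · exact hg i

lemma local_gens [IsDomain O] [IsIntegrallyClosed O] (h : LocAt I v π)
    (hgood : ∀ W, IsRul I n W → v ∈ W → Good W l)
    {K : Type} [Field K] [Algebra ℂ K] [Algebra O K] [IsScalarTower ℂ O K] [IsFractionRing O K]
    {α : Matrix (Fin n) (Fin m) K} (hs : Sec I l (fun k => algebraMap O K (π (X k))) α) :
    ∃ c : Matrix (Fin n) (Fin m) ℂ, c * l = 1 ∧ RulM I c ∧ v = (v ᵥ* l) ᵥ* c ∧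
      ∃ f0, eval v f0 = 0 ∧ ∀ k, ∃ (s g : MvPolynomial (Fin m) ℂ)
        (p : Fin n → MvPolynomial (Fin m) ℂ), eval v s ≠ 0 ∧
        s * (X k - C (v k)) - ∑ i, p i * (∑ k, C (l k i) * (X k - C (v k))) - g * f0 ∈ I := by
  obtain ⟨ev, hev0, hev⟩ := h.exists_ev
  have hb := sec_in_O h hgood hs
  choose β hβ using hb
  have hinj : Function.Injective (algebraMap O K) := IsFractionRing.injective O K
  let jO : O →ₐ[ℂ] K := IsScalarTower.toAlgHom ℂ O K
  have hjO : ∀ y, jO y = algebraMap O K y := fun y => rfl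
  have hjinj : Function.Injective jO := hinj
  have b1 : ∀ i i', ∑ k, β i k * algebraMap ℂ O (l k i') = if i = i' then 1 else 0 := by
    intro i i'
    apply hinj
    have := congrFun (congrFun hs.G1 i) i'
    simp only [Matrix.mul_apply, Matrix.map_apply, Matrix.one_apply] at this
    simp only [map_sum, map_mul, hβ, ← IsScalarTower.algebraMap_apply]
    rw [this]; split_ifs <;> simp
  have b2 : ∀ f ∈ I, ∀ s : Fin n → ℂ,
      aeval (fun k => ∑ i, algebraMap ℂ O (s i) * β i k) f = 0 := by
    intro f hf s
    apply hjinj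
    rw [aeval_push, map_zero]
    have h0 : (aeval (R := K) (fun i => algebraMap ℂ K (s i))).restrictScalars ℂ
       (aeval (fun k => ∑ i, X i * C (α i k)) f) = 0 := by
       rw [hs.G2 f hf, map_zero]
    rw [aeval_push] at h0
    rw [← h0]
    congr 2
    ext k
    simp only [map_sum, map_mul, AlgHom.commutes]
    simp only [hjO, hβ, AlgHom.restrictScalars_apply, aeval_X, MvPolynomial.algHom_C,
      Algebra.algebraMap_self, RingHom.id_apply]
  have b3 : ∀ k, π (X k) = ∑ i, (∑ k', π (X k') * algebraMap ℂ O (l k' i)) * β i k := by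
    intro k
    apply hinj
    have := congrFun hs.G3 k
    simp only [Matrix.vecMul, dotProduct, Matrix.map_apply] at this
    simp only [map_sum, map_mul, hβ, ← IsScalarTower.algebraMap_apply]
    exact this
  let c : Matrix (Fin n) (Fin m) ℂ := fun i k => ev (β i k)
  have hc : ∀ i k, c i k = ev (β i k) := fun i k => rfl
  have c3 : v = (v ᵥ* l) ᵥ* c := by
    ext k
    have := congrArg ev (b3 k)
    simp only [map_sum, map_mul, hev, AlgHom.commutes, eval_X] at this
    exact this
  refine ⟨c, ?_, ?_, c3, ?_⟩
  · ext i i'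
    have := congrArg ev (b1 i i')
    simp only [map_sum, map_mul, AlgHom.commutes] at this
    simp only [Matrix.mul_apply, Matrix.one_apply, hc]
    refine Eq.trans this ?_
    split_ifs <;> simp
  · intro f hf s
    have := congrArg ev (b2 f hf s)
    rw [aeval_push, map_zero] at this
    rw [← this, MvPolynomial.aeval_eq_eval]
    congr 2
    ext k
    simp only [map_sum, map_mul, AlgHom.commutes]
    rfl
  · obtain ⟨t, htm, ht⟩ := exists_common_div
      (fun p : Fin n × Fin m => β p.1 p.2 - algebraMap ℂ O (c p.1 p.2)) (by
        intro p
        rw [← hev0, map_sub, AlgHom.commutes, hc]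
        simp) (by
        intro p q
        obtain ⟨P, hP, hPe⟩ := hs.G4 p.1 p.2 q.1 q.2
        refine shift_dep _ _ _ _ P hP ?_
        apply hjinj
        rw [← dep_map, map_zero, hjO, hjO, hβ, hβ]
        exact hPe)
    choose r hr using ht
    obtain ⟨f0, s0, hs0, hf0⟩ := h.L3 t
    refine ⟨f0, ?_, ?_⟩
    · rw [← h.L2, ← hf0]; exact Ideal.mul_mem_left _ _ htm
    intro k
    -- clear denominators
    have hden : ∀ (ι : Type) [Fintype ι] (y : ι → O), ∃ s, eval v s ≠ 0 ∧
        ∃ p : ι → MvPolynomial (Fin m) ℂ, ∀ i, π s * y i = π (p i) := by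
      classical
      intro ι _ y
      choose f s hs hy using fun i => h.L3 (y i)
      refine ⟨∏ i, s i, ?_, fun i => (∏ j ∈ Finset.univ.erase i, s j) * f i, ?_⟩
      · rw [map_prod]; exact Finset.prod_ne_zero_iff.2 fun i _ => hs i
      · intro i
        rw [← Finset.mul_prod_erase Finset.univ s (Finset.mem_univ i), map_mul, map_mul, ← hy i]
        ring
    obtain ⟨s1, hs1, p, hp⟩ := hden (Fin n) (fun i => β i k)
    obtain ⟨s2, hs2, q, hq⟩ := hden Unit
      (fun _ => ∑ i, algebraMap ℂ O ((v ᵥ* l) i) * r (i, k))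
    refine ⟨s0 * s1 * s2, s1 * q (), fun i => s0 * s2 * p i, ?_, ?_⟩
    · simp [hs0, hs1, hs2]
    rw [← h.L1]
    have hv : algebraMap ℂ O (v k) = ∑ i, algebraMap ℂ O ((v ᵥ* l) i) * algebraMap ℂ O (c i k) := by
      have := congrFun c3 k
      have := congrArg (algebraMap ℂ O) this
      simp only [Matrix.vecMul, dotProduct, map_sum, map_mul] at this ⊢
      exact this
    have hu : ∀ i, π (∑ k, C (l k i) * (X k - C (v k))) =
        ∑ k', π (X k') * algebraMap ℂ O (l k' i) - algebraMap ℂ O ((v ᵥ* l) i) := by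
      intro i
      simp only [Matrix.vecMul, dotProduct, map_sum, map_mul, map_sub, MvPolynomial.algHom_C,
        ← Finset.sum_sub_distrib]
      refine Finset.sum_congr rfl fun k _ => by ring
    have key : π (X k) - algebraMap ℂ O (v k) =
        ∑ i, β i k * π (∑ k, C (l k i) * (X k - C (v k))) +
        t * ∑ i, algebraMap ℂ O ((v ᵥ* l) i) * r (i, k) := by
      simp only [hu]
      rw [b3 k, hv, Finset.mul_sum, ← Finset.sum_sub_distrib, ← Finset.sum_add_distrib]
      refine Finset.sum_congr rfl fun i _ => ?_
      have := hr (i, k)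
      simp only at this
      linear_combination (algebraMap ℂ O ((v ᵥ* l) i)) * this
    have hq' := hq ()
    simp only [map_sub, map_mul, map_sum π, MvPolynomial.algHom_C π] at key ⊢
    rw [key, ← hf0, ← hq', mul_add, Finset.mul_sum]
    simp only [← hp]
    have h9 : ∀ a b c d : O, a = b → c = d → a + c - b - d = 0 := by
      intro a b c d h1 h2; rw [h1, h2]; ring
    apply h9
    · refine Finset.sum_congr rfl fun i _ => by ring
    · ring

end

end ScrollPf

end

section
open MvPolynomial Matrix

namespace ScrollPf

/-- directional derivative at a point -/
def grad {m : ℕ} (v w : Fin m → ℂ) (f : MvPolynomial (Fin m) ℂ) : ℂ :=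
  ∑ k, w k * eval v (pderiv k f)

lemma grad_add {m : ℕ} (v w : Fin m → ℂ) (f g) : grad v w (f + g) = grad v w f + grad v w g := by
  simp [grad, mul_add, Finset.sum_add_distrib]

lemma grad_sub {m : ℕ} (v w : Fin m → ℂ) (f g) : grad v w (f - g) = grad v w f - grad v w g := by
  simp [grad, mul_sub, Finset.sum_sub_distrib]

lemma grad_zero {m : ℕ} (v w : Fin m → ℂ) : grad v w 0 = 0 := by simp [grad]

lemma grad_sum {m : ℕ} {ι : Type*} (s : Finset ι) (v w : Fin m → ℂ)
    (f : ι → MvPolynomial (Fin m) ℂ) : grad v w (∑ i ∈ s, f i) = ∑ i ∈ s, grad v w (f i) := by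
  classical
  induction s using Finset.induction_on with
  | empty => simp [grad_zero]
  | insert a s ha ih => rw [Finset.sum_insert ha, Finset.sum_insert ha, grad_add, ih]

lemma grad_mul {m : ℕ} (v w : Fin m → ℂ) (f g) :
    grad v w (f * g) = eval v f * grad v w g + eval v g * grad v w f := by
  simp only [grad, Finset.mul_sum, ← Finset.sum_add_distrib]
  refine Finset.sum_congr rfl fun k _ => ?_
  simp only [pderiv_mul, map_add, map_mul]
  ring

lemma grad_X_sub {m : ℕ} (v w : Fin m → ℂ) (k) (c : ℂ) : grad v w (X k - C c) = w k := by
  classical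
  simp [grad, pderiv_X, Pi.single_apply]

lemma grad_C_mul {m : ℕ} (v w : Fin m → ℂ) (c : ℂ) (f) : grad v w (C c * f) = c * grad v w f := by
  rw [grad_mul]
  simp [grad]

/-- Zariski tangent space -/
def TI {m : ℕ} (I : Ideal (MvPolynomial (Fin m) ℂ)) (v : Fin m → ℂ) : Submodule ℂ (Fin m → ℂ) where
  carrier := {w | ∀ f ∈ I, grad v w f = 0}
  add_mem' := by
    intro a b ha hb f hf
    have h1 := ha f hf
    have h2 := hb f hf
    simp only [grad] at *
    simp [add_mul, Finset.sum_add_distrib, h1, h2]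
  zero_mem' := by intro f hf; simp [grad]
  smul_mem' := by
    intro c a ha f hf
    have h1 := ha f hf
    simp only [grad] at *
    simp [mul_assoc, ← Finset.mul_sum, h1]

lemma TI_le {n m : ℕ} {I : Ideal (MvPolynomial (Fin m) ℂ)} {v : Fin m → ℂ}
    {l : Matrix (Fin m) (Fin n) ℂ} {f0} (hf0 : eval v f0 = 0)
    (h : ∀ k, ∃ (s g : MvPolynomial (Fin m) ℂ)
        (p : Fin n → MvPolynomial (Fin m) ℂ), eval v s ≠ 0 ∧
        s * (X k - C (v k)) - ∑ i, p i * (∑ k, C (l k i) * (X k - C (v k))) - g * f0 ∈ I) :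
    Module.finrank ℂ (TI I v) ≤ n + 1 := by
  let Φ : TI I v →ₗ[ℂ] (Fin n → ℂ) × ℂ :=
    { toFun := fun w => (w.1 ᵥ* l, grad v w f0)
      map_add' := by
        intro a b
        ext
        · simp [Matrix.add_vecMul]
        · simp [grad, add_mul, Finset.sum_add_distrib]
      map_smul' := by
        intro c a
        ext
        · simp [Matrix.smul_vecMul]
        · simp [grad, mul_assoc, Finset.mul_sum] }
  have hΦ : Function.Injective Φ := by
    rw [← LinearMap.ker_eq_bot, LinearMap.ker_eq_bot']
    intro w hw
    have h1 : w.1 ᵥ* l = 0 := congrArg Prod.fst hw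
    have h2 : grad v w f0 = 0 := congrArg Prod.snd hw
    apply Subtype.ext
    ext k
    obtain ⟨s, g, p, hs, hk⟩ := h k
    have h3 := w.2 _ hk
    have h4 : ∀ i, grad v w (∑ k, C (l k i) * (X k - C (v k))) = 0 := by
      intro i
      rw [grad_sum]
      simp only [grad_C_mul, grad_X_sub]
      have h5 := congrFun h1 i
      simpa [Matrix.vecMul, dotProduct, mul_comm] using h5
    rw [grad_sub, grad_sub, grad_sum] at h3
    simp only [grad_mul, h2, hf0, h4, grad_X_sub] at h3
    simp at h3
    simpa using h3.resolve_left hs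
  have := LinearMap.finrank_le_finrank_of_injective hΦ
  simpa using this

/-- vanishing ideal of a set of vectors -/
def vanI {m : ℕ} (S : Set (Fin m → ℂ)) : Ideal (MvPolynomial (Fin m) ℂ) where
  carrier := {f | ∀ u ∈ S, eval u f = 0}
  add_mem' := by intro a b ha hb u hu; simp [ha u hu, hb u hu]
  zero_mem' := by intro u _; simp
  smul_mem' := by intro c a ha u hu; simp [ha u hu]

lemma mem_vanI {m : ℕ} {S : Set (Fin m → ℂ)} {f} : f ∈ vanI S ↔ ∀ u ∈ S, eval u f = 0 := Iff.rfl

/-- irreducibility of linear spaces -/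
lemma vanI_prime {m : ℕ} (U : Submodule ℂ (Fin m → ℂ)) : (vanI (U : Set (Fin m → ℂ))).IsPrime := by
  refine ⟨?_, ?_⟩
  · rw [Ne, Ideal.eq_top_iff_one]
    intro h
    have := h 0 U.zero_mem
    simp at this
  · intro f g hfg
    by_contra hcon
    push Not at hcon
    obtain ⟨hf, hg⟩ := hcon
    simp only [mem_vanI] at hf hg
    push Not at hf hg
    obtain ⟨x, hx, hfx⟩ := hf
    obtain ⟨y, hy, hgy⟩ := hg
    have hall : ∀ t : ℂ, eval (x + t • (y - x)) f = 0 ∨ eval (x + t • (y - x)) g = 0 := by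
      intro t
      have := hfg (x + t • (y - x)) (U.add_mem hx (U.smul_mem _ (U.sub_mem hy hx)))
      rw [map_mul] at this
      exact mul_eq_zero.1 this
    have hinf : ({t : ℂ | eval (x + t • (y - x)) f = 0} ∪
        {t : ℂ | eval (x + t • (y - x)) g = 0}).Infinite := by
      have : ({t : ℂ | eval (x + t • (y - x)) f = 0} ∪
        {t : ℂ | eval (x + t • (y - x)) g = 0}) = Set.univ := by
        ext t; simpa using hall t
      rw [this]; exact Set.infinite_univ
    rcases Set.infinite_union.1 hinf with h | h
    · have := line_zero f x (y - x) h 0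
      simp at this
      exact hfx this
    · have := line_zero g x (y - x) h 1
      simp at this
      exact hgy this

lemma vanI_single_prime {m : ℕ} (v : Fin m → ℂ) : (vanI ({v} : Set (Fin m → ℂ))).IsPrime := by
  have : vanI ({v} : Set (Fin m → ℂ)) = RingHom.ker (eval v) := by
    ext f; simp [mem_vanI, RingHom.mem_ker]
  rw [this]
  exact RingHom.ker_isPrime _

/-- separating linear form -/
lemma exists_lin {m : ℕ} (U : Submodule ℂ (Fin m → ℂ)) (x) (hx : x ∉ U) :
    ∃ f ∈ vanI (U : Set (Fin m → ℂ)), eval x f ≠ 0 := by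
  obtain ⟨φ, hφ, hU⟩ := Submodule.exists_le_ker_of_notMem hx
  have key : ∀ u, eval u (∑ k, C (φ (Pi.single k 1)) * X k) = φ u := by
    intro u
    conv_rhs => rw [LinearMap.pi_apply_eq_sum_univ φ u]
    simp only [map_sum, map_mul, eval_C, eval_X, smul_eq_mul]
    refine Finset.sum_congr rfl fun k _ => ?_
    rw [mul_comm]
    congr 2
    ext j; simp [Pi.single_apply, eq_comm]
  refine ⟨∑ k, C (φ (Pi.single k 1)) * X k, ?_, ?_⟩
  · intro u hu
    rw [key]; exact hU hu
  · rw [key]; exact hφ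

section
variable {n m : ℕ} {I : Ideal (MvPolynomial (Fin m) ℂ)}

lemma map_prime {J : Ideal (MvPolynomial (Fin m) ℂ)} (hJ : J.IsPrime) (hIJ : I ≤ J) :
    (J.map (Ideal.Quotient.mk I)).IsPrime :=
  Ideal.map_isPrime_of_surjective Ideal.Quotient.mk_surjective (by simpa using hIJ)

lemma map_lt {J J' : Ideal (MvPolynomial (Fin m) ℂ)} (hIJ : I ≤ J) (h : J ≤ J') {f}
    (hf : f ∈ J') (hf' : f ∉ J) : J.map (Ideal.Quotient.mk I) < J'.map (Ideal.Quotient.mk I) := by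
  refine lt_of_le_of_ne (Ideal.map_mono h) ?_
  intro he
  have h1 : Ideal.Quotient.mk I f ∈ J'.map (Ideal.Quotient.mk I) := Ideal.mem_map_of_mem _ hf
  rw [← he, Ideal.mem_quotient_iff_mem hIJ] at h1
  exact hf' h1

lemma vanI_anti {S T : Set (Fin m → ℂ)} (h : S ⊆ T) : vanI T ≤ vanI S :=
  fun _ hf u hu => hf u (h hu)

lemma height_vanI (hI : I.IsPrime) (hinf : {W | IsRul I n W}.Infinite) {W} (hW : IsRul I n W) :
    ∀ (k : ℕ) (U : Submodule ℂ (Fin m → ℂ)), U ≤ W → Module.finrank ℂ U + k = n →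
      (k + 1 : ℕ) ≤ ((vanI (U : Set (Fin m → ℂ))).map (Ideal.Quotient.mk I)).height := by
  have hIU : ∀ U : Submodule ℂ (Fin m → ℂ), U ≤ W → I ≤ vanI (U : Set (Fin m → ℂ)) :=
    fun U hU f hf u hu => hW.2 u (hU hu) f hf
  intro k
  induction k with
  | zero =>
    intro U hU hk
    obtain ⟨W', hW', hne⟩ := hinf.exists_notMem_finite (Set.finite_singleton U)
    have hUf : Module.finrank ℂ U = n := by simpa using hk
    have hex : ∃ x ∈ W', x ∉ U := by
      by_contra hcon
      push Not at hcon
      exact hne (Submodule.eq_of_le_of_finrank_eq hcon (by rw [hW'.1, hUf]))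
    obtain ⟨x, hx, hxU⟩ := hex
    obtain ⟨f, hf, hfx⟩ := exists_lin U x hxU
    have hlt := map_lt (I := I) le_rfl (hIU U hU) hf (fun hfI => hfx (hW'.2 x hx f hfI))
    have p1 := map_prime hI (le_refl I)
    have p2 := map_prime (vanI_prime U) (hIU U hU)
    have := Ideal.height_add_one_le_of_lt_of_isPrime hlt
    refine le_trans ?_ this
    simp
  | succ k ih =>
    intro U hU hk
    have hex : ∃ x ∈ W, x ∉ U := by
      by_contra hcon
      push Not at hcon
      have := Submodule.finrank_mono (R := ℂ) hcon
      rw [hW.1] at this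
      omega
    obtain ⟨x, hx, hxU⟩ := hex
    have hU'W : U ⊔ Submodule.span ℂ {x} ≤ W := sup_le hU (by simpa using hx)
    have hfr : Module.finrank ℂ ↥(U ⊔ Submodule.span ℂ {x}) = Module.finrank ℂ U + 1 := by
      have hd : U ⊓ Submodule.span ℂ {x} = ⊥ := by
        rw [← disjoint_iff, disjoint_comm]
        exact (Submodule.disjoint_span_singleton' (by rintro rfl; exact hxU U.zero_mem)).2 hxU |>.symm
      have := Submodule.finrank_sup_add_finrank_inf_eq U (Submodule.span ℂ {x})
      rw [hd, finrank_span_singleton (by rintro rfl; exact hxU U.zero_mem)] at this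
      simpa using this
    have h1 := ih _ hU'W (by omega)
    obtain ⟨f, hf, hfx⟩ := exists_lin U x hxU
    have hlt := map_lt (I := I) (hIU _ hU'W) (vanI_anti (S := U)
      (T := ((U ⊔ Submodule.span ℂ {x} : Submodule ℂ (Fin m → ℂ)) : Set (Fin m → ℂ)))
      (le_sup_left : U ≤ U ⊔ Submodule.span ℂ {x})) hf (fun h => hfx (h x
        ((le_sup_right : Submodule.span ℂ {x} ≤ U ⊔ Submodule.span ℂ {x})
          (Submodule.mem_span_singleton_self x))))
    have p1 := map_prime (vanI_prime _) (hIU _ hU'W)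
    have p2 := map_prime (vanI_prime U) (hIU U hU)
    have := Ideal.height_add_one_le_of_lt_of_isPrime hlt
    refine le_trans ?_ this
    push_cast at h1 ⊢
    gcongr

lemma height_pt (hI : I.IsPrime) (hn : 0 < n) (hinf : {W | IsRul I n W}.Infinite) {W}
    (hW : IsRul I n W) {v : Fin m → ℂ} (hv : v ∈ W) (hv0 : v ≠ 0) :
    (n + 1 : ℕ) ≤ ((vanI ({v} : Set (Fin m → ℂ))).map (Ideal.Quotient.mk I)).height := by
  have hU : Submodule.span ℂ {v} ≤ W := by simpa using hv
  have h1 := height_vanI hI hinf hW (n - 1) (Submodule.span ℂ {v}) hU (by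
    rw [finrank_span_singleton hv0]; omega)
  have hIU : I ≤ vanI ((Submodule.span ℂ {v} : Submodule ℂ (Fin m → ℂ)) : Set (Fin m → ℂ)) :=
    fun f hf u hu => hW.2 u (hU hu) f hf
  obtain ⟨k, hk⟩ : ∃ k, v k ≠ 0 := by
    by_contra hcon; push Not at hcon; exact hv0 (funext hcon)
  have hsub : ({v} : Set (Fin m → ℂ)) ⊆ (Submodule.span ℂ {v} : Submodule ℂ (Fin m → ℂ)) := by
    simp
  have hlt := map_lt (I := I) hIU (vanI_anti hsub) (f := X k - C (v k)) (by
    intro u hu; rw [Set.mem_singleton_iff.1 hu]; simp) (by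
    intro h
    have := h 0 (Submodule.zero_mem _)
    simp [hk] at this)
  have p1 := map_prime (vanI_prime _) hIU
  have p2 := map_prime (vanI_single_prime v) (hIU.trans (vanI_anti hsub))
  have := Ideal.height_add_one_le_of_lt_of_isPrime hlt
  refine le_trans ?_ this
  rw [Nat.sub_add_cancel hn] at h1
  push_cast
  gcongr

end

end ScrollPf

end

section
open MvPolynomial Matrix

namespace ScrollPf

/-- linear form centered at a point -/
def linf {m : ℕ} (v c : Fin m → ℂ) : MvPolynomial (Fin m) ℂ := ∑ k, C (c k) * (X k - C (v k))

lemma linf_add {m : ℕ} (v c d : Fin m → ℂ) : linf v (c + d) = linf v c + linf v d := by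
  simp [linf, add_mul, Finset.sum_add_distrib]

lemma linf_smul {m : ℕ} (v : Fin m → ℂ) (a : ℂ) (c : Fin m → ℂ) :
    linf v (a • c) = C a * linf v c := by
  simp [linf, mul_assoc, Finset.mul_sum]

lemma linf_sum {m d : ℕ} (v : Fin m → ℂ) (c : Fin d → Fin m → ℂ) (a : Fin d → ℂ) :
    linf v (∑ j, a j • c j) = ∑ j, C (a j) * linf v (c j) := by
  have := map_sum (AddMonoidHom.mk' (linf v) (linf_add v)) (fun j => a j • c j) Finset.univ
  simp only [AddMonoidHom.mk'_apply] at this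
  rw [this]
  simp only [linf_smul]

lemma X_sub_mem {m : ℕ} (v : Fin m → ℂ) (k) :
    (X k - C (v k) : MvPolynomial (Fin m) ℂ) ∈ vanI ({v} : Set (Fin m → ℂ)) := by
  intro u hu; rw [Set.mem_singleton_iff.1 hu]; simp

lemma linf_mem {m : ℕ} (v c : Fin m → ℂ) : linf v c ∈ vanI ({v} : Set (Fin m → ℂ)) :=
  Ideal.sum_mem _ fun k _ => Ideal.mul_mem_left _ _ (X_sub_mem v k)

lemma taylor {m : ℕ} (v : Fin m → ℂ) (f : MvPolynomial (Fin m) ℂ) :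
    f - C (eval v f) - linf v (fun k => eval v (pderiv k f)) ∈
      (vanI ({v} : Set (Fin m → ℂ))) ^ 2 := by
  classical
  induction f using MvPolynomial.induction_on with
  | C a =>
    simp [linf]
  | add p q hp hq =>
    have : (fun k => eval v (pderiv k (p + q))) =
      (fun k => eval v (pderiv k p)) + fun k => eval v (pderiv k q) := by ext k; simp
    rw [this, linf_add]
    convert Ideal.add_mem _ hp hq using 1
    simp only [map_add]; ring
  | mul_X p i hp =>
    have : (fun k => eval v (pderiv k (p * X i))) =
        v i • (fun k => eval v (pderiv k p)) + eval v p • (Pi.single i 1 : Fin m → ℂ) := by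
      ext k
      simp [pderiv_mul, pderiv_X, Pi.single_apply, mul_comm, eq_comm, add_comm]
      split_ifs <;> simp
    have h2 : linf v (Pi.single i 1 : Fin m → ℂ) = X i - C (v i) := by
      simp [linf, Pi.single_apply]
    rw [this, linf_add, linf_smul, linf_smul, h2]
    obtain ⟨L, hL⟩ : ∃ L, L = linf v (fun k => eval v (pderiv k p)) := ⟨_, rfl⟩
    have hLm : L ∈ vanI ({v} : Set (Fin m → ℂ)) := by rw [hL]; exact linf_mem _ _
    rw [← hL] at hp ⊢
    have h3 : L * (X i - C (v i)) ∈ (vanI ({v} : Set (Fin m → ℂ))) ^ 2 := by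
      rw [pow_two]; exact Ideal.mul_mem_mul hLm (X_sub_mem v i)
    convert Ideal.add_mem _ (Ideal.mul_mem_right (X i) _ hp) h3 using 1
    simp only [map_mul, eval_X]; ring

/-- space of gradients -/
def LI {m : ℕ} (I : Ideal (MvPolynomial (Fin m) ℂ)) (v : Fin m → ℂ) : Submodule ℂ (Fin m → ℂ) where
  carrier := {c | ∃ f ∈ I, c = fun k => eval v (pderiv k f)}
  add_mem' := by
    rintro _ _ ⟨f, hf, rfl⟩ ⟨g, hg, rfl⟩
    exact ⟨f + g, I.add_mem hf hg, by ext k; simp⟩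
  zero_mem' := ⟨0, I.zero_mem, by ext k; simp⟩
  smul_mem' := by
    rintro a _ ⟨f, hf, rfl⟩
    exact ⟨C a * f, I.mul_mem_left _ hf, by ext k; simp [pderiv_C_mul]⟩

lemma LI_TI {m : ℕ} (I : Ideal (MvPolynomial (Fin m) ℂ)) (v : Fin m → ℂ) :
    m ≤ Module.finrank ℂ (TI I v) + Module.finrank ℂ (LI I v) := by
  let Ψ : (Fin m → ℂ) →ₗ[ℂ] Module.Dual ℂ (LI I v) :=
    { toFun := fun w =>
        { toFun := fun c => ∑ k, w k * c.1 k
          map_add' := by intro a b; simp [mul_add, Finset.sum_add_distrib]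
          map_smul' := by
            intro a b; simp only [Submodule.coe_smul, Pi.smul_apply, smul_eq_mul, Finset.mul_sum,
              RingHom.id_apply]
            refine Finset.sum_congr rfl fun k _ => by ring }
      map_add' := by
        intro a b; ext c; simp [add_mul, Finset.sum_add_distrib]
      map_smul' := by
        intro a b; ext c; simp [mul_assoc, Finset.mul_sum] }
  have hker : LinearMap.ker Ψ ≤ TI I v := by
    intro w hw f hf
    have := congrArg (fun φ => φ ⟨fun k => eval v (pderiv k f), f, hf, rfl⟩) (LinearMap.mem_ker.1 hw)
    exact this
  have h1 := LinearMap.finrank_range_add_finrank_ker Ψ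
  have h2 := Submodule.finrank_mono (R := ℂ) hker
  have h3 := Submodule.finrank_le (R := ℂ) (LinearMap.range Ψ)
  rw [Subspace.dual_finrank_eq] at h3
  simp only [Module.finrank_fin_fun] at h1
  omega

lemma sq_to_smul {R : Type*} [CommRing R] {A B : Ideal R} (h : A ≤ B ⊔ A ^ 2) : A ≤ B ⊔ A • A := by
  rwa [pow_two] at h

lemma height_le_TI {m : ℕ} {I : Ideal (MvPolynomial (Fin m) ℂ)} {v : Fin m → ℂ}
    (hv : I ≤ vanI ({v} : Set (Fin m → ℂ))) :
    ((vanI ({v} : Set (Fin m → ℂ))).map (Ideal.Quotient.mk I)).height ≤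
      (Module.finrank ℂ (TI I v) : ℕ) := by
  obtain ⟨Q, hQ⟩ := (LI I v).exists_isCompl
  have hd : Module.finrank ℂ Q ≤ Module.finrank ℂ (TI I v) := by
    have h1 := Submodule.finrank_add_eq_of_isCompl hQ
    have h2 := LI_TI I v
    simp only [Module.finrank_fin_fun] at h1
    omega
  obtain ⟨M, hM⟩ : ∃ M, M = vanI ({v} : Set (Fin m → ℂ)) := ⟨_, rfl⟩
  have hMp : M.IsPrime := hM ▸ vanI_single_prime v
  have hMl : ∀ c, linf v c ∈ M := by rw [hM]; exact linf_mem v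
  have hMt := taylor v
  have hMv : ∀ f ∈ M, eval v f = 0 := by rw [hM]; exact fun f hf => hf v rfl
  rw [← hM] at hv hMt ⊢
  clear hM
  let b := Module.finBasis ℂ Q
  let y : Fin (Module.finrank ℂ Q) → MvPolynomial (Fin m) ℂ ⧸ I := fun j =>
    Ideal.Quotient.mk I (linf v (b j : Fin m → ℂ))
  have hp := map_prime hMp hv
  have hmap : ∀ f, f ∈ M ^ 2 → Ideal.Quotient.mk I f ∈ (M.map (Ideal.Quotient.mk I)) ^ 2 := by
    intro f hf
    rw [← Ideal.map_pow]; exact Ideal.mem_map_of_mem _ hf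
  have hJ : Ideal.span (Set.range y) ≤ M.map (Ideal.Quotient.mk I) := by
    rw [Ideal.span_le]
    rintro _ ⟨j, rfl⟩
    exact Ideal.mem_map_of_mem _ (hMl _)
  have hnak : M.map (Ideal.Quotient.mk I) ≤ Ideal.span (Set.range y) ⊔
      (M.map (Ideal.Quotient.mk I)) ^ 2 := by
    rw [Ideal.map_le_iff_le_comap]
    intro f hf
    rw [Ideal.mem_comap]
    have hlin : ∀ c, Ideal.Quotient.mk I (linf v c) ∈
        Ideal.span (Set.range y) ⊔ (M.map (Ideal.Quotient.mk I)) ^ 2 := by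
      intro c
      have hc : c ∈ LI I v ⊔ Q := by rw [hQ.sup_eq_top]; trivial
      obtain ⟨a, ⟨g, hg, ha⟩, q, hq, rfl⟩ := Submodule.mem_sup.1 hc
      rw [linf_add, map_add]
      refine Ideal.add_mem _ ?_ ?_
      · have h1 := hMt g
        rw [hMv g (hv hg), ← ha, map_zero, sub_zero] at h1
        have h2 := hmap _ h1
        rw [map_sub, Ideal.Quotient.eq_zero_iff_mem.2 hg, zero_sub, neg_mem_iff] at h2
        exact Ideal.mem_sup_right h2
      · have h1 : q = ∑ j, (b.repr ⟨q, hq⟩ j) • (b j : Fin m → ℂ) := by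
          have := congrArg (Subtype.val) (b.sum_repr ⟨q, hq⟩)
          rw [Submodule.coe_sum] at this
          exact this.symm
        rw [h1, linf_sum, map_sum]
        refine Ideal.mem_sup_left (Ideal.sum_mem _ fun j _ => ?_)
        rw [map_mul]
        exact Ideal.mul_mem_left _ _ (Ideal.subset_span ⟨j, rfl⟩)
    have h1 := hMt f
    rw [hMv f hf, map_zero, sub_zero] at h1
    have h2 := Ideal.add_mem _ (Ideal.mem_sup_right (S := Ideal.span (Set.range y)) (hmap _ h1))
      (hlin (fun k => eval v (pderiv k f)))
    rw [← map_add] at h2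
    simpa using h2
  obtain ⟨r, hr1, hr⟩ := Submodule.exists_sub_one_mem_and_smul_le_of_fg_of_le_sup
    (IsNoetherian.noetherian _) le_rfl (sq_to_smul hnak)
  have hmin : M.map (Ideal.Quotient.mk I) ∈ (Ideal.span (Set.range y)).minimalPrimes := by
    refine ⟨⟨hp, hJ⟩, ?_⟩
    rintro P ⟨hP, hJP⟩ hPM z hz
    have h1 : r * z ∈ P := hJP (hr (Submodule.smul_mem_pointwise_smul z r _ hz))
    refine (hP.mem_or_mem h1).resolve_left fun h => ?_
    have h2 := (M.map (Ideal.Quotient.mk I)).sub_mem (hPM h) hr1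
    rw [sub_sub_cancel] at h2
    exact hp.ne_top ((Ideal.eq_top_iff_one _).2 h2)
  refine (Ideal.height_le_card_of_mem_minimalPrimes_span (Set.finite_range y) hmin).trans ?_
  have : (Set.range y).ncard ≤ Module.finrank ℂ Q := by
    rw [← Set.image_univ]
    refine (Set.ncard_image_le Set.finite_univ).trans ?_
    rw [Set.ncard_univ, Nat.card_eq_fintype_card, Fintype.card_fin]
  exact_mod_cast this.trans hd

end ScrollPf

end

section
open MvPolynomial Matrix

namespace ScrollPf

lemma mem_map_vanI {m : ℕ} {I : Ideal (MvPolynomial (Fin m) ℂ)} {v : Fin m → ℂ}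
    (hv : I ≤ vanI ({v} : Set (Fin m → ℂ))) (f : MvPolynomial (Fin m) ℂ) :
    Ideal.Quotient.mk I f ∈ (vanI ({v} : Set (Fin m → ℂ))).map (Ideal.Quotient.mk I) ↔
      eval v f = 0 := by
  rw [Ideal.mem_quotient_iff_mem hv]
  constructor
  · intro h; exact h v rfl
  · intro h u hu; rw [Set.mem_singleton_iff.1 hu]; exact h

lemma core_gen {n m : ℕ} {I : Ideal (MvPolynomial (Fin m) ℂ)}
    (hn : 2 ≤ n) (hI : Hyp I n) (H2 : {W | IsRul I n W}.Infinite)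
    (H4 : ∀ c : Fin m → ℂ, ∑ k, C (c k) * X k ∈ I → c = 0)
    {v : Fin m → ℂ} (hv0 : v ≠ 0) (hv : I ≤ vanI ({v} : Set (Fin m → ℂ)))
    [hp : ((vanI ({v} : Set (Fin m → ℂ))).map (Ideal.Quotient.mk I)).IsPrime]
    {O : Type} [CommRing O] [Algebra (MvPolynomial (Fin m) ℂ ⧸ I) O] [IsLocalRing O] [IsDomain O]
    [IsLocalization.AtPrime O ((vanI ({v} : Set (Fin m → ℂ))).map (Ideal.Quotient.mk I))]
    [IsIntegrallyClosed O] [Algebra ℂ O] [IsScalarTower ℂ (MvPolynomial (Fin m) ℂ ⧸ I) O]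
    {K : Type} [Field K] [Algebra ℂ K] [Algebra O K] [IsScalarTower ℂ O K] [IsFractionRing O K]
    [Algebra (MvPolynomial (Fin m) ℂ ⧸ I) K] [IsScalarTower ℂ (MvPolynomial (Fin m) ℂ ⧸ I) K]
    [IsScalarTower (MvPolynomial (Fin m) ℂ ⧸ I) O K] :
    I = ⊥ ∨ Module.finrank ℂ (TI I v) = n + 1 := by
  have hIp := hI.prime
  have hinjO : Function.Injective (algebraMap (MvPolynomial (Fin m) ℂ ⧸ I) O) :=
    IsLocalization.injective O (Ideal.primeCompl_le_nonZeroDivisors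
      ((vanI ({v} : Set (Fin m → ℂ))).map (Ideal.Quotient.mk I)))
  have hinjK : Function.Injective (algebraMap (MvPolynomial (Fin m) ℂ ⧸ I) K) := by
    rw [IsScalarTower.algebraMap_eq (MvPolynomial (Fin m) ℂ ⧸ I) O K]
    exact (IsFractionRing.injective O K).comp hinjO
  have hsurj : ∀ y : O, ∃ f s, eval v s ≠ 0 ∧
      algebraMap (MvPolynomial (Fin m) ℂ ⧸ I) O (Ideal.Quotient.mk I s) * y =
      algebraMap (MvPolynomial (Fin m) ℂ ⧸ I) O (Ideal.Quotient.mk I f) := by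
    intro y
    obtain ⟨⟨a, s, hs⟩, h⟩ := IsLocalization.surj
      ((vanI ({v} : Set (Fin m → ℂ))).map (Ideal.Quotient.mk I)).primeCompl y
    obtain ⟨a, rfl⟩ := Ideal.Quotient.mk_surjective a
    obtain ⟨s, rfl⟩ := Ideal.Quotient.mk_surjective s
    refine ⟨a, s, fun h0 => hs ((mem_map_vanI hv s).2 h0), ?_⟩
    rw [mul_comm]; exact h
  have hfr : IsFractionRing (MvPolynomial (Fin m) ℂ ⧸ I) K := by
    have : FaithfulSMul (MvPolynomial (Fin m) ℂ ⧸ I) K :=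
      (faithfulSMul_iff_algebraMap_injective _ _).2 hinjK
    have hO : ∀ z : O, ∃ x y : MvPolynomial (Fin m) ℂ ⧸ I,
        algebraMap O K z = algebraMap _ K x / algebraMap _ K y := by
      intro z
      obtain ⟨f, s, hs, h⟩ := hsurj z
      refine ⟨Ideal.Quotient.mk I f, Ideal.Quotient.mk I s, ?_⟩
      have h1 := congrArg (algebraMap O K) h
      rw [map_mul, ← IsScalarTower.algebraMap_apply, ← IsScalarTower.algebraMap_apply] at h1
      have h2 : algebraMap (MvPolynomial (Fin m) ℂ ⧸ I) K (Ideal.Quotient.mk I s) ≠ 0 := by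
        rw [Ne, map_eq_zero_iff _ hinjK, Ideal.Quotient.eq_zero_iff_mem]
        intro h; exact hs (hv h v rfl)
      rw [eq_div_iff h2, ← h1, mul_comm]
    refine IsFractionRing.of_field _ _ fun z => ?_
    obtain ⟨a, b, hb, rfl⟩ := IsFractionRing.div_surjective (A := O) z
    obtain ⟨x, y, h1⟩ := hO a
    obtain ⟨x', y', h2⟩ := hO b
    refine ⟨x * y', y * x', ?_⟩
    rw [h1, h2, map_mul, map_mul, div_div_div_eq]
  let π : MvPolynomial (Fin m) ℂ →ₐ[ℂ] O :=
    (IsScalarTower.toAlgHom ℂ (MvPolynomial (Fin m) ℂ ⧸ I) O).comp (Ideal.Quotient.mkₐ ℂ I)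
  have hπ : ∀ f, π f = algebraMap (MvPolynomial (Fin m) ℂ ⧸ I) O (Ideal.Quotient.mk I f) :=
    fun f => rfl
  have hloc : LocAt I v π := by
    refine ⟨?_, ?_, ?_⟩
    · intro f; rw [hπ, map_eq_zero_iff _ hinjO, Ideal.Quotient.eq_zero_iff_mem]
    · intro f
      rw [hπ, IsLocalization.AtPrime.to_map_mem_maximal_iff O
        ((vanI ({v} : Set (Fin m → ℂ))).map (Ideal.Quotient.mk I)), mem_map_vanI hv]
    · exact hsurj
  obtain ⟨l, hl1, hl2⟩ := exists_chart {W | IsRul I n W ∧ v ∈ W} {W | IsRul I n W} (hI.H3 v hv0)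
    (fun W hW => hW.1.1) H2 (fun W hW => hW.1)
  have hE := E0_infinite hl2
  rcases exists_alpha hn hI H4 hE (K := K) with h | ⟨α, hα⟩
  · exact Or.inl h
  right
  have hα' : Sec I l (fun k => algebraMap O K (π (X k))) α := by
    have : (fun k => algebraMap O K (π (X k))) =
        fun k => algebraMap (MvPolynomial (Fin m) ℂ ⧸ I) K (Ideal.Quotient.mk I (X k)) := by
      ext k; rw [hπ, ← IsScalarTower.algebraMap_apply]
    rw [this]; exact hα
  obtain ⟨c, hc, hcR, hvc, f0, hf0, h⟩ := local_gens hloc (fun W hW hv => hl1 W ⟨hW, hv⟩) hα'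
  have h1 := TI_le hf0 h
  have hW := rowSp_isRul (fun s hs => inj_of_mul_eq_one hc s hs) hcR
  have hvW : v ∈ rowSp c := (mem_rowSp c v).2 ⟨_, hvc.symm⟩
  have h2 := (height_pt hIp (by omega) H2 hW hvW hv0).trans (height_le_TI hv)
  have h3 : n + 1 ≤ Module.finrank ℂ (TI I v) := by exact_mod_cast h2
  omega

lemma core_gen2 {n m : ℕ} {I : Ideal (MvPolynomial (Fin m) ℂ)}
    (hn : 2 ≤ n) (hI : Hyp I n) (H2 : {W | IsRul I n W}.Infinite)
    (H4 : ∀ c : Fin m → ℂ, ∑ k, C (c k) * X k ∈ I → c = 0)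
    {v : Fin m → ℂ} (hv0 : v ≠ 0) (hv : I ≤ vanI ({v} : Set (Fin m → ℂ)))
    [hp : ((vanI ({v} : Set (Fin m → ℂ))).map (Ideal.Quotient.mk I)).IsPrime]
    {O : Type} [CommRing O] [Algebra (MvPolynomial (Fin m) ℂ ⧸ I) O] [IsLocalRing O] [IsDomain O]
    [IsLocalization.AtPrime O ((vanI ({v} : Set (Fin m → ℂ))).map (Ideal.Quotient.mk I))]
    [IsIntegrallyClosed O] [Algebra ℂ O] [IsScalarTower ℂ (MvPolynomial (Fin m) ℂ ⧸ I) O] :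
    I = ⊥ ∨ Module.finrank ℂ (TI I v) = n + 1 :=
  core_gen hn hI H2 H4 hv0 hv (O := O) (K := FractionRing O)

lemma ic_of {R : Type} [CommRing R] (M : Submonoid R)
    (h : integralClosure (Localization M) (FractionRing (Localization M)) = ⊥) :
    IsIntegrallyClosed (Localization M) :=
  (IsIntegrallyClosed.integralClosure_eq_bot_iff _).1 h

lemma core {n m : ℕ} {I : Ideal (MvPolynomial (Fin m) ℂ)}
    (hn : 2 ≤ n) (hI : Hyp I n) (H2 : {W | IsRul I n W}.Infinite)
    (H4 : ∀ c : Fin m → ℂ, ∑ k, C (c k) * X k ∈ I → c = 0)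
    {v : Fin m → ℂ} (hv0 : v ≠ 0) (hv : I ≤ vanI ({v} : Set (Fin m → ℂ)))
    (hp : ((vanI ({v} : Set (Fin m → ℂ))).map (Ideal.Quotient.mk I)).IsPrime)
    (h1 : IsIntegrallyClosed
      (Localization (@Ideal.primeCompl _ _ ((vanI ({v} : Set (Fin m → ℂ))).map (Ideal.Quotient.mk I)) hp))) :
    I = ⊥ ∨ Module.finrank ℂ (TI I v) = n + 1 := by
  have hIp := hI.prime
  have h3 : IsDomain (Localization (@Ideal.primeCompl _ _ ((vanI ({v} : Set (Fin m → ℂ))).map (Ideal.Quotient.mk I)) hp)) :=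
    IsLocalization.isDomain_localization (Ideal.primeCompl_le_nonZeroDivisors
      ((vanI ({v} : Set (Fin m → ℂ))).map (Ideal.Quotient.mk I)))
  exact core_gen2 hn hI H2 H4 hv0 hv
    (O := Localization (@Ideal.primeCompl _ _ ((vanI ({v} : Set (Fin m → ℂ))).map (Ideal.Quotient.mk I)) hp))

end ScrollPf

end

section
open MvPolynomial Matrix

namespace ScrollPf
open ProjGeo

/-- scaling invariant sets with a nonzero element -/
def Conic {m : ℕ} (A : Set (Fin m → ℂ)) : Prop :=
  (∀ a ∈ A, ∀ t : ℂ, t • a ∈ A) ∧ ∃ a ∈ A, a ≠ 0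

lemma Conic.van {m : ℕ} {A : Set (Fin m → ℂ)} (hA : Conic A) {f : MvPolynomial (Fin m) ℂ}
    (h : ∀ a ∈ A, a ≠ 0 → eval a f = 0) : f ∈ vanI A := by
  intro a ha
  by_cases h0 : a = 0
  · obtain ⟨b, hb, hb0⟩ := hA.2
    have := line_zero f 0 b (Set.Infinite.mono (s := {0}ᶜ) (fun t ht => by
      have := h (t • b) (hA.1 b hb t) (smul_ne_zero ht hb0)
      simpa using this) (Set.finite_singleton _).infinite_compl) 0
    simpa [h0] using this
  · exact h a ha h0

lemma eval_smul_hom {m d : ℕ} {f : MvPolynomial (Fin m) ℂ} (hf : f.IsHomogeneous d)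
    (t : ℂ) (v : Fin m → ℂ) : eval (t • v) f = t ^ d * eval v f := by
  rw [eval_eq, eval_eq, Finset.mul_sum]
  refine Finset.sum_congr rfl fun s hs => ?_
  have h1 := hf.degree_eq_sum_deg_support hs
  simp only [Pi.smul_apply, smul_eq_mul, mul_pow, Finset.prod_mul_distrib]
  rw [Finset.prod_pow_eq_pow_sum, ← h1]
  ring

lemma comp_zero {m : ℕ} {f : MvPolynomial (Fin m) ℂ} {v : Fin m → ℂ}
    (h : ∀ t : ℂ, eval (t • v) f = 0) (d : ℕ) : eval v (homogeneousComponent d f) = 0 := by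
  let q : Polynomial ℂ := ∑ i ∈ Finset.range (f.totalDegree + 1),
    Polynomial.C (eval v (homogeneousComponent i f)) * Polynomial.X ^ i
  have hq : q = 0 := by
    refine Polynomial.funext fun t => ?_
    have h1 := h t
    rw [← sum_homogeneousComponent f, map_sum] at h1
    rw [Polynomial.eval_zero, ← h1]
    simp only [q, Polynomial.eval_finsetSum]
    refine Finset.sum_congr rfl fun i _ => ?_
    rw [eval_smul_hom (homogeneousComponent_isHomogeneous i f)]
    simp only [Polynomial.eval_mul, Polynomial.eval_C, Polynomial.eval_pow, Polynomial.eval_X]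
    ring
  by_cases hd : d < f.totalDegree + 1
  · have h2 := congrArg (fun p => Polynomial.coeff p d) hq
    simp only [q, Polynomial.finsetSum_coeff, Polynomial.coeff_C_mul_X_pow,
      Polynomial.coeff_zero] at h2
    rw [Finset.sum_ite_eq] at h2
    simpa [hd] using h2
  · rw [homogeneousComponent_eq_zero _ _ (by omega), map_zero]

lemma Conic.comp {m : ℕ} {A : Set (Fin m → ℂ)} (hA : Conic A) {f : MvPolynomial (Fin m) ℂ}
    (hf : f ∈ vanI A) (d : ℕ) : homogeneousComponent d f ∈ vanI A := by
  intro a ha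
  exact comp_zero (fun t => hf _ (hA.1 a ha t)) d

/-- affine cone -/
def AC {r : ℕ} (X : Set (Pt r)) : Set (Fin (r + 1) → ℂ) :=
  {v | ∀ hv : v ≠ 0, Projectivization.mk ℂ v hv ∈ X}

lemma AC_conic {r : ℕ} {X : Set (Pt r)} (hX : X.Nonempty) : Conic (AC X) := by
  refine ⟨?_, ?_⟩
  · intro a ha t hv
    have ht : t ≠ 0 := fun h => hv (by rw [h, zero_smul])
    have ha0 : a ≠ 0 := fun h => hv (by rw [h, smul_zero])
    have : Projectivization.mk ℂ (t • a) hv = Projectivization.mk ℂ a ha0 :=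
      (Projectivization.mk_eq_mk_iff' _ _ _ _ _).2 ⟨t, rfl⟩
    rw [this]; exact ha ha0
  · obtain ⟨x, hx⟩ := hX
    exact ⟨x.rep, fun hv => by rwa [Projectivization.mk_rep], x.rep_nonzero⟩

/-- projective zero set of the homogeneous elements of an ideal -/
def Zv {r : ℕ} (J : Ideal (MvPolynomial (Fin (r + 1)) ℂ)) : Set (Pt r) :=
  ZeroLocus {p | p ∈ J ∧ ∃ d, p.IsHomogeneous d}

lemma Zv_alg {r : ℕ} (J : Ideal (MvPolynomial (Fin (r + 1)) ℂ)) : IsAlgSet (Zv J) :=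
  ⟨_, fun _ hp => hp.2, rfl⟩

lemma vanishesAt_mk {r d : ℕ} {p : MvPolynomial (Fin (r + 1)) ℂ} (hp : p.IsHomogeneous d)
    {v : Fin (r + 1) → ℂ} (hv : v ≠ 0) (h : eval v p = 0) :
    VanishesAt p (Projectivization.mk ℂ v hv) := by
  intro u hu hm
  obtain ⟨t, rfl⟩ := (Projectivization.mk_eq_mk_iff' _ _ _ _ _).1 hm
  rw [eval_smul_hom hp, h, mul_zero]

lemma Zv_van {r : ℕ} {A : Set (Fin (r + 1) → ℂ)} (hA : Conic A) {v : Fin (r + 1) → ℂ} (hv : v ≠ 0) :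
    Projectivization.mk ℂ v hv ∈ Zv (vanI A) ↔ ∀ f ∈ vanI A, eval v f = 0 := by
  constructor
  · intro h f hf
    rw [← sum_homogeneousComponent f, map_sum]
    exact Finset.sum_eq_zero fun i _ =>
      h _ ⟨hA.comp hf i, i, homogeneousComponent_isHomogeneous i f⟩ v hv rfl
  · rintro h p ⟨hp, d, hd⟩
    exact vanishesAt_mk hd hv (h p hp)

lemma vanI_AC_Zv {r : ℕ} {A : Set (Fin (r + 1) → ℂ)} (hA : Conic A) :
    vanI (AC (Zv (vanI A))) = vanI A := by
  apply le_antisymm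
  · intro f hf
    refine hA.van fun a ha h0 => hf a fun hv => ?_
    exact (Zv_van hA hv).2 fun g hg => hg a ha
  · intro f hf
    have hne : (Zv (vanI A)).Nonempty := by
      obtain ⟨a, ha, ha0⟩ := hA.2
      exact ⟨_, (Zv_van hA ha0).2 fun g hg => hg a ha⟩
    refine (AC_conic hne).van fun a ha h0 => ?_
    exact (Zv_van hA h0).1 (ha h0) f hf

lemma Zv_AC {r : ℕ} {X : Set (Pt r)} (hX : X.Nonempty) (h : IsAlgSet X) : Zv (vanI (AC X)) = X := by
  obtain ⟨S, hS, rfl⟩ := h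
  ext x
  obtain ⟨v, hv, rfl⟩ : ∃ v, ∃ hv : v ≠ 0, Projectivization.mk ℂ v hv = x :=
    ⟨x.rep, x.rep_nonzero, x.mk_rep⟩
  rw [Zv_van (AC_conic hX)]
  constructor
  · intro h p hp
    obtain ⟨d, hd⟩ := hS p hp
    refine vanishesAt_mk hd hv (h p ((AC_conic hX).van fun a ha h0 => ?_))
    exact ha h0 p hp a h0 rfl
  · intro h f hf
    exact hf v fun _ => h

lemma irr_of_prime {r : ℕ} {A : Set (Fin (r + 1) → ℂ)} (hA : Conic A) (hp : (vanI A).IsPrime) :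
    IsIrrVar (Zv (vanI A)) := by
  refine ⟨?_, Zv_alg _, ?_⟩
  · obtain ⟨a, ha, ha0⟩ := hA.2
    exact ⟨_, (Zv_van hA ha0).2 fun g hg => hg a ha⟩
  rintro Y Z ⟨S, hS, rfl⟩ ⟨T, hT, rfl⟩ h
  by_contra hcon
  rw [not_or, Set.not_subset, Set.not_subset] at hcon
  obtain ⟨⟨x, hx, hxS⟩, ⟨y, hy, hyT⟩⟩ := hcon
  simp only [ZeroLocus, Set.mem_ofPred_eq, not_forall, VanishesAt] at hxS hyT
  obtain ⟨p, hp1, u, hu, rfl, hpu⟩ := hxS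
  obtain ⟨q, hq1, w, hw, rfl, hqw⟩ := hyT
  have hpq : p * q ∈ vanI A := by
    refine hA.van fun a ha h0 => ?_
    have ha' : Projectivization.mk ℂ a h0 ∈ Zv (vanI A) := (Zv_van hA h0).2 fun g hg => hg a ha
    rcases h ha' with h | h
    · rw [map_mul, h p hp1 a h0 rfl, zero_mul]
    · rw [map_mul, h q hq1 a h0 rfl, mul_zero]
  rcases hp.mem_or_mem hpq with h | h
  · exact hpu ((Zv_van hA hu).1 hx p h)
  · exact hqw ((Zv_van hA hw).1 hy q h)

lemma Zv_ssubset {r : ℕ} {A B : Set (Fin (r + 1) → ℂ)} (hA : Conic A) (hB : Conic B)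
    (h : vanI B < vanI A) : Zv (vanI A) ⊂ Zv (vanI B) := by
  refine ⟨fun x hx p hp => hx p ⟨h.le hp.1, hp.2⟩, fun hle => h.not_ge ?_⟩
  rw [← vanI_AC_Zv hA, ← vanI_AC_Zv hB]
  exact vanI_anti fun v hv h0 => hle (hv h0)

lemma DimGE_zero {r : ℕ} {Z : Set (Pt r)} (h : IsIrrVar Z) : DimGE Z 0 :=
  ⟨fun _ => Z, fun _ => ⟨h, subset_rfl⟩, fun i j hij => by omega⟩

lemma DimGE_succ {r k : ℕ} {Z Z' : Set (Pt r)} (h : DimGE Z k) (hZ : Z ⊂ Z') (hZ' : IsIrrVar Z') :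
    DimGE Z' (k + 1) := by
  obtain ⟨c, hc, hlt⟩ := h
  refine ⟨Fin.snoc (α := fun _ => Set (Pt r)) c Z', ?_, ?_⟩
  · intro i
    refine Fin.lastCases ?_ (fun i => ?_) i
    · rw [Fin.snoc_last]; exact ⟨hZ', subset_rfl⟩
    · rw [Fin.snoc_castSucc]; exact ⟨(hc i).1, (hc i).2.trans hZ.subset⟩
  · intro i j
    refine Fin.lastCases ?_ (fun j => ?_) j
    · refine Fin.lastCases ?_ (fun i => ?_) i
      · intro h; exact absurd h (lt_irrefl _)
      · intro _; rw [Fin.snoc_last, Fin.snoc_castSucc]; exact (hc i).2.trans_ssubset hZ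
    · refine Fin.lastCases ?_ (fun i => ?_) i
      · intro h; exact absurd (h.trans (Fin.castSucc_lt_last j)) (lt_irrefl _)
      · intro h; rw [Fin.snoc_castSucc, Fin.snoc_castSucc]
        exact hlt i j (Fin.castSucc_lt_castSucc_iff.1 h)

lemma sub_conic {m : ℕ} {U : Submodule ℂ (Fin m → ℂ)} (h : U ≠ ⊥) :
    Conic (U : Set (Fin m → ℂ)) :=
  ⟨fun _ ha t => U.smul_mem t ha, U.exists_mem_ne_zero_of_ne_bot h⟩

lemma DimGE_sub {r : ℕ} : ∀ (k : ℕ) (U : Submodule ℂ (Fin (r + 1) → ℂ)),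
    Module.finrank ℂ U = k + 1 → DimGE (Zv (vanI (U : Set (Fin (r + 1) → ℂ)))) k := by
  have hbot : ∀ (k : ℕ) (U : Submodule ℂ (Fin (r + 1) → ℂ)), Module.finrank ℂ U = k + 1 → U ≠ ⊥ := by
    rintro k U h rfl; simp at h
  intro k
  induction k with
  | zero =>
    intro U hU
    exact DimGE_zero (irr_of_prime (sub_conic (hbot _ U hU)) (vanI_prime U))
  | succ k ih =>
    intro U hU
    let b : Module.Basis (Fin (k + 2)) ℂ U := Module.finBasisOfFinrankEq ℂ U hU
    have hli : LinearIndependent ℂ (fun i : Fin (k + 2) => (b i : Fin (r + 1) → ℂ)) :=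
      b.linearIndependent.map' U.subtype (Submodule.ker_subtype U)
    have hli' : LinearIndependent ℂ (fun i : Fin (k + 1) => (b i.castSucc : Fin (r + 1) → ℂ)) :=
      hli.comp _ (Fin.castSucc_injective _)
    obtain ⟨U', hU'⟩ : ∃ U', U' = Submodule.span ℂ
      (Set.range fun i : Fin (k + 1) => (b i.castSucc : Fin (r + 1) → ℂ)) := ⟨_, rfl⟩
    have hfr : Module.finrank ℂ U' = k + 1 := by
      rw [hU', finrank_span_eq_card hli']; simp
    have hle : U' ≤ U := by
      rw [hU', Submodule.span_le]; rintro _ ⟨i, rfl⟩; exact (b i.castSucc).2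
    have hex : ∃ x ∈ U, x ∉ U' := by
      by_contra hcon
      push Not at hcon
      have := Submodule.finrank_mono (R := ℂ) hcon
      omega
    obtain ⟨x, hx, hxU⟩ := hex
    obtain ⟨f, hf, hfx⟩ := exists_lin U' x hxU
    have hc := sub_conic (hbot _ U hU)
    have hc' := sub_conic (hbot _ U' hfr)
    refine DimGE_succ (ih U' hfr) (Zv_ssubset hc' hc ?_) (irr_of_prime hc (vanI_prime U))
    exact lt_of_le_of_ne (vanI_anti hle) fun h => hfx ((h.symm ▸ hf : f ∈ vanI (U : Set _)) x hx)

end ScrollPf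

end

section
open MvPolynomial Matrix

namespace ScrollPf
open ProjGeo

/-- union of a family of subspaces -/
def UV {m : ℕ} (V : Set (Submodule ℂ (Fin m → ℂ))) : Set (Fin m → ℂ) := {v | ∃ W ∈ V, v ∈ W}

lemma UV_conic {m : ℕ} {V : Set (Submodule ℂ (Fin m → ℂ))} {W} (hW : W ∈ V) (h : W ≠ ⊥) :
    Conic (UV V) := by
  refine ⟨?_, ?_⟩
  · rintro a ⟨U, hU, ha⟩ t; exact ⟨U, hU, U.smul_mem t ha⟩
  · obtain ⟨a, ha, h0⟩ := W.exists_mem_ne_zero_of_ne_bot h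
    exact ⟨a, ⟨W, hW, ha⟩, h0⟩

/-- an infinite family contains an infinite subfamily with prime vanishing ideal -/
lemma exists_prime_sub {m : ℕ} (V : Set (Submodule ℂ (Fin m → ℂ))) (hV : V.Infinite) :
    ∃ V' ⊆ V, V'.Infinite ∧ (vanI (UV V')).IsPrime := by
  obtain ⟨J, ⟨V', hsub, hinf, rfl⟩, hmax⟩ := set_has_maximal_iff_noetherian.2
    (inferInstance : IsNoetherian (MvPolynomial (Fin m) ℂ) (MvPolynomial (Fin m) ℂ))
    {J | ∃ V' ⊆ V, V'.Infinite ∧ J = vanI (UV V')} ⟨_, V, subset_rfl, hV, rfl⟩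
  refine ⟨V', hsub, hinf, ?_, ?_⟩
  · obtain ⟨W, hW⟩ := hinf.nonempty
    rw [Ne, Ideal.eq_top_iff_one]
    intro h
    have := h 0 ⟨W, hW, W.zero_mem⟩
    simp at this
  · intro f g hfg
    have key : ∀ f : MvPolynomial (Fin m) ℂ,
        {W ∈ V' | f ∈ vanI (W : Set (Fin m → ℂ))}.Infinite → f ∈ vanI (UV V') := by
      intro f hf
      have hle : vanI (UV V') ≤ vanI (UV {W ∈ V' | f ∈ vanI (W : Set (Fin m → ℂ))}) :=
        vanI_anti (by rintro v ⟨W, hW, hv⟩; exact ⟨W, hW.1, hv⟩)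
      have hnot := hmax _ ⟨_, (Set.sep_subset _ _).trans hsub, hf, rfl⟩
      have heq := hle.eq_of_not_lt hnot
      rw [heq]
      rintro v ⟨W, hW, hv⟩
      exact hW.2 v hv
    have hun : V' ⊆ {W ∈ V' | f ∈ vanI (W : Set (Fin m → ℂ))} ∪
        {W ∈ V' | g ∈ vanI (W : Set (Fin m → ℂ))} := by
      intro W hW
      have : f * g ∈ vanI (W : Set (Fin m → ℂ)) := fun v hv => hfg v ⟨W, hW, hv⟩
      rcases (vanI_prime W).mem_or_mem this with h | h
      · exact Or.inl ⟨hW, h⟩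
      · exact Or.inr ⟨hW, h⟩
    rcases Set.infinite_union.1 (hinf.mono hun) with h | h
    · exact Or.inl (key f h)
    · exact Or.inr (key g h)

section
variable {r n : ℕ} {X : Set (Pt r)}

lemma ne_bot_of_finrank {m : ℕ} {W : Submodule ℂ (Fin m → ℂ)} (hn : 2 ≤ n)
    (h : Module.finrank ℂ W = n) : W ≠ ⊥ := by
  rintro rfl; simp at h; omega

lemma H1_of (hirr : IsIrrVar X) (hdim : HasDim X n) (hn : 2 ≤ n)
    (f : MvPolynomial (Fin (r + 1)) ℂ)
    (hf : {W | IsRul (vanI (AC X)) n W ∧ ∀ w ∈ W, eval w f = 0}.Infinite) : f ∈ vanI (AC X) := by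
  by_contra hfI
  obtain ⟨V, hV, hinf, hp⟩ := exists_prime_sub _ hf
  obtain ⟨W, hW⟩ := hinf.nonempty
  obtain ⟨W', hW', hne⟩ := hinf.exists_notMem_finite (Set.finite_singleton W)
  have hWb := ne_bot_of_finrank hn (hV hW).1.1
  have hex : ∃ x ∈ W', x ∉ W := by
    by_contra hcon
    push Not at hcon
    exact hne (Submodule.eq_of_le_of_finrank_eq hcon (by rw [(hV hW).1.1, (hV hW').1.1]))
  obtain ⟨x, hx, hxW⟩ := hex
  obtain ⟨g, hg, hgx⟩ := exists_lin W x hxW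
  have hc := UV_conic hW hWb
  have h1 : vanI (UV V) < vanI (W : Set (Fin (r + 1) → ℂ)) := by
    refine lt_of_le_of_ne (vanI_anti fun v hv => ⟨W, hW, hv⟩) fun h => ?_
    rw [← h] at hg
    exact hgx (hg x ⟨W', hW', hx⟩)
  have h2 : vanI (AC X) < vanI (UV V) := by
    refine lt_of_le_of_ne ?_ fun h => ?_
    · rintro p hp v ⟨U, hU, hv⟩
      exact (hV hU).1.2 v hv p hp
    · rw [h] at hfI
      refine hfI ?_
      rintro v ⟨U, hU, hv⟩
      exact (hV hU).2 v hv
  obtain ⟨k, rfl⟩ : ∃ k, n = k + 1 := ⟨n - 1, by omega⟩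
  have d1 := DimGE_sub k W (hV hW).1.1
  have d2 := DimGE_succ d1 (Zv_ssubset (sub_conic hWb) hc h1) (irr_of_prime hc hp)
  have h3 := Zv_ssubset hc (AC_conic hirr.1) h2
  rw [Zv_AC hirr.1 hirr.2.1] at h3
  exact hdim.2 (DimGE_succ d2 h3 hirr)

lemma span_eq (hX : X.Nonempty) : Ideal.span (homIdeal X) = vanI (AC X) := by
  apply le_antisymm
  · rw [Ideal.span_le]
    rintro p ⟨-, hp⟩
    exact (AC_conic hX).van fun a ha h0 => hp _ (ha h0) a h0 rfl
  · intro f hf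
    rw [← sum_homogeneousComponent f]
    refine Ideal.sum_mem _ fun d _ => Ideal.subset_span ⟨⟨d, homogeneousComponent_isHomogeneous d f⟩, ?_⟩
    rintro x hx v hv rfl
    exact (AC_conic hX).comp hf d v fun _ => hx

lemma mem_iff (hX : X.Nonempty) (hA : IsAlgSet X) {v : Fin (r + 1) → ℂ} (hv : v ≠ 0) :
    Projectivization.mk ℂ v hv ∈ X ↔ ∀ f ∈ vanI (AC X), eval v f = 0 := by
  rw [← Zv_van (AC_conic hX) hv, Zv_AC hX hA]

lemma isRul_of (hn : 2 ≤ n) {W : Submodule ℂ (Fin (r + 1) → ℂ)}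
    (hW : Module.finrank ℂ W = n ∧ projSub W ⊆ X) : IsRul (vanI (AC X)) n W := by
  refine ⟨hW.1, ?_⟩
  intro w hw f hf
  refine (sub_conic (ne_bot_of_finrank hn hW.1)).van (f := f) (fun a ha h0 => hf a fun _ => hW.2 ?_) w hw
  change (Projectivization.mk ℂ a h0).submodule ≤ W
  rw [Projectivization.submodule_mk, Submodule.span_singleton_le_iff_mem]
  exact ha

lemma prime_of (H1 : ∀ f, {W | IsRul (vanI (AC X)) n W ∧ ∀ w ∈ W, eval w f = 0}.Infinite →
    f ∈ vanI (AC X)) (H2 : {W | IsRul (vanI (AC X)) n W}.Infinite) : (vanI (AC X)).IsPrime := by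
  refine ⟨?_, ?_⟩
  · obtain ⟨W, hW⟩ := H2.nonempty
    rw [Ne, Ideal.eq_top_iff_one]
    intro h
    have := hW.2 0 W.zero_mem 1 h
    simp at this
  · intro f g hfg
    have hun : {W | IsRul (vanI (AC X)) n W} ⊆
        {W | IsRul (vanI (AC X)) n W ∧ ∀ w ∈ W, eval w f = 0} ∪
        {W | IsRul (vanI (AC X)) n W ∧ ∀ w ∈ W, eval w g = 0} := by
      intro W hW
      have : f * g ∈ vanI (W : Set (Fin (r + 1) → ℂ)) := fun v hv => hW.2 v hv _ hfg
      rcases (vanI_prime W).mem_or_mem this with h | h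
      · exact Or.inl ⟨hW, h⟩
      · exact Or.inr ⟨hW, h⟩
    rcases Set.infinite_union.1 (H2.mono hun) with h | h
    · exact Or.inl (H1 f h)
    · exact Or.inr (H1 g h)

/-- translation of a polynomial -/
lemma exists_translate {m : ℕ} (f : MvPolynomial (Fin m) ℂ) (p : Fin m → ℂ) :
    ∃ g, ∀ v, eval v g = eval (v + p) f := by
  refine ⟨aeval (fun k => X k + C (p k)) f, fun v => ?_⟩
  have : (aeval v : MvPolynomial (Fin m) ℂ →ₐ[ℂ] ℂ).comp (aeval (fun k => X k + C (p k))) =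
      aeval (v + p) := by
    ext k; simp
  exact congrArg (fun φ => φ f) this

lemma H3_of (hX : X.Nonempty) (hA : IsAlgSet X)
    (H1 : ∀ f, {W | IsRul (vanI (AC X)) n W ∧ ∀ w ∈ W, eval w f = 0}.Infinite →
    f ∈ vanI (AC X)) (hcone : ¬ IsCone X) (p : Fin (r + 1) → ℂ) (hp : p ≠ 0) :
    {W | IsRul (vanI (AC X)) n W ∧ p ∈ W}.Finite := by
  by_contra hinf
  apply hcone
  have hinf : {W | IsRul (vanI (AC X)) n W ∧ p ∈ W}.Infinite := hinf
  refine ⟨Projectivization.mk ℂ p hp, ?_, ?_⟩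
  · obtain ⟨W, hW, hpW⟩ := hinf.nonempty
    exact (mem_iff hX hA hp).2 fun f hf => hW.2 p hpW f hf
  · intro x hx y hy
    obtain ⟨u, hu, rfl⟩ : ∃ v, ∃ hv : v ≠ 0, Projectivization.mk ℂ v hv = x :=
      ⟨x.rep, x.rep_nonzero, x.mk_rep⟩
    obtain ⟨w, hw, rfl⟩ : ∃ v, ∃ hv : v ≠ 0, Projectivization.mk ℂ v hv = y :=
      ⟨y.rep, y.rep_nonzero, y.mk_rep⟩
    change (Projectivization.mk ℂ w hw).submodule ≤ _ at hy
    rw [Projectivization.submodule_mk, Projectivization.submodule_mk, Projectivization.submodule_mk,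
      Submodule.span_singleton_le_iff_mem, Submodule.mem_sup] at hy
    obtain ⟨a, ha, b, hb, rfl⟩ := hy
    obtain ⟨s, rfl⟩ := Submodule.mem_span_singleton.1 ha
    obtain ⟨t, rfl⟩ := Submodule.mem_span_singleton.1 hb
    refine (mem_iff hX hA hw).2 fun f hf => ?_
    obtain ⟨g, hg⟩ := exists_translate f (s • p)
    have hgI : g ∈ vanI (AC X) := by
      refine H1 g (hinf.mono ?_)
      rintro W ⟨hW, hpW⟩
      refine ⟨hW, fun w hw => ?_⟩
      rw [hg]
      exact hW.2 _ (W.add_mem hw (W.smul_mem s hpW)) f hf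
    rw [add_comm (s • p) (t • u), ← hg]
    exact hgI _ ((AC_conic hX).1 u (fun _ => hx) t)

lemma H4_of (hnd : Nondeg X) (c : Fin (r + 1) → ℂ)
    (h : ∑ k, C (c k) * MvPolynomial.X k ∈ vanI (AC X)) : c = 0 := by
  have hle : projSpan X ≤ LinearMap.ker (∑ k, c k • (LinearMap.proj k : (Fin (r + 1) → ℂ) →ₗ[ℂ] ℂ)) := by
    refine iSup₂_le fun x hx => ?_
    obtain ⟨u, hu, rfl⟩ : ∃ v, ∃ hv : v ≠ 0, Projectivization.mk ℂ v hv = x :=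
      ⟨x.rep, x.rep_nonzero, x.mk_rep⟩
    rw [Projectivization.submodule_mk, Submodule.span_singleton_le_iff_mem, LinearMap.mem_ker]
    have := h u fun _ => hx
    simpa [LinearMap.sum_apply] using this
  rw [show projSpan X = ⊤ from hnd] at hle
  ext k
  have := LinearMap.mem_ker.1 (hle (Submodule.mem_top (x := Pi.single k 1)))
  simpa [LinearMap.sum_apply, Pi.single_apply] using this

lemma cone_of_bot (hX : X.Nonempty) (hA : IsAlgSet X) (h : vanI (AC X) = ⊥) : IsCone X := by
  have hall : ∀ x : Pt r, x ∈ X := by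
    intro x
    obtain ⟨u, hu, rfl⟩ : ∃ v, ∃ hv : v ≠ 0, Projectivization.mk ℂ v hv = x :=
      ⟨x.rep, x.rep_nonzero, x.mk_rep⟩
    refine (mem_iff hX hA hu).2 fun f hf => ?_
    rw [h, Ideal.mem_bot] at hf
    rw [hf, map_zero]
  obtain ⟨x, hx⟩ := hX
  exact ⟨x, hx, fun _ _ y _ => hall y⟩

lemma embTangent_eq {x : Pt r} (hx : x ∈ X) :
    embTangent X x = TI (Ideal.span (homIdeal X)) x.rep := by
  have hgr : ∀ (w : Fin (r + 1) → ℂ) (p : MvPolynomial (Fin (r + 1)) ℂ),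
      (∑ i, eval x.rep (pderiv i p) • (LinearMap.proj i : (Fin (r + 1) → ℂ) →ₗ[ℂ] ℂ)) w =
        grad x.rep w p := by
    intro w p
    simp [grad, LinearMap.sum_apply, mul_comm]
  ext w
  simp only [embTangent, Submodule.mem_iInf, LinearMap.mem_ker, hgr]
  constructor
  · intro h f hf
    suffices eval x.rep f = 0 ∧ grad x.rep w f = 0 from this.2
    refine Submodule.span_induction ?_ ?_ ?_ ?_ hf
    · intro p hp
      exact ⟨hp.2 x hx x.rep x.rep_nonzero x.mk_rep, h p hp⟩
    · simp [grad_zero]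
    · rintro a b - - ⟨h1, h2⟩ ⟨h3, h4⟩
      exact ⟨by rw [map_add, h1, h3, add_zero], by rw [grad_add, h2, h4, add_zero]⟩
    · rintro a b - ⟨h1, h2⟩
      refine ⟨by rw [smul_eq_mul, map_mul, h1, mul_zero], ?_⟩
      rw [smul_eq_mul, grad_mul, h1, h2]; ring
  · intro h p hp
    exact h p (Ideal.subset_span hp)

end

end ScrollPf

end

namespace ProjGeo

open ScrollPf

theorem normal_scroll_smooth_or_cone {r n : ℕ} (X : Set (Pt r))
    (hirr : IsIrrVar X) (hnd : Nondeg X) (hdim : HasDim X n) (hn : 2 ≤ n)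
    (hnorm : IsNormalVar X) (hscroll : IsScrollOverCurve n X) :
    SmoothOfDim n X ∨ IsCone X := by
  by_cases hcone : IsCone X
  · exact Or.inr hcone
  obtain ⟨F, hF, hFX, -⟩ := hscroll
  have H2 : {W | IsRul (vanI (AC X)) n W}.Infinite := hF.mono fun W hW => isRul_of hn (hFX W hW)
  have H1 := H1_of hirr hdim hn
  have hI : Hyp (vanI (AC X)) n := ⟨prime_of H1 H2, H1, H3_of hirr.1 hirr.2.1 H1 hcone⟩
  have H4 := H4_of hnd
  have hbot : Ideal.span (homIdeal X) ≠ ⊥ := by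
    rw [span_eq hirr.1]; exact fun h => hcone (cone_of_bot hirr.1 hirr.2.1 h)
  left
  intro x hx
  rw [embTangent_eq hx]
  have hv : Ideal.span (homIdeal X) ≤ vanI ({x.rep} : Set (Fin (r + 1) → ℂ)) := by
    rw [span_eq hirr.1]
    refine vanI_anti ?_
    rintro _ rfl _
    rwa [Projectivization.mk_rep]
  rw [← span_eq hirr.1] at H2 hI H4
  have hp := map_prime (vanI_single_prime x.rep) hv
  have hex : ∃ i : Fin (r + 1), Ideal.Quotient.mk (Ideal.span (homIdeal X)) (MvPolynomial.X i) ∉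
      (vanI ({x.rep} : Set (Fin (r + 1) → ℂ))).map (Ideal.Quotient.mk (Ideal.span (homIdeal X))) := by
    by_contra hcon
    push Not at hcon
    refine x.rep_nonzero (funext fun i => ?_)
    simpa using (mem_map_vanI hv _).1 (hcon i)
  have hic := ic_of (R := coneRing X) _ (hnorm _ hp hex)
  exact (core hn hI H2 H4 x.rep_nonzero hv hp hic).resolve_left hbot

end ProjGeo
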